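/- Let G = SL(n,ℝ), let U = 𝕌ₙ be the subgroup of upper triangular matrices with all diagonal entries equal to 1, and let Γ be a discrete subgroup of G such that G/Γ has finite volume (there is a Borel fundamental domain for the right Γ-action on G of finite Haar measure). Let μ be a Borel probability measure on G/Γ that is invariant under left translation by every element of U and ergodic for the U-action (every measurable A ⊆ G/Γ with v⁻¹·A = A for all v ∈ U has μ(A) = 0 or μ(A) = 1). Then there exist a closed subgroup L of G and a point a ∈ G/Γ such that the orbit L·a is closed in G/Γ, μ(L·a) = 1, and μ is invariant under left translation by every element of L. -/

import Mathlib

open Matrix MatrixGroups Filter MeasureTheory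

noncomputable instance {n : ℕ} : TopologicalSpace (Matrix.SpecialLinearGroup (Fin n) ℝ) :=
  instTopologicalSpaceSubtype

noncomputable instance {n : ℕ} : MeasurableSpace (Matrix.SpecialLinearGroup (Fin n) ℝ) :=
  borel _

instance {n : ℕ} : BorelSpace (Matrix.SpecialLinearGroup (Fin n) ℝ) := ⟨rfl⟩

open scoped ENNReal Topology Pointwise

theorem maximal_ineq {H X : Type*} [Group H] [MeasurableSpace H] [MeasurableMul₂ H]
    [MeasurableSpace X] [MulAction H X] [MeasurableSMul₂ H X]
    (lam : Measure H) [SFinite lam] [lam.IsMulRightInvariant] (μ : Measure X) [SFinite μ]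
    (hμ : ∀ h : H, MeasurePreserving (fun x : X => h • x) μ μ)
    (B B' : ℕ → Set H) (hmono : Monotone B) (hBm : ∀ k, MeasurableSet (B k))
    (hBm' : ∀ k, MeasurableSet (B' k)) (h1 : ∀ k, (1 : H) ∈ B k)
    (hB1 : ∀ k, ∀ a ∈ B k, ∀ b ∈ B k, a⁻¹ * b ∈ B' k)
    (hB2 : ∀ k, ∀ a ∈ B k, ∀ b ∈ B k, a * b ∈ B' k)
    (C : ℝ≥0∞) (hC : ∀ k, lam (B' k) ≤ C * lam (B k))
    (hpos : ∀ k, lam (B k) ≠ 0) (hfin : ∀ k, lam (B' k) ≠ ⊤)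
    (f : X → ℝ≥0∞) (hf : Measurable f) (α : ℝ≥0∞) (N : ℕ) :
    α * μ {x | ∃ k ≤ N, α * lam (B k) < ∫⁻ v in B k, f (v • x) ∂lam} ≤
      C ^ 2 * ∫⁻ x, f x ∂μ := by
  set E : Set X := {x | ∃ k ≤ N, α * lam (B k) < ∫⁻ v in B k, f (v • x) ∂lam} with hE
  have hF : Measurable (fun p : X × H => f (p.2 • p.1)) :=
    hf.comp (measurable_snd.smul measurable_fst)
  have hEm : MeasurableSet E := by
    have : E = ⋃ k ∈ Finset.range (N+1), {x | α * lam (B k) < ∫⁻ v in B k, f (v • x) ∂lam} := by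
      ext x; simp [hE, Nat.lt_succ_iff]
    rw [this]
    refine Finset.measurableSet_biUnion _ fun k _ => ?_
    exact measurableSet_lt measurable_const (Measurable.lintegral_prod_right' hF)
  -- local step
  have key : ∀ x : X, α * lam {u ∈ B N | u • x ∈ E} ≤ C * ∫⁻ v in B' N, f (v • x) ∂lam := by
    intro x
    set Ex : Set H := {u ∈ B N | u • x ∈ E}
    have hk : ∀ u : H, ∃ k, u ∈ Ex → k ≤ N ∧ α * lam (B k) < ∫⁻ v in B k, f (v • (u • x)) ∂lam := by
      intro u
      by_cases hu : u ∈ Ex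
      · obtain ⟨k, hk, h⟩ := hu.2
        exact ⟨k, fun _ => ⟨hk, h⟩⟩
      · exact ⟨0, fun h => absurd h hu⟩
    choose k hk using hk
    let S : H → Set H := fun u => (fun v => v * u⁻¹) ⁻¹' (B (k u))
    have hSm : ∀ u, MeasurableSet (S u) := fun u => (measurable_mul_const _) (hBm _)
    have hSl : ∀ u, lam (S u) = lam (B (k u)) := fun u => measure_preimage_mul_right lam _ _
    have hSint : ∀ u, ∫⁻ v in S u, f (v • x) ∂lam = ∫⁻ v in B (k u), f (v • (u • x)) ∂lam := by
      intro u
      rw [← lintegral_indicator (hSm u), ← lintegral_indicator (hBm _)]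
      rw [← lintegral_mul_right_eq_self (μ := lam) _ u]
      congr 1; ext v
      have hv : v * u ∈ S u ↔ v ∈ B (k u) := by simp [S]
      by_cases h : v ∈ B (k u)
      · rw [Set.indicator_of_mem (hv.2 h), Set.indicator_of_mem h, smul_smul]
      · rw [Set.indicator_of_notMem (fun h' => h (hv.1 h')), Set.indicator_of_notMem h]
    obtain ⟨T, hT, hdisj, hcov⟩ := Vitali.exists_disjoint_subfamily_covering_enlargement
      S Ex (fun u => (2:ℝ) ^ (k u)) (3/2) (by norm_num) (fun u _ => by positivity)
      (2 ^ N) (fun u hu => by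
        exact pow_le_pow_right₀ (by norm_num) (hk u hu).1)
      (fun u hu => ⟨u, by simp [S, h1]⟩)
    have hSsub : ∀ u ∈ T, S u ⊆ B' N := by
      intro u hu v hv
      have := hB2 N _ (hmono (hk u (hT hu)).1 hv) u (hT hu).1
      simpa using this
    have hTc : T.Countable := by
      have h := Measure.countable_meas_pos_of_disjoint_iUnion (ι := T)
        (μ := lam.restrict (B' N)) (As := fun u => S u)
        (fun u => hSm u) (fun u v huv => hdisj u.2 v.2 (fun h => huv (Subtype.ext h)))
      have h2 : {i : T | 0 < (lam.restrict (B' N)) (S i)} = Set.univ := by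
        ext u
        simp only [Set.mem_setOf_eq, Set.mem_univ, iff_true]
        rw [Measure.restrict_apply (hSm u), Set.inter_eq_left.2 (hSsub u u.2), hSl]
        exact pos_iff_ne_zero.2 (hpos _)
      have : SFinite (lam.restrict (B' N)) := inferInstance
      rw [h2] at h
      exact Set.countable_coe_iff.1 (Set.countable_univ_iff.1 h)
    have hcover : Ex ⊆ ⋃ u ∈ T, (fun v => v * u⁻¹) ⁻¹' (B' (k u)) := by
      intro u hu
      obtain ⟨w, hw, ⟨z, hz1, hz2⟩, hle⟩ := hcov u hu
      simp only [Set.mem_iUnion, Set.mem_preimage]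
      refine ⟨w, hw, ?_⟩
      have hkk : k u ≤ k w := by
        by_contra hlt
        push Not at hlt
        have : (2:ℝ) ^ (k w + 1) ≤ 2 ^ (k u) := pow_le_pow_right₀ (by norm_num) hlt
        have h0 : (0:ℝ) < 2 ^ (k w) := by positivity
        rw [pow_succ] at this
        linarith
      have := hB1 (k w) _ (hmono hkk hz1) _ hz2
      simpa [mul_assoc] using this
    have := hTc.to_subtype
    calc α * lam Ex ≤ α * ∑' u : T, lam ((fun v => v * (u:H)⁻¹) ⁻¹' (B' (k u))) := by
          gcongr
          refine (measure_mono hcover).trans ?_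
          exact measure_biUnion_le _ hTc _
      _ ≤ α * ∑' u : T, C * lam (B (k u)) := by
          gcongr with u
          rw [measure_preimage_mul_right]
          exact hC _
      _ = C * ∑' u : T, α * lam (B (k u)) := by
          rw [ENNReal.tsum_mul_left, ENNReal.tsum_mul_left]; ring
      _ ≤ C * ∑' u : T, ∫⁻ v in S u, f (v • x) ∂lam := by
          gcongr with u
          rw [hSint]
          exact (hk u (hT u.2)).2.le
      _ = C * ∫⁻ v in ⋃ u ∈ T, S u, f (v • x) ∂lam := by
          rw [lintegral_biUnion hTc (fun u _ => hSm u) hdisj]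
      _ ≤ C * ∫⁻ v in B' N, f (v • x) ∂lam := by
          gcongr
          exact Set.iUnion₂_subset hSsub
  have hI := lintegral_mono (μ := μ) key
  have hL : ∫⁻ x, α * lam {u ∈ B N | u • x ∈ E} ∂μ = α * (lam (B N) * μ E) := by
    have hm : MeasurableSet {p : X × H | p.2 • p.1 ∈ E} :=
      (measurable_snd.smul measurable_fst) hEm
    have e1 : ∀ x, lam {u ∈ B N | u • x ∈ E} =
        ∫⁻ u in B N, (E.indicator 1 (u • x) : ℝ≥0∞) ∂lam := by
      intro x
      have hmx : MeasurableSet {u : H | u • x ∈ E} := (measurable_smul_const x) hEm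
      have : (fun u : H => (E.indicator 1 (u • x) : ℝ≥0∞)) =
        ({u : H | u • x ∈ E}).indicator 1 := by ext u; simp [Set.indicator]
      rw [this, lintegral_indicator_one hmx, Measure.restrict_apply hmx, Set.inter_comm]; rfl
    have hm2 : Measurable (fun p : X × H => (E.indicator 1 (p.2 • p.1) : ℝ≥0∞)) :=
      (measurable_one.indicator hEm).comp (measurable_snd.smul measurable_fst)
    simp_rw [e1]
    rw [lintegral_const_mul _ (Measurable.lintegral_prod_right' hm2), lintegral_lintegral_swap]
    · congr 1
      have : ∀ u : H, ∫⁻ x, (E.indicator 1 (u • x) : ℝ≥0∞) ∂μ = μ E := by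
        intro u
        rw [(hμ u).lintegral_comp (measurable_one.indicator hEm), lintegral_indicator_one hEm]
      simp_rw [this]
      simp [mul_comm]
    · exact hm2.aemeasurable
  have hR : ∫⁻ x, C * ∫⁻ v in B' N, f (v • x) ∂lam ∂μ = C * (lam (B' N) * ∫⁻ x, f x ∂μ) := by
    rw [lintegral_const_mul _ (Measurable.lintegral_prod_right' hF), lintegral_lintegral_swap]
    · congr 1
      have : ∀ u : H, ∫⁻ x, f (u • x) ∂μ = ∫⁻ x, f x ∂μ := fun u => (hμ u).lintegral_comp hf
      simp_rw [this]
      simp [mul_comm]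
    · exact hF.aemeasurable
  rw [hL, hR] at hI
  have hBfin : lam (B N) ≠ ⊤ := by
    refine ne_top_of_le_ne_top (hfin N) (measure_mono fun a ha => ?_)
    simpa using hB2 N a ha 1 (h1 N)
  have h3 : lam (B N) * (α * μ E) ≤ lam (B N) * (C ^ 2 * ∫⁻ x, f x ∂μ) := by
    calc lam (B N) * (α * μ E) = α * (lam (B N) * μ E) := by ring
      _ ≤ _ := hI
      _ ≤ C * ((C * lam (B N)) * ∫⁻ x, f x ∂μ) := by gcongr; exact hC N
      _ = _ := by ring
  exact (ENNReal.mul_le_mul_iff_right (hpos N) hBfin).1 h3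

theorem exists_dense_cc (X : Type*) [TopologicalSpace X] [LocallyCompactSpace X]
    [SecondCountableTopology X] [T2Space X] :
    ∃ D : ℕ → C(X, ℝ), (∀ i, HasCompactSupport (D i)) ∧
      ∀ f : X → ℝ, Continuous f → HasCompactSupport f → ∀ ε > 0, ∃ i, ∀ x, |f x - D i x| ≤ ε := by
  obtain ⟨d, hd⟩ := TopologicalSpace.exists_dense_seq C(X, ℝ)
  let K := CompactExhaustion.choice X
  have hχ : ∀ j, ∃ f : C(X, ℝ), Set.EqOn f 1 (K j) ∧ Set.EqOn f 0 ∅ ∧ HasCompactSupport f ∧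
      ∀ x, f x ∈ Set.Icc (0 : ℝ) 1 := fun j =>
    exists_continuous_one_zero_of_isCompact (K.isCompact j) isClosed_empty (by simp)
  choose χ h1 _ h3 h4 using hχ
  refine ⟨fun i => d i.unpair.1 * χ i.unpair.2, fun i => ?_, fun f hf hfs ε hε => ?_⟩
  · exact (h3 i.unpair.2).mul_left (f := d i.unpair.1)
  · obtain ⟨j, hj⟩ := K.exists_superset_of_isCompact hfs
    have hcl : (⟨f, hf⟩ : C(X, ℝ)) ∈ closure (Set.range d) := hd _
    obtain ⟨s, hs, hlim⟩ := mem_closure_iff_seq_limit.1 hcl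
    have hu := (ContinuousMap.tendsto_iff_forall_isCompact_tendstoUniformlyOn.1 hlim)
      (tsupport (χ j)) (h3 j)
    obtain ⟨m, hm⟩ := ((Metric.tendstoUniformlyOn_iff.1 hu) ε hε).exists
    obtain ⟨i, hi⟩ := hs m
    refine ⟨Nat.pair i j, fun x => ?_⟩
    simp only [Nat.unpair_pair, ContinuousMap.mul_apply, hi]
    have e : f x = f x * χ j x := by
      by_cases hx : x ∈ K j
      · rw [h1 j hx]; simp
      · have : f x = 0 := image_eq_zero_of_notMem_tsupport (fun h => hx (hj h))
        simp [this]
    rw [e, ← sub_mul, abs_mul]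
    by_cases hx : x ∈ tsupport (χ j)
    · have := hm x hx
      rw [Real.dist_eq] at this
      have h0 := (h4 j x)
      rw [abs_of_nonneg h0.1]
      have h5 : |f x - s m x| ≤ ε := this.le
      nlinarith [abs_nonneg (f x - s m x), h0.1, h0.2]
    · rw [image_eq_zero_of_notMem_tsupport hx]; simp [hε.le]

section equi
variable {H X : Type*} [Group H] [TopologicalSpace H] [IsTopologicalGroup H]
    [LocallyCompactSpace H] [SecondCountableTopology H] [T2Space H] [MeasurableSpace H]
    [BorelSpace H] [TopologicalSpace X] [SecondCountableTopology X] [MeasurableSpace X]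
    [BorelSpace X] [MulAction H X] [ContinuousSMul H X]

theorem erg_ae_inv (lam : Measure H) [lam.IsHaarMeasure] [lam.IsMulRightInvariant]
    (μ : Measure X) [IsProbabilityMeasure μ]
    (hμ : ∀ h : H, MeasurePreserving (fun x : X => h • x) μ μ)
    (herg : ∀ A : Set X, MeasurableSet A → (∀ v : H, (fun x => v • x) ⁻¹' A = A) →
      μ A = 0 ∨ μ A = 1)
    (E : Set X) (hE : MeasurableSet E)
    (hinv : ∀ h : H, ∀ᵐ x ∂μ, (h • x ∈ E ↔ x ∈ E)) : (∀ᵐ x ∂μ, x ∈ E) ∨ (∀ᵐ x ∂μ, x ∉ E) := by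
  let E' : Set X := {x | ∀ᵐ u ∂lam, u • x ∈ E}
  have hm : MeasurableSet {p : X × H | p.2 • p.1 ∈ E} :=
    (measurable_snd.smul measurable_fst) hE
  have hE' : MeasurableSet E' := by
    have : E' = (fun x => lam (Prod.mk x ⁻¹' {p : X × H | p.2 • p.1 ∈ E}ᶜ)) ⁻¹' {0} := by
      ext x; simp only [E', ae_iff]; rfl
    rw [this]
    exact (measurable_measure_prodMk_left hm.compl) (measurableSet_singleton 0)
  have hstr : ∀ v : H, (fun x => v • x) ⁻¹' E' = E' := by
    intro v
    ext x
    simp only [Set.mem_preimage, E', Set.mem_setOf_eq, smul_smul, ae_iff]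
    have := measure_preimage_mul_right lam v {a | ¬ a • x ∈ E}
    rw [← this]; rfl
  have hae : ∀ᵐ x ∂μ, ∀ᵐ u ∂lam, (u • x ∈ E ↔ x ∈ E) := by
    have hms : MeasurableSet {p : H × X | (p.1 • p.2 ∈ E ↔ p.2 ∈ E)} := by
      have h1 : MeasurableSet {p : H × X | p.1 • p.2 ∈ E} := (measurable_fst.smul measurable_snd) hE
      have h2 : MeasurableSet {p : H × X | p.2 ∈ E} := measurable_snd hE
      exact h1.iff h2
    have h1 : ∀ᵐ p ∂(lam.prod μ), (p.1 • p.2 ∈ E ↔ p.2 ∈ E) :=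
      (Measure.ae_prod_iff_ae_ae hms).2 (Eventually.of_forall hinv)
    have h2 := Measure.ae_ae_comm (μ := lam) (ν := μ) (p := fun u x => (u • x ∈ E ↔ x ∈ E)) hms
    exact h2.1 (Eventually.of_forall hinv)
  have hiff : ∀ᵐ x ∂μ, (x ∈ E ↔ x ∈ E') := by
    filter_upwards [hae] with x hx
    constructor
    · intro h; exact hx.mono fun u hu => hu.2 h
    · intro h
      obtain ⟨u, h1, h2⟩ := (hx.and h).exists
      exact h1.1 h2
  rcases herg E' hE' hstr with h | h
  · right
    have : ∀ᵐ x ∂μ, x ∉ E' := measure_eq_zero_iff_ae_notMem.1 h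
    filter_upwards [this, hiff] with x h1 h2 h3 using h1 (h2.1 h3)
  · left
    have : ∀ᵐ x ∂μ, x ∈ E' := (mem_ae_iff_prob_eq_one hE').2 h
    filter_upwards [this, hiff] with x h1 h2 using h2.2 h1

theorem erg_const (lam : Measure H) [lam.IsHaarMeasure] [lam.IsMulRightInvariant]
    (μ : Measure X) [IsProbabilityMeasure μ]
    (hμ : ∀ h : H, MeasurePreserving (fun x : X => h • x) μ μ)
    (herg : ∀ A : Set X, MeasurableSet A → (∀ v : H, (fun x => v • x) ⁻¹' A = A) →
      μ A = 0 ∨ μ A = 1)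
    (w : X → ℝ) (hw : Measurable w) (hinv : ∀ h : H, ∀ᵐ x ∂μ, w (h • x) = w x) :
    ∃ c, w =ᵐ[μ] fun _ => c :=
  exists_eventuallyEq_const_of_forall_separating MeasurableSet fun U hU =>
    erg_ae_inv lam μ hμ herg (w ⁻¹' U) (hw hU) fun h => by
      filter_upwards [hinv h] with x hx
      simp [hx]

/-- density of constants plus coboundaries -/
theorem cobdry_dense (lam : Measure H) [lam.IsHaarMeasure] [lam.IsMulRightInvariant]
    (μ : Measure X) [IsProbabilityMeasure μ]
    (hμ : ∀ h : H, MeasurePreserving (fun x : X => h • x) μ μ)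
    (herg : ∀ A : Set X, MeasurableSet A → (∀ v : H, (fun x => v • x) ⁻¹' A = A) →
      μ A = 0 ∨ μ A = 1)
    (P : (X → ℝ) → Prop) (hP0 : P 0) (hPadd : ∀ f g, P f → P g → P (f + g))
    (hPs : ∀ (c : ℝ) f, P f → P (c • f))
    (hPc : ∀ (A : Set X) (u : H), MeasurableSet A →
      P (fun x => A.indicator 1 x - A.indicator 1 (u • x)))
    (f : X → ℝ) (hf : MemLp f 2 μ) (ε : ℝ≥0∞) (hε : 0 < ε) :
    ∃ g, P g ∧ AEStronglyMeasurable g μ ∧ eLpNorm (f - (fun _ => ∫ x, f x ∂μ) - g) 1 μ ≤ ε := by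
  classical
  have hmp : ∀ (A : {A : Set X // MeasurableSet A}) (u : H),
      MeasurableSet ((fun x => u • x) ⁻¹' A.1) := fun A u => (measurable_const_smul u) A.2
  let F : {A : Set X // MeasurableSet A} × H → Lp ℝ 2 μ := fun p =>
    indicatorConstLp 2 p.1.2 (measure_ne_top μ _) 1 -
      indicatorConstLp 2 (hmp p.1 p.2) (measure_ne_top μ _) 1
  let V : Submodule ℝ (Lp ℝ 2 μ) := Submodule.span ℝ (Set.range F)
  have hV : ∀ v ∈ V, ∃ g, P g ∧ v =ᵐ[μ] g := by
    intro v hv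
    induction hv using Submodule.span_induction with
    | mem x h =>
      obtain ⟨⟨A, u⟩, rfl⟩ := h
      refine ⟨_, hPc A.1 u A.2, ?_⟩
      have h1 := Lp.coeFn_sub (indicatorConstLp 2 A.2 (measure_ne_top μ _) (1:ℝ))
        (indicatorConstLp 2 (hmp A u) (measure_ne_top μ _) (1:ℝ))
      have h2 := indicatorConstLp_coeFn (p := 2) (hs := A.2) (hμs := measure_ne_top μ _) (c := (1:ℝ))
      have h3 := indicatorConstLp_coeFn (p := 2) (hs := hmp A u)
        (hμs := measure_ne_top μ _) (c := (1:ℝ))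
      filter_upwards [h1, h2, h3] with x e1 e2 e3
      simp only [F]
      rw [e1, Pi.sub_apply, e2, e3]
      rfl
    | zero => exact ⟨0, hP0, Lp.coeFn_zero _ _ _⟩
    | add x y _ _ hx hy =>
      obtain ⟨g1, p1, e1⟩ := hx
      obtain ⟨g2, p2, e2⟩ := hy
      exact ⟨g1 + g2, hPadd _ _ p1 p2, (Lp.coeFn_add _ _).trans (e1.add e2)⟩
    | smul a x _ hx =>
      obtain ⟨g1, p1, e1⟩ := hx
      exact ⟨a • g1, hPs _ _ p1, (Lp.coeFn_smul _ _).trans (e1.const_smul a)⟩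
  set c : ℝ := ∫ x, f x ∂μ with hc
  have hfc : MemLp (f - fun _ => c) 2 μ := hf.sub (memLp_const c)
  let fL : Lp ℝ 2 μ := hfc.toLp
  have hmem : fL ∈ V.topologicalClosure := by
    rw [← Submodule.orthogonal_orthogonal_eq_closure]
    rw [Submodule.mem_orthogonal]
    intro w hw
    rw [Submodule.mem_orthogonal] at hw
    have hwi : Integrable w μ := (Lp.memLp w).integrable (by norm_num)
    have hset : ∀ (A : Set X) (hA : MeasurableSet A) (u : H),
        ∫ x in A, w x ∂μ = ∫ x in (fun x => u • x) ⁻¹' A, w x ∂μ := by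
      intro A hA u
      have := hw (F (⟨A, hA⟩, u)) (Submodule.subset_span ⟨_, rfl⟩)
      simp only [F, inner_sub_left] at this
      rw [L2.inner_indicatorConstLp_one, L2.inner_indicatorConstLp_one] at this
      linarith
    have hwm := (Lp.stronglyMeasurable w).measurable
    have hwinv : ∀ u : H, ∀ᵐ x ∂μ, w (u • x) = w x := by
      intro u
      refine Integrable.ae_eq_of_forall_setIntegral_eq _ _ ?_ hwi ?_
      · exact (hμ u).integrable_comp_of_integrable hwi
      · intro A hA _
        have h1 := hset A hA u⁻¹
        rw [h1]
        have h2 := (hμ u).setIntegral_preimage_emb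
          (MeasurableEquiv.smul u).measurableEmbedding w ((fun x => u⁻¹ • x) ⁻¹' A)
        have h3 : (fun x : X => u • x) ⁻¹' ((fun x => u⁻¹ • x) ⁻¹' A) = A := by
          ext x; simp
        rw [h3] at h2
        exact h2
    obtain ⟨d, hd⟩ := erg_const lam μ hμ herg w hwm hwinv
    rw [L2.inner_def]
    have : ∫ a, inner ℝ (w a) (fL a) ∂μ = ∫ a, (f a - c) * d ∂μ := by
      refine integral_congr_ae ?_
      filter_upwards [hd, hfc.coeFn_toLp] with x e1 e2
      simp only [fL]
      rw [e1, e2]; simp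
    rw [this, integral_mul_const, integral_sub (hf.integrable (by norm_num)) (integrable_const _)]
    simp [hc]
  have hcl : fL ∈ closure (V : Set (Lp ℝ 2 μ)) := hmem
  obtain ⟨v, hv, hdist⟩ := EMetric.mem_closure_iff.1 hcl ε hε
  obtain ⟨g, hg, hvg⟩ := hV v hv
  refine ⟨g, hg, (Lp.aestronglyMeasurable v).congr hvg, ?_⟩
  have hgm := (Lp.aestronglyMeasurable v).congr hvg
  refine (eLpNorm_le_eLpNorm_of_exponent_le (q := 2) (by norm_num)
    (hfc.aestronglyMeasurable.sub hgm)).trans ?_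
  rw [Lp.edist_def] at hdist
  refine le_of_eq_of_le (eLpNorm_congr_ae ?_) hdist.le
  filter_upwards [hvg, hfc.coeFn_toLp] with x e1 e2
  simp only [Pi.sub_apply, fL] at e2 ⊢
  rw [e1, e2]
end equi

section equi2
variable {H X : Type*} [Group H] [TopologicalSpace H] [IsTopologicalGroup H]
    [LocallyCompactSpace H] [SecondCountableTopology H] [T2Space H] [MeasurableSpace H]
    [BorelSpace H] [TopologicalSpace X] [SecondCountableTopology X] [MeasurableSpace X]
    [BorelSpace X] [MulAction H X] [ContinuousSMul H X]

theorem haar_scale (lam : Measure H) [lam.IsHaarMeasure] (T : H ≃ₜ* H) :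
    ∃ κ : ℝ≥0∞, κ ≠ 0 ∧ κ ≠ ⊤ ∧ ∀ F : H → ℝ≥0∞, Measurable F →
      ∫⁻ v, F (T.symm v) ∂lam = κ * ∫⁻ u, F u ∂lam := by
  have : (Measure.map T.symm lam).IsHaarMeasure :=
    MulEquiv.isHaarMeasure_map lam T.symm.toMulEquiv T.symm.continuous T.continuous
  have h := Measure.isMulLeftInvariant_eq_smul (Measure.map T.symm lam) lam
  refine ⟨(Measure.haarScalarFactor (Measure.map T.symm lam) lam : ℝ≥0∞), ?_,
    ENNReal.coe_ne_top, ?_⟩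
  · exact_mod_cast (Measure.haarScalarFactor_pos_of_isHaarMeasure _ _).ne'
  · intro F hF
    have hm : Measurable (T.symm : H → H) := T.symm.continuous.measurable
    rw [← lintegral_map hF hm]
    conv_lhs => rw [h]
    rw [lintegral_smul_measure]; rfl

theorem maximal_cor (lam : Measure H) [lam.IsHaarMeasure] [lam.IsMulRightInvariant]
    (μ : Measure X) [IsProbabilityMeasure μ]
    (hμ : ∀ h : H, MeasurePreserving (fun x : X => h • x) μ μ)
    (T : ℕ → H ≃ₜ* H)
    (hTB : ∀ K : Set H, IsCompact K → ∃ B, IsCompact B ∧ B ∈ 𝓝 (1 : H) ∧ K ⊆ B ∧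
      Monotone (fun k => T k '' B))
    (φ : H → ℝ) (hφ : Continuous φ) (hφs : HasCompactSupport φ) :
    ∃ Kc : ℝ≥0∞, Kc ≠ ⊤ ∧ ∀ e : X → ℝ≥0∞, Measurable e → ∀ α : ℝ≥0∞,
      α * μ {x | ∃ t, α < ∫⁻ u, ‖φ u‖ₑ * e (T t u • x) ∂lam} ≤ Kc * ∫⁻ x, e x ∂μ := by
  obtain ⟨B, hBc, hB1, hKB, hmono⟩ := hTB _ hφs
  obtain ⟨M, hM⟩ := hφs.exists_bound_of_continuous hφ
  set B' : Set H := (B⁻¹ * B) ∪ (B * B)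
  have hB'c : IsCompact B' := (hBc.inv.mul hBc).union (hBc.mul hBc)
  have hBm : MeasurableSet B := hBc.measurableSet
  have hBm' : MeasurableSet B' := hB'c.measurableSet
  have hBpos : lam B ≠ 0 := (Measure.measure_pos_of_mem_nhds lam hB1).ne'
  have hBfin : lam B ≠ ⊤ := hBc.measure_lt_top.ne
  have hBfin' : lam B' ≠ ⊤ := hB'c.measure_lt_top.ne
  choose κ κ0 κt hκ using fun k => haar_scale lam (T k)
  have him : ∀ k (S : Set H), T k '' S = (T k).symm ⁻¹' S := fun k S =>
    (T k).toEquiv.image_eq_preimage_symm S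
  have hmk : ∀ k (S : Set H), MeasurableSet S → MeasurableSet (T k '' S) := fun k S hS => by
    rw [him]; exact (T k).symm.continuous.measurable hS
  have hlam : ∀ k (S : Set H), MeasurableSet S → lam (T k '' S) = κ k * lam S := by
    intro k S hS
    have := hκ k (S.indicator 1) (measurable_one.indicator hS)
    rw [lintegral_indicator_one hS] at this
    rw [← this, ← lintegral_indicator_one (hmk k S hS)]
    congr 1; ext v
    rw [him]; rfl
  have hint : ∀ k (e : X → ℝ≥0∞), Measurable e → ∀ x,
      ∫⁻ v in T k '' B, e (v • x) ∂lam = κ k * ∫⁻ u in B, e (T k u • x) ∂lam := by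
    intro k e he x
    have hm : Measurable (fun u => e (T k u • x)) :=
      he.comp ((T k).continuous.measurable.smul_const x)
    have := hκ k (B.indicator fun u => e (T k u • x)) (hm.indicator hBm)
    rw [lintegral_indicator hBm] at this
    rw [← this, ← lintegral_indicator (hmk k B hBm)]
    congr 1; ext v
    rw [him]
    by_cases hv : (T k).symm v ∈ B
    · rw [Set.indicator_of_mem hv, Set.indicator_of_mem (by exact hv)]; simp
    · rw [Set.indicator_of_notMem hv, Set.indicator_of_notMem (by exact hv)]
  set M' : ℝ≥0∞ := ENNReal.ofReal M + 1
  have hM' : ∀ u, ‖φ u‖ₑ ≤ M' := fun u => by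
    rw [← ofReal_norm_eq_enorm]
    exact (ENNReal.ofReal_le_ofReal (hM u)).trans le_self_add
  have hM0 : M' ≠ 0 := by simp [M']
  have hMt : M' ≠ ⊤ := by simp [M']
  set C := lam B' / lam B
  refine ⟨M' * lam B * C ^ 2, ?_, fun e he α => ?_⟩
  · exact ENNReal.mul_ne_top (ENNReal.mul_ne_top hMt hBfin)
      (ENNReal.pow_ne_top (ENNReal.div_ne_top hBfin' hBpos))
  set α' : ℝ≥0∞ := α / (M' * lam B)
  have hα : α = (M' * lam B) * α' := by
    rw [ENNReal.mul_div_cancel (mul_ne_zero hM0 hBpos) (ENNReal.mul_ne_top hMt hBfin)]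
  have key : ∀ N, α' * μ {x | ∃ k ≤ N, α' * lam (T k '' B) < ∫⁻ v in T k '' B, e (v • x) ∂lam} ≤
      C ^ 2 * ∫⁻ x, e x ∂μ := by
    intro N
    refine maximal_ineq lam μ hμ (fun k => T k '' B) (fun k => T k '' B') hmono
      (fun k => hmk k B hBm) (fun k => hmk k B' hBm') (fun k => ⟨1, mem_of_mem_nhds hB1, map_one _⟩)
      ?_ ?_ C ?_ ?_ ?_ e he α' N
    · rintro k _ ⟨a, ha, rfl⟩ _ ⟨b, hb, rfl⟩
      exact ⟨a⁻¹ * b, Or.inl (Set.mul_mem_mul (Set.inv_mem_inv.2 ha) hb), by simp⟩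
    · rintro k _ ⟨a, ha, rfl⟩ _ ⟨b, hb, rfl⟩
      exact ⟨a * b, Or.inr (Set.mul_mem_mul ha hb), by simp⟩
    · intro k
      simp only [hlam k B hBm, hlam k B' hBm', C]
      rw [mul_left_comm, ENNReal.div_mul_cancel hBpos hBfin]
    · intro k; simp only [hlam k B hBm]; exact mul_ne_zero (κ0 k) hBpos
    · intro k; simp only [hlam k B' hBm']; exact ENNReal.mul_ne_top (κt k) hBfin'
  have hsub : {x | ∃ t, α < ∫⁻ u, ‖φ u‖ₑ * e (T t u • x) ∂lam} ⊆
      ⋃ N, {x | ∃ k ≤ N, α' * lam (T k '' B) < ∫⁻ v in T k '' B, e (v • x) ∂lam} := by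
    rintro x ⟨t, ht⟩
    refine Set.mem_iUnion.2 ⟨t, t, le_rfl, ?_⟩
    rw [hlam t B hBm, hint t e he]
    have h1 : ∫⁻ u, ‖φ u‖ₑ * e (T t u • x) ∂lam ≤ M' * ∫⁻ u in B, e (T t u • x) ∂lam := by
      rw [← lintegral_const_mul' _ _ hMt, ← lintegral_indicator hBm]
      refine lintegral_mono fun u => ?_
      by_cases hu : u ∈ B
      · rw [Set.indicator_of_mem hu]; gcongr; exact hM' u
      · have : φ u = 0 := image_eq_zero_of_notMem_tsupport fun h => hu (hKB h)
        simp [this]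
    have h2 : M' * (α' * lam B) < M' * ∫⁻ u in B, e (T t u • x) ∂lam := by
      calc M' * (α' * lam B) = α := by rw [hα]; ring
        _ < _ := ht.trans_le h1
    have h3 := (ENNReal.mul_lt_mul_iff_right hM0 hMt).1 h2
    calc α' * (κ t * lam B) = κ t * (α' * lam B) := by ring
      _ < _ := (ENNReal.mul_lt_mul_iff_right (κ0 t) (κt t)).2 h3
  calc α * μ {x | ∃ t, α < ∫⁻ u, ‖φ u‖ₑ * e (T t u • x) ∂lam}
      ≤ α * μ (⋃ N, {x | ∃ k ≤ N, α' * lam (T k '' B) < ∫⁻ v in T k '' B, e (v • x) ∂lam}) := by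
        gcongr
    _ = M' * lam B * (α' *
        μ (⋃ N, {x | ∃ k ≤ N, α' * lam (T k '' B) < ∫⁻ v in T k '' B, e (v • x) ∂lam})) := by
        conv_lhs => rw [hα]
        ring
    _ ≤ M' * lam B * (C ^ 2 * ∫⁻ x, e x ∂μ) := by
        refine mul_le_mul_right ?_ _
        rw [Monotone.measure_iUnion, ENNReal.mul_iSup]
        · exact iSup_le key
        · intro N N' h x hx
          obtain ⟨k, hk, hk'⟩ := hx
          exact ⟨k, hk.trans h, hk'⟩
    _ = _ := by ring

theorem L1_cont (lam : Measure H) [lam.IsHaarMeasure]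
    (φ : H → ℝ) (hφ : Continuous φ) (hφs : HasCompactSupport φ) :
    Tendsto (fun v : H => ∫ u, |φ u - φ (v⁻¹ * u)| ∂lam) (𝓝 1) (𝓝 0) := by
  obtain ⟨M, hM⟩ := hφs.exists_bound_of_continuous hφ
  obtain ⟨W, hW, hW1⟩ := exists_compact_mem_nhds (1 : H)
  set K : Set H := W * tsupport φ
  have hK : IsCompact K := hW.mul hφs
  have h0 : (0 : ℝ) = ∫ u, (0:ℝ) ∂lam := by simp
  rw [h0]
  refine tendsto_integral_filter_of_dominated_convergence (K.indicator fun _ => 2 * M) ?_ ?_ ?_ ?_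
  · exact Eventually.of_forall fun v => by
      have : Continuous fun u => |φ u - φ (v⁻¹ * u)| := by fun_prop
      exact this.aestronglyMeasurable
  · filter_upwards [hW1] with v hv
    refine Eventually.of_forall fun u => ?_
    by_cases hu : u ∈ K
    · rw [Set.indicator_of_mem hu, Real.norm_eq_abs, abs_abs]
      have h1 := hM u
      have h2 := hM (v⁻¹ * u)
      rw [Real.norm_eq_abs] at h1 h2
      exact (abs_sub _ _).trans (by linarith)
    · have e1 : φ u = 0 := image_eq_zero_of_notMem_tsupport fun h =>
        hu ⟨1, mem_of_mem_nhds hW1, u, h, by simp⟩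
      have e2 : φ (v⁻¹ * u) = 0 := image_eq_zero_of_notMem_tsupport fun h =>
        hu ⟨v, hv, _, h, by simp⟩
      rw [Set.indicator_of_notMem hu]; simp [e1, e2]
  · exact (integrable_indicator_iff hK.measurableSet).2
      (integrableOn_const hK.measure_lt_top.ne)
  · refine Eventually.of_forall fun u => ?_
    have hc : Continuous fun v : H => |φ u - φ (v⁻¹ * u)| := by fun_prop
    have := hc.tendsto 1
    simpa using this

theorem ae_equi (lam : Measure H) [lam.IsHaarMeasure] [lam.IsMulRightInvariant]
    (μ : Measure X) [IsProbabilityMeasure μ]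
    (hμ : ∀ h : H, MeasurePreserving (fun x : X => h • x) μ μ)
    (herg : ∀ A : Set X, MeasurableSet A → (∀ v : H, (fun x => v • x) ⁻¹' A = A) →
      μ A = 0 ∨ μ A = 1)
    (T : ℕ → H ≃ₜ* H) (hT0 : ∀ u, Tendsto (fun k => (T k).symm u) atTop (𝓝 1))
    (hTB : ∀ K : Set H, IsCompact K → ∃ B, IsCompact B ∧ B ∈ 𝓝 (1 : H) ∧ K ⊆ B ∧
      Monotone (fun k => T k '' B))
    (φ : H → ℝ) (hφ : Continuous φ) (hφs : HasCompactSupport φ)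
    (f : X → ℝ) (hf : Measurable f) (hfb : ∃ M, ∀ x, |f x| ≤ M) :
    ∀ᵐ x ∂μ, Tendsto (fun t => ∫ u, φ u * f (T t u • x) ∂lam) atTop
      (𝓝 ((∫ u, φ u ∂lam) * ∫ x, f x ∂μ)) := by
  set c := ∫ x, f x ∂μ
  have hφi : Integrable φ lam := hφ.integrable_of_hasCompactSupport hφs
  have hmeas : ∀ g : X → ℝ, Measurable g → ∀ t x, Measurable fun u => g (T t u • x) :=
    fun g hg t x => hg.comp ((T t).continuous.measurable.smul_const x)
  have hint : ∀ g : X → ℝ, Measurable g → (∃ M, ∀ x, |g x| ≤ M) → ∀ t x,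
      Integrable (fun u => φ u * g (T t u • x)) lam := by
    rintro g hg ⟨M, hM⟩ t x
    exact hφi.mul_bdd (c := M) (hmeas g hg t x).aestronglyMeasurable (Eventually.of_forall fun u => hM _)
  let P : (X → ℝ) → Prop := fun g => Measurable g ∧ (∃ M, ∀ x, |g x| ≤ M) ∧
    ∀ x, Tendsto (fun t => ∫ u, φ u * g (T t u • x) ∂lam) atTop (𝓝 0)
  have hP0 : P 0 := ⟨measurable_zero, ⟨0, by simp⟩, by simp⟩
  have hPadd : ∀ f g, P f → P g → P (f + g) := by
    rintro f g ⟨h1, ⟨M, h2⟩, h3⟩ ⟨k1, ⟨N, k2⟩, k3⟩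
    refine ⟨h1.add k1, ⟨M + N, fun x => (abs_add_le _ _).trans (add_le_add (h2 x) (k2 x))⟩,
      fun x => ?_⟩
    have := (h3 x).add (k3 x)
    rw [add_zero] at this
    refine this.congr fun t => ?_
    rw [← integral_add (hint f h1 ⟨M, h2⟩ t x) (hint g k1 ⟨N, k2⟩ t x)]
    congr 1; ext u; simp [mul_add]
  have hPs : ∀ (c : ℝ) f, P f → P (c • f) := by
    rintro c f ⟨h1, ⟨M, h2⟩, h3⟩
    refine ⟨h1.const_smul c, ⟨|c| * M, fun x => ?_⟩, fun x => ?_⟩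
    · rw [Pi.smul_apply, smul_eq_mul, abs_mul]; gcongr; exact h2 x
    · have := (h3 x).const_mul c
      rw [mul_zero] at this
      refine this.congr fun t => ?_
      rw [← integral_const_mul]
      congr 1; ext u; simp; ring
  have hPc : ∀ (A : Set X) (u : H), MeasurableSet A →
      P (fun x => A.indicator 1 x - A.indicator 1 (u • x)) := by
    intro A u0 hA
    have hA1 : Measurable (A.indicator (1 : X → ℝ)) := measurable_one.indicator hA
    have hAb : ∀ x, |A.indicator (1 : X → ℝ) x| ≤ 1 := fun x => by
      by_cases h : x ∈ A <;> simp [h]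
    refine ⟨hA1.sub (hA1.comp (measurable_const_smul u0)), ⟨2, fun x => ?_⟩, fun x => ?_⟩
    · have h1 := hAb x
      have h2 := hAb (u0 • x)
      exact (abs_sub _ _).trans (by linarith)
    · have h1 := (L1_cont lam φ hφ hφs).comp (hT0 u0)
      refine squeeze_zero_norm (fun t => ?_) h1
      set v := (T t).symm u0
      have e1 : ∫ u, φ u * A.indicator 1 (u0 • T t u • x) ∂lam =
          ∫ u, φ (v⁻¹ * u) * A.indicator 1 (T t u • x) ∂lam := by
        rw [← integral_mul_left_eq_self (fun u => φ (v⁻¹ * u) * A.indicator 1 (T t u • x)) v]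
        congr 1; ext u
        simp [v, mul_smul]
      have i1 := hint (A.indicator 1) hA1 ⟨1, hAb⟩ t x
      have i2 : Integrable (fun u => φ u * A.indicator 1 (u0 • T t u • x)) lam :=
        hint (fun x => A.indicator 1 (u0 • x)) (hA1.comp (measurable_const_smul u0))
          ⟨1, fun x => hAb _⟩ t x
      have i3 : Integrable (fun u => φ (v⁻¹ * u) * A.indicator 1 (T t u • x)) lam :=
        (hφi.comp_mul_left v⁻¹).mul_bdd (c := 1)
          (hmeas _ hA1 t x).aestronglyMeasurable (Eventually.of_forall fun u => hAb _)
      have e2 : ∫ u, φ u * (A.indicator 1 (T t u • x) - A.indicator 1 (u0 • T t u • x)) ∂lam =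
          ∫ u, (φ u - φ (v⁻¹ * u)) * A.indicator 1 (T t u • x) ∂lam := by
        simp_rw [mul_sub, sub_mul]
        rw [integral_sub i1 i2, integral_sub i1 i3, e1]
      rw [e2]
      refine (norm_integral_le_integral_norm _).trans (integral_mono_of_nonneg
        (Eventually.of_forall fun _ => norm_nonneg _)
        (hφi.sub (hφi.comp_mul_left v⁻¹)).abs (Eventually.of_forall fun u => ?_))
      simp only [norm_mul, Real.norm_eq_abs]
      exact mul_le_of_le_one_right (abs_nonneg _) (hAb _)
  obtain ⟨Kc, hKc, hmax⟩ := maximal_cor lam μ hμ T hTB φ hφ hφs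
  have hL2 : MemLp f 2 μ := by
    obtain ⟨M, hM⟩ := hfb
    exact MemLp.of_bound hf.aestronglyMeasurable M (Eventually.of_forall hM)
  have main : ∀ r : ℝ, 0 < r → ∀ᵐ x ∂μ, ∀ᶠ t in atTop,
      |∫ u, φ u * f (T t u • x) ∂lam - (∫ u, φ u ∂lam) * c| ≤ r := by
    intro r hr
    rw [ae_iff]
    set α : ℝ≥0∞ := ENNReal.ofReal (r / 2)
    have hα0 : α ≠ 0 := by simp [α, hr]
    have hαt : α ≠ ⊤ := ENNReal.ofReal_ne_top
    have bound : ∀ ε : ℝ≥0∞, 0 < ε → α * μ {x | ¬ ∀ᶠ t in atTop,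
        |∫ u, φ u * f (T t u • x) ∂lam - (∫ u, φ u ∂lam) * c| ≤ r} ≤ Kc * ε := by
      intro ε hε
      obtain ⟨g, ⟨hg1, ⟨M, hg2⟩, hg3⟩, -, hge⟩ :=
        cobdry_dense lam μ hμ herg P hP0 hPadd hPs hPc f hL2 ε hε
      set e : X → ℝ := f - (fun _ => c) - g with he
      have hem : Measurable e := (hf.sub measurable_const).sub hg1
      have heb : ∃ M, ∀ x, |e x| ≤ M := by
        obtain ⟨N, hN⟩ := hfb
        refine ⟨N + |c| + M, fun x => ?_⟩
        simp only [he, Pi.sub_apply]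
        exact (abs_sub _ _).trans (add_le_add ((abs_sub _ _).trans (add_le_add (hN x) le_rfl)) (hg2 x))
      rw [eLpNorm_one_eq_lintegral_enorm] at hge
      refine (mul_le_mul_right (measure_mono ?_) α).trans ((hmax (fun x => ‖e x‖ₑ) hem.enorm α).trans
        (mul_le_mul_right hge Kc))
      intro x hx
      by_contra hcon
      apply hx
      simp only [Set.mem_setOf_eq, not_exists, not_lt] at hcon
      have hg4 := (hg3 x).eventually (Metric.ball_mem_nhds 0 (half_pos hr))
      filter_upwards [hg4] with t ht
      have e1 : ∫ u, φ u * f (T t u • x) ∂lam - (∫ u, φ u ∂lam) * c =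
          ∫ u, φ u * g (T t u • x) ∂lam + ∫ u, φ u * e (T t u • x) ∂lam := by
        rw [← integral_mul_const, ← integral_sub (hint f hf hfb t x) (hφi.mul_const c),
          ← integral_add (hint g hg1 ⟨M, hg2⟩ t x) (hint e hem heb t x)]
        congr 1; ext u; simp [he]; ring
      have e2 : |∫ u, φ u * e (T t u • x) ∂lam| ≤ r / 2 := by
        have h1 : ‖∫ u, φ u * e (T t u • x) ∂lam‖ₑ ≤ α := by
          refine (enorm_integral_le_lintegral_enorm _).trans (le_trans (le_of_eq ?_) (hcon t))
          congr 1; ext u; rw [enorm_mul]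
        rw [← ofReal_norm_eq_enorm, ENNReal.ofReal_le_ofReal_iff (by linarith)] at h1
        exact h1
      rw [dist_zero_right, Real.norm_eq_abs] at ht
      rw [e1]
      exact (abs_add_le _ _).trans (by linarith)
    have h0 : α * μ {x | ¬ ∀ᶠ t in atTop,
        |∫ u, φ u * f (T t u • x) ∂lam - (∫ u, φ u ∂lam) * c| ≤ r} ≤ 0 := by
      have hlim : Tendsto (fun n : ℕ => Kc * ((n : ℝ≥0∞) + 1)⁻¹) atTop (𝓝 (Kc * 0)) := by
        refine ENNReal.Tendsto.const_mul ?_ (Or.inr hKc)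
        have := ENNReal.tendsto_inv_nat_nhds_zero.comp (tendsto_add_atTop_nat 1)
        simpa [Function.comp_def] using this
      rw [mul_zero] at hlim
      exact ge_of_tendsto' hlim fun n => bound _ (by simp)
    have := le_antisymm h0 bot_le
    exact (mul_eq_zero.1 this).resolve_left hα0
  have main2 : ∀ᵐ x ∂μ, ∀ j : ℕ, ∀ᶠ t in atTop,
      |∫ u, φ u * f (T t u • x) ∂lam - (∫ u, φ u ∂lam) * c| ≤ 1 / ((j : ℝ) + 1) :=
    ae_all_iff.2 fun j => main _ (by positivity)
  filter_upwards [main2] with x hx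
  rw [Metric.tendsto_nhds]
  intro ε hε
  obtain ⟨j, hj⟩ := exists_nat_one_div_lt hε
  filter_upwards [hx j] with t ht
  rw [Real.dist_eq]
  exact ht.trans_lt hj

end equi2

section equi3
variable {H X : Type*} [Group H] [TopologicalSpace H] [IsTopologicalGroup H]
    [LocallyCompactSpace H] [SecondCountableTopology H] [T2Space H] [MeasurableSpace H]
    [BorelSpace H] [TopologicalSpace X] [SecondCountableTopology X] [MeasurableSpace X]
    [BorelSpace X] [MulAction H X] [ContinuousSMul H X] [LocallyCompactSpace X] [T2Space X]

theorem exists_dense_cc2 :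
    ∃ D : ℕ → H → ℝ, (∀ i, Continuous (D i) ∧ HasCompactSupport (D i)) ∧
      ∀ (lam : Measure H) [IsFiniteMeasureOnCompacts lam], ∀ f : H → ℝ, Continuous f →
      HasCompactSupport f → ∀ ε > 0, ∃ i, ∫ x, |f x - D i x| ∂lam ≤ ε := by
  obtain ⟨d, hd, hd2⟩ := exists_dense_cc H
  let K := CompactExhaustion.choice H
  have hχ : ∀ j, ∃ f : C(H, ℝ), Set.EqOn f 1 (K j) ∧ Set.EqOn f 0 ∅ ∧ HasCompactSupport f ∧
      ∀ x, f x ∈ Set.Icc (0 : ℝ) 1 := fun j =>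
    exists_continuous_one_zero_of_isCompact (K.isCompact j) isClosed_empty (by simp)
  choose χ h1 _ h2 h3 using hχ
  refine ⟨fun m u => χ m.unpair.1 u * d m.unpair.2 u, fun i => ⟨by fun_prop, (h2 _).mul_right⟩, ?_⟩
  intro lam _ f hf hfs ε hε
  obtain ⟨j, hj⟩ := K.exists_superset_of_isCompact hfs
  have hχi : Integrable (χ j) lam := (χ j).continuous.integrable_of_hasCompactSupport (h2 j)
  have hI : 0 ≤ ∫ x, χ j x ∂lam := integral_nonneg fun x => (h3 j x).1
  obtain ⟨i, hi⟩ := hd2 f hf hfs (ε / (∫ x, χ j x ∂lam + 1)) (by positivity)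
  refine ⟨Nat.pair j i, ?_⟩
  simp only [Nat.unpair_pair]
  have hb : ∀ x, |f x - χ j x * d i x| ≤ χ j x * (ε / (∫ x, χ j x ∂lam + 1)) := by
    intro x
    have : f x = χ j x * f x := by
      by_cases hx : x ∈ tsupport f
      · rw [h1 j (hj hx)]; simp
      · rw [image_eq_zero_of_notMem_tsupport hx]; simp
    rw [this, ← mul_sub, abs_mul, abs_of_nonneg (h3 j x).1]
    exact mul_le_mul_of_nonneg_left (hi x) (h3 j x).1
  refine (integral_mono_of_nonneg (Eventually.of_forall fun _ => abs_nonneg _)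
    (hχi.mul_const _) (Eventually.of_forall hb)).trans ?_
  rw [integral_mul_const, mul_div_assoc', div_le_iff₀ (by positivity)]
  nlinarith

theorem unif_equi (lam : Measure H) [lam.IsHaarMeasure] [lam.IsMulRightInvariant]
    (μ : Measure X) [IsProbabilityMeasure μ]
    (hμ : ∀ h : H, MeasurePreserving (fun x : X => h • x) μ μ)
    (herg : ∀ A : Set X, MeasurableSet A → (∀ v : H, (fun x => v • x) ⁻¹' A = A) →
      μ A = 0 ∨ μ A = 1)
    (T : ℕ → H ≃ₜ* H) (hT0 : ∀ u, Tendsto (fun k => (T k).symm u) atTop (𝓝 1))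
    (hTB : ∀ K : Set H, IsCompact K → ∃ B, IsCompact B ∧ B ∈ 𝓝 (1 : H) ∧ K ⊆ B ∧
      Monotone (fun k => T k '' B)) (ε : ℝ≥0∞) (hε : 0 < ε) :
    ∃ Ω, MeasurableSet Ω ∧ μ Ωᶜ ≤ ε ∧ ∀ φ : H → ℝ, Continuous φ → HasCompactSupport φ →
      ∀ f : X → ℝ, Continuous f → HasCompactSupport f →
      TendstoUniformlyOn (fun t x => ∫ u, φ u * f (T t u • x) ∂lam)
        (fun _ => (∫ u, φ u ∂lam) * ∫ x, f x ∂μ) atTop Ω := by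
  obtain ⟨D, hD, hD2⟩ := exists_dense_cc2 (H := H)
  obtain ⟨E, hE, hE2⟩ := exists_dense_cc X
  obtain ⟨δ, hδ, hδs⟩ := ENNReal.exists_pos_sum_of_countable' hε.ne' (ℕ × ℕ)
  have hbd : ∀ (f : X → ℝ), Continuous f → HasCompactSupport f → ∃ M, ∀ x, |f x| ≤ M :=
    fun f hf hs => hs.exists_bound_of_continuous hf
  have eg : ∀ p : ℕ × ℕ, ∃ t, MeasurableSet t ∧ μ t ≤ δ p ∧
      TendstoUniformlyOn (fun t x => ∫ u, D p.1 u * E p.2 (T t u • x) ∂lam)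
        (fun _ => (∫ u, D p.1 u ∂lam) * ∫ x, E p.2 x ∂μ) atTop tᶜ := by
    intro p
    have hm : ∀ t, StronglyMeasurable (fun x : X => ∫ u, D p.1 u * E p.2 (T t u • x) ∂lam) := by
      intro t
      have : Continuous (fun q : X × H => D p.1 q.2 * E p.2 (T t q.2 • q.1)) := by
        have h1 := (hD p.1).1
        have h2 := (T t).continuous
        have h3 : Continuous (fun q : X × H => T t q.2) := h2.comp continuous_snd
        have h4 : Continuous (fun q : X × H => T t q.2 • q.1) := h3.smul continuous_fst
        exact (h1.comp continuous_snd).mul ((E p.2).continuous.comp h4)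
      exact this.stronglyMeasurable.integral_prod_right
    have := ae_equi lam μ hμ herg T hT0 hTB (D p.1) (hD p.1).1 (hD p.1).2 (E p.2)
      (E p.2).continuous.measurable (hbd _ (E p.2).continuous (hE p.2))
    obtain ⟨r, hr0, hr⟩ : ∃ r : ℝ, 0 < r ∧ ENNReal.ofReal r ≤ δ p := by
      obtain ⟨r, hr0, hr⟩ := ENNReal.lt_iff_exists_nnreal_btwn.1 (hδ p)
      exact ⟨r, by exact_mod_cast hr0, by simpa using hr.le⟩
    obtain ⟨t, ht1, ht2, ht3⟩ := tendstoUniformlyOn_of_ae_tendsto' hm stronglyMeasurable_const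
      this hr0
    exact ⟨t, ht1, ht2.trans hr, ht3⟩
  choose S hS hSm hSu using eg
  refine ⟨(⋃ p, S p)ᶜ, (MeasurableSet.iUnion hS).compl, ?_, ?_⟩
  · rw [compl_compl]
    exact (measure_iUnion_le S).trans ((ENNReal.tsum_le_tsum hSm).trans hδs.le)
  intro φ hφ hφs f hf hfs
  rw [Metric.tendstoUniformlyOn_iff]
  intro r hr
  obtain ⟨M, hM⟩ := hbd f hf hfs
  have hM0 : 0 ≤ M ∨ IsEmpty X := by
    rcases isEmpty_or_nonempty X with h | ⟨⟨x⟩⟩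
    · exact Or.inr h
    · exact Or.inl ((abs_nonneg _).trans (hM x))
  rcases hM0 with hM0 | hX
  swap
  · exact Eventually.of_forall fun t x => (hX.false x).elim
  obtain ⟨i, hi⟩ := hD2 lam φ hφ hφs (r / 8 / (M + 1)) (by positivity)
  set I := ∫ u, |D i u| ∂lam
  have hI0 : 0 ≤ I := integral_nonneg fun _ => abs_nonneg _
  set r2 := r / 8 / (I + 1)
  have hr2 : 0 < r2 := by positivity
  obtain ⟨j, hj⟩ := hE2 f hf hfs r2 hr2
  have hDi : Integrable (D i) lam := (hD i).1.integrable_of_hasCompactSupport (hD i).2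
  have hφi : Integrable φ lam := hφ.integrable_of_hasCompactSupport hφs
  have hdi : Integrable (fun u => |φ u - D i u|) lam := (hφi.sub hDi).abs
  have hu := (Metric.tendstoUniformlyOn_iff.1 (hSu (i, j))) (r / 8) (by positivity)
  have a1 : r / 8 / (M + 1) * M ≤ r / 8 := by
    rw [div_mul_eq_mul_div, div_le_iff₀ (by positivity)]; nlinarith
  have a2 : I * r2 ≤ r / 8 := by
    simp only [r2]
    rw [mul_div_assoc', div_le_iff₀ (by positivity)]; nlinarith
  -- generic bound
  have hfm : ∀ g : X → ℝ, Continuous g → ∀ t x, AEStronglyMeasurable (fun u => g (T t u • x)) lam :=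
    fun g hg t x => (hg.comp (((T t).continuous).smul continuous_const)).aestronglyMeasurable
  have gb : ∀ (t : ℕ) (x : X), |∫ u, φ u * f (T t u • x) ∂lam -
      ∫ u, D i u * E j (T t u • x) ∂lam| ≤ r / 4 := by
    intro t x
    have i1 : Integrable (fun u => φ u * f (T t u • x)) lam :=
      hφi.mul_bdd (c := M) (hfm f hf t x) (Eventually.of_forall fun u => hM _)
    obtain ⟨M', hM'⟩ := hbd _ (E j).continuous (hE j)
    have i2 : Integrable (fun u => D i u * E j (T t u • x)) lam :=
      hDi.mul_bdd (c := M') (hfm _ (E j).continuous t x) (Eventually.of_forall fun u => hM' _)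
    rw [← integral_sub i1 i2]
    refine abs_integral_le_integral_abs.trans ?_
    calc _ ≤ ∫ u, (|φ u - D i u| * M + |D i u| * r2) ∂lam := by
          refine integral_mono_of_nonneg (Eventually.of_forall fun _ => abs_nonneg _)
            ((hdi.mul_const _).add (hDi.abs.mul_const _)) (Eventually.of_forall fun u => ?_)
          have : φ u * f (T t u • x) - D i u * E j (T t u • x) =
            (φ u - D i u) * f (T t u • x) + D i u * (f (T t u • x) - E j (T t u • x)) := by ring
          simp only [this]
          refine (abs_add_le _ _).trans ?_
          rw [abs_mul, abs_mul]
          exact add_le_add (mul_le_mul_of_nonneg_left (hM _) (abs_nonneg _))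
            (mul_le_mul_of_nonneg_left (hj _) (abs_nonneg _))
      _ ≤ r / 4 := by
          rw [integral_add (hdi.mul_const _) (hDi.abs.mul_const _), integral_mul_const,
            integral_mul_const]
          have := mul_le_mul_of_nonneg_right hi hM0
          linarith
  have gc : |(∫ u, φ u ∂lam) * ∫ x, f x ∂μ - (∫ u, D i u ∂lam) * ∫ x, E j x ∂μ| ≤ r / 4 := by
    have b1 : |∫ u, φ u ∂lam - ∫ u, D i u ∂lam| ≤ r / 8 / (M + 1) := by
      rw [← integral_sub hφi hDi]
      exact abs_integral_le_integral_abs.trans hi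
    have b2 : |∫ x, f x ∂μ| ≤ M := by
      have := norm_integral_le_of_norm_le_const (μ := μ) (f := f) (C := M) (Eventually.of_forall hM)
      simpa using this
    have b3 : |∫ u, D i u ∂lam| ≤ I := abs_integral_le_integral_abs
    have b4 : |∫ x, f x ∂μ - ∫ x, E j x ∂μ| ≤ r2 := by
      rw [← integral_sub (hf.integrable_of_hasCompactSupport hfs)
        ((E j).continuous.integrable_of_hasCompactSupport (hE j))]
      have := norm_integral_le_of_norm_le_const (μ := μ) (f := fun x => f x - E j x) (C := r2)
        (Eventually.of_forall hj)
      simpa using this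
    have : (∫ u, φ u ∂lam) * ∫ x, f x ∂μ - (∫ u, D i u ∂lam) * ∫ x, E j x ∂μ =
      (∫ u, φ u ∂lam - ∫ u, D i u ∂lam) * ∫ x, f x ∂μ +
      (∫ u, D i u ∂lam) * (∫ x, f x ∂μ - ∫ x, E j x ∂μ) := by ring
    rw [this]
    refine (abs_add_le _ _).trans ?_
    rw [abs_mul, abs_mul]
    have c1 := mul_le_mul b1 b2 (abs_nonneg _) (by positivity)
    have c2 := mul_le_mul b3 b4 (abs_nonneg _) hI0
    linarith
  filter_upwards [hu] with t ht x hx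
  have hx' : x ∈ (S (i, j))ᶜ := fun h => hx (Set.mem_iUnion.2 ⟨_, h⟩)
  have := ht x hx'
  rw [Real.dist_eq] at this ⊢
  have g1 := gb t x
  rw [abs_lt] at *
  rw [abs_le] at *
  constructor <;> linarith [this.1, this.2, g1.1, g1.2, gc.1, gc.2]

theorem mod_spec (lam : Measure H) [lam.IsHaarMeasure] (g : H) (S : Set H) (hS : MeasurableSet S) :
    lam ((fun x => x * g) ⁻¹' S) = (Measure.modularCharacterFun g : ℝ≥0∞) * lam S := by
  have := Measure.map_right_mul_eq_modularCharacterFun_smul lam g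
  rw [← Measure.map_apply (measurable_mul_const g) hS, this]
  rfl

theorem mod_bdd : ∃ W ∈ 𝓝 (1 : H), ∃ C : ℝ, ∀ v ∈ W, (Measure.modularCharacterFun v : ℝ) ≤ C := by
  borelize H
  let lam : Measure H := Measure.haar
  obtain ⟨W, hWc, hW⟩ := exists_compact_mem_nhds (1 : H)
  have h1 : lam W ≠ 0 := (Measure.measure_pos_of_mem_nhds lam hW).ne'
  have h2 : lam W ≠ ⊤ := hWc.measure_lt_top.ne
  have h3 : lam (W * W⁻¹) ≠ ⊤ := (hWc.mul hWc.inv).measure_lt_top.ne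
  refine ⟨W, hW, (lam (W * W⁻¹) / lam W).toReal, fun v hv => ?_⟩
  have h4 := mod_spec lam v W hWc.measurableSet
  have h5 : (Measure.modularCharacterFun v : ℝ≥0∞) * lam W ≤ lam (W * W⁻¹) := by
    rw [← h4]
    refine measure_mono fun x hx => ⟨x * v, hx, v⁻¹, Set.inv_mem_inv.2 hv, by simp⟩
  have h6 := (ENNReal.le_div_iff_mul_le (Or.inl h1) (Or.inl h2)).2 h5
  have := ENNReal.toReal_mono (ENNReal.div_ne_top h3 h1) h6
  simpa using this

theorem mod_one_of_bdd (g : H) (C : ℝ)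
    (h : ∀ k : ℕ, (Measure.modularCharacterFun (g ^ k) : ℝ) ≤ C)
    (h' : ∀ k : ℕ, (Measure.modularCharacterFun (g⁻¹ ^ k) : ℝ) ≤ C) :
    Measure.modularCharacterFun g = 1 := by
  have hp : ∀ (g : H) (k : ℕ), Measure.modularCharacterFun (g ^ k) =
      Measure.modularCharacterFun g ^ k := fun g k => map_pow Measure.modularCharacter g k
  have key : ∀ g : H, (∀ k : ℕ, (Measure.modularCharacterFun (g ^ k) : ℝ) ≤ C) →
      (Measure.modularCharacterFun g : ℝ) ≤ 1 := by
    intro g h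
    by_contra hc
    push Not at hc
    obtain ⟨k, hk⟩ := pow_unbounded_of_one_lt C hc
    have := h k
    rw [hp] at this
    push_cast at this
    linarith
  have e : Measure.modularCharacterFun g * Measure.modularCharacterFun g⁻¹ = 1 := by
    rw [← Measure.modularCharacterFun_map_mul]; simp [Measure.modularCharacterFun_map_one]
  have e' : (Measure.modularCharacterFun g : ℝ) * Measure.modularCharacterFun g⁻¹ = 1 := by
    exact_mod_cast e
  have k1 := key g h
  have k2 := key _ h'
  have k0 : (0 : ℝ) ≤ Measure.modularCharacterFun g := NNReal.coe_nonneg _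
  have : (Measure.modularCharacterFun g : ℝ) = 1 := by nlinarith
  exact_mod_cast this

theorem mod_one_of_tendsto (g : H) (C : ℕ → H → H) (hC : ∀ u, Tendsto (fun k => C k u) atTop (𝓝 1))
    (hmod : ∀ k u, Measure.modularCharacterFun (C k u) = Measure.modularCharacterFun u) :
    Measure.modularCharacterFun g = 1 := by
  obtain ⟨W, hW, M, hM⟩ := mod_bdd (H := H)
  have key : ∀ u : H, (Measure.modularCharacterFun u : ℝ) ≤ M := by
    intro u
    obtain ⟨k, hk⟩ := ((hC u).eventually hW).exists
    have := hM _ hk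
    rwa [hmod] at this
  exact mod_one_of_bdd g M (fun k => key _) fun k => key _

theorem right_inv_of_mod (lam : Measure H) [lam.IsHaarMeasure]
    (h : ∀ g : H, Measure.modularCharacterFun g = 1) : lam.IsMulRightInvariant := by
  refine ⟨fun g => ?_⟩
  rw [Measure.map_right_mul_eq_modularCharacterFun_smul lam g, h, one_smul]

theorem mod_aut (T : H ≃ₜ* H) (u : H) :
    Measure.modularCharacterFun (T u) = Measure.modularCharacterFun u := by
  borelize H
  let lam : Measure H := Measure.haar
  obtain ⟨W, hWc, hW⟩ := exists_compact_mem_nhds (1 : H)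
  have h1 : lam W ≠ 0 := (Measure.measure_pos_of_mem_nhds lam hW).ne'
  have h2 : lam W ≠ ⊤ := hWc.measure_lt_top.ne
  obtain ⟨κ, k0, kt, hκ⟩ := haar_scale lam T
  have hm : Measurable (T.symm : H → H) := T.symm.continuous.measurable
  have hlam : ∀ (S : Set H), MeasurableSet S → lam (T.symm ⁻¹' S) = κ * lam S := by
    intro S hS
    have := hκ (S.indicator 1) (measurable_one.indicator hS)
    rw [lintegral_indicator_one hS] at this
    rw [← this, ← lintegral_indicator_one (hm hS)]
    rfl
  have hWm := hWc.measurableSet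
  have e1 := mod_spec lam (T u) (T.symm ⁻¹' W) (hm hWm)
  have e2 := mod_spec lam u W hWm
  have e3 : (fun x => x * T u) ⁻¹' (T.symm ⁻¹' W) = T.symm ⁻¹' ((fun x => x * u) ⁻¹' W) := by
    ext x; simp
  rw [e3, hlam _ (measurable_mul_const u hWm), hlam _ hWm, e2, ← mul_assoc, ← mul_assoc,
    mul_comm κ, mul_assoc, mul_assoc] at e1
  have := (ENNReal.mul_left_inj (mul_ne_zero k0 h1) (ENNReal.mul_ne_top kt h2)).1 e1
  exact_mod_cast this.symm

/-- A group contracted by automorphisms is unimodular. -/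
theorem unimod_of_contract (T : ℕ → H ≃ₜ* H)
    (hT0 : ∀ u, Tendsto (fun k => (T k).symm u) atTop (𝓝 1))
    (lam : Measure H) [lam.IsHaarMeasure] : lam.IsMulRightInvariant :=
  right_inv_of_mod lam fun g => mod_one_of_tendsto g (fun k => (T k).symm) hT0 fun k u =>
    mod_aut (T k).symm u
end equi3

section drift
variable {G X : Type*} [Group G] [TopologicalSpace G] [IsTopologicalGroup G]
    [LocallyCompactSpace G] [SecondCountableTopology G] [T2Space G] [MeasurableSpace G]
    [BorelSpace G] [TopologicalSpace X] [SecondCountableTopology X] [MeasurableSpace X]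
    [BorelSpace X] [MulAction G X] [ContinuousSMul G X] [LocallyCompactSpace X] [T2Space X]

theorem unif_smul (f : X → ℝ) (hf : Continuous f) (hfs : HasCompactSupport f) (c : ℕ → G) (c0 : G)
    (hc : Tendsto c atTop (𝓝 c0)) (ε : ℝ) (hε : 0 < ε) :
    ∀ᶠ n in atTop, ∀ y, |f (c n • y) - f (c0 • y)| ≤ ε := by
  obtain ⟨W, hWc, hW⟩ := exists_compact_mem_nhds c0
  have hK : IsCompact ((fun p : G × X => p.1 • p.2) '' (W⁻¹ ×ˢ tsupport f)) :=
    (hWc.inv.prod hfs).image continuous_smul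
  have h1 := hK.mem_uniformity_of_prod (f := fun (g : G) (y : X) => f (g • y)) (s := Set.univ)
    (q := c0) (by
      have : Continuous (Function.uncurry fun (g : G) (y : X) => f (g • y)) :=
        hf.comp continuous_smul
      exact this.continuousOn) (Set.mem_univ _) (Metric.dist_mem_uniformity hε)
  rw [nhdsWithin_univ] at h1
  obtain ⟨V, hV, h1⟩ := h1
  filter_upwards [hc.eventually hV, hc.eventually hW] with n hn hn2 y
  by_cases hy : y ∈ (fun p : G × X => p.1 • p.2) '' (W⁻¹ ×ˢ tsupport f)
  · exact (h1 _ hn y hy).le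
  · have z : ∀ g ∈ W, f (g • y) = 0 := fun g hg => by
      refine image_eq_zero_of_notMem_tsupport fun h => hy ?_
      exact ⟨(g⁻¹, g • y), ⟨Set.inv_mem_inv.2 hg, h⟩, by simp⟩
    rw [z _ hn2, z _ (mem_of_mem_nhds hW)]; simp [hε.le]

theorem avg_swap (U : Subgroup G) (muG : Measure G) [IsFiniteMeasureOnCompacts muG]
    [muG.IsMulRightInvariant] (lam : Measure U) [IsFiniteMeasureOnCompacts lam]
    (φ : U → ℝ) (hφ : Continuous φ) (hφs : HasCompactSupport φ) (h1 : ∫ v, φ v ∂lam = 1)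
    (Ψ : G → ℝ) (hΨ : Continuous Ψ) (hΨs : HasCompactSupport Ψ) :
    ∫ g, Ψ g ∂muG = ∫ g, ∫ v, φ v * Ψ (g * v) ∂lam ∂muG := by
  have hc : Continuous (Function.uncurry fun (g : G) (v : U) => φ v * Ψ (g * v)) := by
    simp only [Function.uncurry_def]; fun_prop
  have hK : IsCompact ((fun p : G × U => (p.1 * (p.2 : G)⁻¹, p.2)) '' (tsupport Ψ ×ˢ tsupport φ)) :=
    (hΨs.prod hφs).image (by fun_prop)
  have hs : HasCompactSupport (Function.uncurry fun (g : G) (v : U) => φ v * Ψ (g * v)) := by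
    refine HasCompactSupport.intro hK fun p hp => ?_
    by_contra hne
    apply hp
    simp only [Function.uncurry_def] at hne
    refine ⟨(p.1 * p.2, p.2), ⟨subset_tsupport _ (right_ne_zero_of_mul hne),
      subset_tsupport _ (left_ne_zero_of_mul hne)⟩, by simp⟩
  rw [integral_integral_swap_of_hasCompactSupport hc hs]
  have : ∀ v : U, ∫ g, φ v * Ψ (g * v) ∂muG = φ v * ∫ g, Ψ g ∂muG := fun v => by
    rw [integral_const_mul, integral_mul_right_eq_self]
  simp_rw [this]
  rw [integral_mul_const, h1, one_mul]

theorem exists_bump (H : Type*) [TopologicalSpace H] [LocallyCompactSpace H] [T2Space H]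
    [MeasurableSpace H] [BorelSpace H] (lam : Measure H) [lam.IsOpenPosMeasure]
    [IsFiniteMeasureOnCompacts lam] (p : H)
    (N : Set H) (hN : N ∈ 𝓝 p) : ∃ φ : H → ℝ, Continuous φ ∧ HasCompactSupport φ ∧
      (∀ v, 0 ≤ φ v) ∧ φ p ≠ 0 ∧
      (∀ v, φ v ≠ 0 → v ∈ N) ∧ ∫ v, φ v ∂lam = 1 := by
  obtain ⟨f, f1, f2, f3, f4⟩ := exists_continuous_one_zero_of_isCompact (isCompact_singleton (x := p))
    (isOpen_interior (s := N)).isClosed_compl (by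
      simpa using mem_interior_iff_mem_nhds.2 hN)
  have hp : 0 < ∫ v, f v ∂lam :=
    f.continuous.integral_pos_of_hasCompactSupport_nonneg_nonzero f3 (fun v => (f4 v).1) (x := p)
      (by rw [f1 rfl]; simp)
  refine ⟨fun v => f v * (∫ v, f v ∂lam)⁻¹, by fun_prop, f3.mul_right,
    fun v => mul_nonneg (f4 v).1 (by positivity), ?_, ?_, ?_⟩
  · simp only [f1 rfl]; simp [hp.ne']
  · intro v hv
    by_contra hvN
    exact hv (by simp only [f2 (fun h => hvN (interior_subset h))]; simp)
  · rw [integral_mul_const, mul_inv_cancel₀ hp.ne']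

variable (μ : Measure X) [IsProbabilityMeasure μ]

theorem F_cont (f : X → ℝ) (hf : Continuous f) (hfs : HasCompactSupport f) :
    Continuous fun g : G => ∫ y, f (g • y) ∂μ := by
  obtain ⟨M, hM⟩ := hfs.exists_bound_of_continuous hf
  refine continuous_of_dominated (bound := fun _ => M) (fun g => ?_) (fun g => ?_) ?_ ?_
  · exact (hf.comp (continuous_const_smul g)).aestronglyMeasurable
  · exact Eventually.of_forall fun y => hM _
  · exact integrable_const _
  · exact Eventually.of_forall fun y => by fun_prop

theorem drift_lim (U : Subgroup G) [LocallyCompactSpace U] (muG : Measure G)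
    [IsFiniteMeasureOnCompacts muG]
    [muG.IsMulRightInvariant] (lam : Measure U) [lam.IsHaarMeasure]
    (Ω : Set X) (b : ℕ → G)
    (hΩ : ∀ φ : U → ℝ, Continuous φ → HasCompactSupport φ →
      ∀ f : X → ℝ, Continuous f → HasCompactSupport f →
      TendstoUniformlyOn (fun t x => ∫ u : U, φ u * f ((b t * u * (b t)⁻¹) • x) ∂lam)
        (fun _ => (∫ u, φ u ∂lam) * ∫ x, f x ∂μ) atTop Ω)
    (O : Set G) (hO : IsOpen O) (lo up a : G → G) (ha : ContinuousOn a O)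
    (hup : ∀ g ∈ O, up g ∈ U) (hlu : ∀ g ∈ O, lo g * up g = g)
    (hav : ∀ g ∈ O, ∀ v ∈ U, g * v ∈ O → a (g * v) = a g)
    (hconj : ∀ g ∈ O, Tendsto (fun t => b t * lo g * (b t)⁻¹) atTop (𝓝 (a g)))
    (x : ℕ → X) (hx : ∀ n, x n ∈ Ω) (t : ℕ → ℕ) (ht : Tendsto t atTop atTop)
    (Φ : G → ℝ) (hΦ : Continuous Φ) (hΦs : HasCompactSupport Φ) (hΦO : tsupport Φ ⊆ O)
    (f : X → ℝ) (hf : Continuous f) (hfs : HasCompactSupport f) :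
    Tendsto (fun n => ∫ g, Φ g * f ((b (t n) * g * (b (t n))⁻¹) • x n) ∂muG) atTop
      (𝓝 (∫ g, Φ g * (∫ y, f (a g • y) ∂μ) ∂muG)) := by
  obtain ⟨V, hV, hVO⟩ := compact_open_separated_mul_right hΦs hO hΦO
  obtain ⟨φ, hφ, hφs, hφ0, -, hφV, hφ1⟩ := exists_bump U lam 1 {v : U | (v : G)⁻¹ ∈ V} (by
    have hc : Continuous fun v : U => (v : G)⁻¹ := by fun_prop
    exact hc.continuousAt.preimage_mem_nhds (by simpa using hV))
  have hgO : ∀ g (v : U), φ v * Φ (g * v) ≠ 0 → g ∈ O := fun g v h => by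
    have h1 := hφV v (left_ne_zero_of_mul h)
    exact hVO ⟨g * v, subset_tsupport _ (right_ne_zero_of_mul h), _, h1, by simp⟩
  obtain ⟨M, hM⟩ := hfs.exists_bound_of_continuous hf
  haveI : SecondCountableTopology U := TopologicalSpace.Subtype.secondCountableTopology (U : Set G)
  haveI : SigmaCompactSpace U := sigmaCompactSpace_of_locallyCompact_secondCountable
  haveI : SFinite lam := inferInstance
  obtain ⟨M', hM'⟩ := hΦs.exists_bound_of_continuous hΦ
  have hF := F_cont (G := G) μ f hf hfs
  set F : G → ℝ := fun g => ∫ y, f (g • y) ∂μ with hFdef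
  have hψ : Continuous fun g => Φ g * F (a g) := by
    rw [continuous_iff_continuousAt]
    intro g
    by_cases hg : g ∈ tsupport Φ
    · exact hΦ.continuousAt.mul
        (hF.continuousAt.comp (ha.continuousAt (hO.mem_nhds (hΦO hg))))
    · have : (fun g => Φ g * F (a g)) =ᶠ[𝓝 g] fun _ => 0 := by
        filter_upwards [(isClosed_tsupport Φ).isOpen_compl.mem_nhds hg] with g' hg'
        rw [image_eq_zero_of_notMem_tsupport hg', zero_mul]
      exact (continuousAt_const).congr this.symm
  rw [avg_swap U muG lam φ hφ hφs hφ1 _ hψ hΦs.mul_right]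
  have hcn : ∀ n, Continuous fun g => f ((b (t n) * g * (b (t n))⁻¹) • x n) := fun n => by fun_prop
  have : ∀ n, ∫ g, Φ g * f ((b (t n) * g * (b (t n))⁻¹) • x n) ∂muG = _ := fun n =>
    avg_swap U muG lam φ hφ hφs hφ1 (fun g => Φ g * f ((b (t n) * g * (b (t n))⁻¹) • x n))
      (hΦ.mul (hcn n)) hΦs.mul_right
  simp_rw [this]
  have hφi : Integrable φ lam := hφ.integrable_of_hasCompactSupport hφs
  set K : Set G := tsupport Φ * ((fun v : U => (v : G)⁻¹) '' tsupport φ)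
  have hK : IsCompact K := hΦs.mul (hφs.image (by fun_prop))
  have hgK : ∀ g (v : U), φ v * Φ (g * v) ≠ 0 → g ∈ K := fun g v h =>
    ⟨g * v, subset_tsupport _ (right_ne_zero_of_mul h), _,
      ⟨v, subset_tsupport _ (left_ne_zero_of_mul h), rfl⟩, by simp⟩
  refine tendsto_integral_filter_of_dominated_convergence
    (K.indicator fun _ => ∫ v, |φ v| * (M' * M) ∂lam) ?_ ?_ ?_ ?_
  · refine Eventually.of_forall fun n => ?_
    have h2 := hcn n
    have : Continuous fun p : G × U =>
      φ p.2 * (Φ (p.1 * p.2) * f ((b (t n) * (p.1 * p.2) * (b (t n))⁻¹) • x n)) := by fun_prop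
    exact this.stronglyMeasurable.integral_prod_right.aestronglyMeasurable
  · refine Eventually.of_forall fun n => Eventually.of_forall fun g => ?_
    by_cases hg : g ∈ K
    · rw [Set.indicator_of_mem hg]
      refine norm_integral_le_of_norm_le (hφi.abs.mul_const _) (Eventually.of_forall fun v => ?_)
      rw [norm_mul, norm_mul, Real.norm_eq_abs]
      gcongr
      · exact (norm_nonneg _).trans (hM' (g * v))
      · exact hM' _
      · exact hM _
    · rw [Set.indicator_of_notMem hg]
      have : ∀ v : U, φ v * (Φ (g * v) * f ((b (t n) * (g * v) * (b (t n))⁻¹) • x n)) = 0 :=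
        fun v => by
          rw [← mul_assoc]
          by_cases h : φ v * Φ (g * v) = 0
          · rw [h, zero_mul]
          · exact (hg (hgK g v h)).elim
      simp [this]
  · exact (integrable_indicator_iff hK.measurableSet).2
      (integrableOn_const hK.measure_lt_top.ne)
  refine Eventually.of_forall fun g => ?_
  by_cases hg : g ∈ O
  swap
  · have z : ∀ (v : U), φ v * Φ (g * v) = 0 := fun v => by
      by_contra h; exact hg (hgO g v h)
    simp only [← mul_assoc, z, zero_mul, integral_zero]
    exact tendsto_const_nhds
  have e0 : ∀ v : U, φ v * (Φ (g * v) * F (a (g * v))) = (φ v * Φ (g * v)) * F (a g) := fun v => by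
    by_cases h : Φ (g * v) = 0
    · simp [h]
    · rw [hav g hg v v.2 (hΦO (subset_tsupport _ h)), mul_assoc]
  simp_rw [e0]
  rw [integral_mul_const]
  set u0 : U := ⟨up g, hup g hg⟩
  set φg : U → ℝ := fun v => φ (u0⁻¹ * v) * Φ (lo g * v)
  have hφg : Continuous φg := by fun_prop
  have hφgs : HasCompactSupport φg :=
    HasCompactSupport.mul_right (hφs.comp_homeomorph (Homeomorph.mulLeft u0⁻¹))
  have hφgi : Integrable φg lam := hφg.integrable_of_hasCompactSupport hφgs
  have eg : ∀ v : U, lo g * ((u0 * v : U) : G) = g * v := fun v => by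
    rw [Subgroup.coe_mul, ← mul_assoc]; congr 1; exact hlu g hg
  have e1 : ∫ v, φ v * Φ (g * v) ∂lam = ∫ v, φg v ∂lam := by
    rw [← integral_mul_left_eq_self φg u0]
    congr 1; ext v
    simp only [φg, eg]; simp
  rw [e1]
  set c : ℕ → G := fun n => b (t n) * lo g * (b (t n))⁻¹
  have e2 : ∀ n, ∫ v : U, φ v * (Φ (g * v) * f ((b (t n) * (g * v) * (b (t n))⁻¹) • x n)) ∂lam =
      ∫ v : U, φg v * f (c n • (b (t n) * v * (b (t n))⁻¹) • x n) ∂lam := by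
    intro n
    rw [← integral_mul_left_eq_self (fun v : U =>
      φg v * f (c n • (b (t n) * v * (b (t n))⁻¹) • x n)) u0]
    congr 1; ext v
    have : c n • (b (t n) * ((u0 * v : U) : G) * (b (t n))⁻¹) • x n =
        (b (t n) * (g * v) * (b (t n))⁻¹) • x n := by
      rw [← eg v, smul_smul]; simp only [c]; congr 1; group
    simp only [this]
    simp only [φg, eg]; simp [mul_assoc]
  simp_rw [e2]
  have hc : Tendsto c atTop (𝓝 (a g)) := (hconj g hg).comp ht
  have l1 : Tendsto (fun n => ∫ v : U, φg v * f (a g • (b (t n) * v * (b (t n))⁻¹) • x n) ∂lam) atTop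
      (𝓝 ((∫ v, φg v ∂lam) * F (a g))) := by
    have := hΩ φg hφg hφgs (fun y => f (a g • y)) (by fun_prop)
      (hfs.comp_homeomorph (Homeomorph.smul (a g)))
    rw [Metric.tendstoUniformlyOn_iff] at this
    rw [Metric.tendsto_nhds]
    intro ε hε
    filter_upwards [ht.eventually (this ε hε)] with n hn
    rw [dist_comm]; exact hn _ (hx n)
  have l2 : Tendsto (fun n => ∫ v : U, φg v * f (c n • (b (t n) * v * (b (t n))⁻¹) • x n) ∂lam -
      ∫ v : U, φg v * f (a g • (b (t n) * v * (b (t n))⁻¹) • x n) ∂lam) atTop (𝓝 0) := by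
    rw [Metric.tendsto_nhds]
    intro ε hε
    set I := ∫ v, |φg v| ∂lam
    have hI : 0 ≤ I := integral_nonneg fun _ => abs_nonneg _
    filter_upwards [unif_smul f hf hfs c (a g) hc (ε / (I + 1)) (by positivity)] with n hn
    have hcc : ∀ c : G, Integrable (fun v : U => φg v * f (c • (b (t n) * v * (b (t n))⁻¹) • x n)) lam :=
      fun c => (hφg.mul (by fun_prop)).integrable_of_hasCompactSupport hφgs.mul_right
    rw [dist_zero_right, ← integral_sub (hcc _) (hcc _)]
    refine lt_of_le_of_lt (norm_integral_le_of_norm_le (hφgi.abs.mul_const (ε / (I + 1)))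
      (Eventually.of_forall fun v => ?_)) ?_
    · rw [← mul_sub, norm_mul, Real.norm_eq_abs]
      exact mul_le_mul_of_nonneg_left (hn _) (abs_nonneg _)
    · rw [integral_mul_const, mul_div_assoc', div_lt_iff₀ (by positivity)]
      nlinarith
  have := l2.add l1
  simpa using this

theorem drift_inv (U : Subgroup G) [LocallyCompactSpace U] (muG : Measure G)
    [IsFiniteMeasureOnCompacts muG] [muG.IsOpenPosMeasure]
    [muG.IsMulRightInvariant] (lam : Measure U) [lam.IsHaarMeasure]
    (Ω : Set X) (b : ℕ → G)
    (hΩ : ∀ φ : U → ℝ, Continuous φ → HasCompactSupport φ →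
      ∀ f : X → ℝ, Continuous f → HasCompactSupport f →
      TendstoUniformlyOn (fun t x => ∫ u : U, φ u * f ((b t * u * (b t)⁻¹) • x) ∂lam)
        (fun _ => (∫ u, φ u ∂lam) * ∫ x, f x ∂μ) atTop Ω)
    (O : Set G) (hO : IsOpen O) (lo up a : G → G) (ha : ContinuousOn a O)
    (hup : ∀ g ∈ O, up g ∈ U) (hlu : ∀ g ∈ O, lo g * up g = g)
    (hav : ∀ g ∈ O, ∀ v ∈ U, g * v ∈ O → a (g * v) = a g)
    (hconj : ∀ g ∈ O, Tendsto (fun t => b t * lo g * (b t)⁻¹) atTop (𝓝 (a g)))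
    (x : ℕ → X) (hx : ∀ n, x n ∈ Ω) (t : ℕ → ℕ) (ht : Tendsto t atTop atTop)
    (γ : ℕ → G) (hy : ∀ n, γ n • x n ∈ Ω) (h : G)
    (hγ : Tendsto (fun n => (b (t n))⁻¹ * γ n * b (t n)) atTop (𝓝 h))
    (g : G) (hg : g ∈ O) (hgh : g * h ∈ O)
    (f : X → ℝ) (hf : Continuous f) (hfs : HasCompactSupport f) :
    ∫ y, f (a g • y) ∂μ = ∫ y, f (a (g * h) • y) ∂μ := by
  have hF := F_cont (G := G) μ f hf hfs
  set F : G → ℝ := fun g => ∫ y, f (g • y) ∂μ with hFdef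
  change F (a g) = F (a (g * h))
  obtain ⟨M, hM⟩ := hfs.exists_bound_of_continuous hf
  set O' : Set G := O ∩ (fun g => g * h) ⁻¹' O
  have hO' : IsOpen O' := hO.inter (hO.preimage (continuous_mul_const h))
  -- the key identity
  have key : ∀ Φ : G → ℝ, Continuous Φ → HasCompactSupport Φ → tsupport Φ ⊆ O' →
      ∫ g, Φ g * F (a g) ∂muG = ∫ g, Φ g * F (a (g * h)) ∂muG := by
    intro Φ hΦ hΦs hΦO
    have L1 := drift_lim μ U muG lam Ω b hΩ O hO lo up a ha hup hlu hav hconj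
      (fun n => γ n • x n) hy t ht Φ hΦ hΦs (hΦO.trans Set.inter_subset_left) f hf hfs
    have hΦ2s : HasCompactSupport fun g => Φ (g * h⁻¹) :=
      hΦs.comp_homeomorph (Homeomorph.mulRight h⁻¹)
    have L2 := drift_lim μ U muG lam Ω b hΩ O hO lo up a ha hup hlu hav hconj
      x hx t ht (fun g => Φ (g * h⁻¹)) (by fun_prop) hΦ2s (by
        intro g hg
        have : g * h⁻¹ ∈ tsupport Φ :=
          tsupport_comp_subset_preimage Φ (f := fun g => g * h⁻¹) (continuous_mul_const h⁻¹) hg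
        have := (hΦO this).2
        simpa using this) f hf hfs
    set q : ℕ → G := fun n => (b (t n))⁻¹ * γ n * b (t n)
    have e1 : ∀ n, ∫ g, Φ g * f ((b (t n) * g * (b (t n))⁻¹) • γ n • x n) ∂muG =
        ∫ g, Φ (g * (q n)⁻¹) * f ((b (t n) * g * (b (t n))⁻¹) • x n) ∂muG := by
      intro n
      rw [← integral_mul_right_eq_self (fun g =>
        Φ (g * (q n)⁻¹) * f ((b (t n) * g * (b (t n))⁻¹) • x n)) (q n)]
      congr 1; ext g
      rw [smul_smul]
      congr 2
      · simp
      · simp only [q]; congr 1; group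
    have L3 : Tendsto (fun n => ∫ g, Φ (g * (q n)⁻¹) * f ((b (t n) * g * (b (t n))⁻¹) • x n) ∂muG -
        ∫ g, Φ (g * h⁻¹) * f ((b (t n) * g * (b (t n))⁻¹) • x n) ∂muG) atTop (𝓝 0) := by
      obtain ⟨W, hWc, hW⟩ := exists_compact_mem_nhds h
      have hK : IsCompact (tsupport Φ * W) := hΦs.mul hWc
      obtain ⟨M', hM'⟩ := hΦs.exists_bound_of_continuous hΦ
      have : Tendsto (fun n => ∫ g, (Φ (g * (q n)⁻¹) - Φ (g * h⁻¹)) *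
          f ((b (t n) * g * (b (t n))⁻¹) • x n) ∂muG) atTop (𝓝 (∫ g, (0 : ℝ) ∂muG)) := by
        refine tendsto_integral_filter_of_dominated_convergence
          ((tsupport Φ * W).indicator fun _ => (M' + M') * M) ?_ ?_ ?_ ?_
        · refine Eventually.of_forall fun n => ?_
          have : Continuous fun g => (Φ (g * (q n)⁻¹) - Φ (g * h⁻¹)) *
            f ((b (t n) * g * (b (t n))⁻¹) • x n) := by fun_prop
          exact this.aestronglyMeasurable
        · filter_upwards [hγ.eventually hW] with n hn
          refine Eventually.of_forall fun g => ?_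
          by_cases hgK : g ∈ tsupport Φ * W
          · rw [Set.indicator_of_mem hgK, norm_mul]
            have hMM : 0 ≤ M' := (norm_nonneg _).trans (hM' 1)
            refine mul_le_mul ((norm_sub_le _ _).trans (add_le_add (hM' _) (hM' _))) (hM _)
              (norm_nonneg _) (by positivity)
          · rw [Set.indicator_of_notMem hgK]
            have z : ∀ w ∈ W, Φ (g * w⁻¹) = 0 := fun w hw => by
              refine image_eq_zero_of_notMem_tsupport fun h => hgK ⟨_, h, w, hw, by simp⟩
            rw [z _ hn, z _ (mem_of_mem_nhds hW)]; simp
        · exact (integrable_indicator_iff hK.measurableSet).2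
            (integrableOn_const hK.measure_lt_top.ne)
        · refine Eventually.of_forall fun g => ?_
          have hc : Continuous fun k => Φ (g * k⁻¹) - Φ (g * h⁻¹) := by fun_prop
          have h1 := (hc.tendsto h).comp hγ
          simp only [sub_self] at h1
          refine squeeze_zero_norm (a := fun n => ‖Φ (g * (q n)⁻¹) - Φ (g * h⁻¹)‖ * M) (fun n => ?_) ?_
          · rw [norm_mul]; gcongr; exact hM _
          · have := h1.norm.mul_const M
            simpa using this
      simp only [integral_zero] at this
      refine this.congr fun n => ?_
      have hcc : ∀ k, Integrable (fun g => Φ (g * k) * f ((b (t n) * g * (b (t n))⁻¹) • x n)) muG :=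
        fun k => by
          have : Continuous fun g => Φ (g * k) * f ((b (t n) * g * (b (t n))⁻¹) • x n) := by fun_prop
          exact this.integrable_of_hasCompactSupport
            (HasCompactSupport.mul_right (hΦs.comp_homeomorph (Homeomorph.mulRight k)))
      rw [← integral_sub (hcc _) (hcc _)]
      congr 1; ext g; ring
    have L4 := L3.add L2
    simp only [sub_add_cancel, zero_add] at L4
    simp_rw [← e1] at L4
    have := tendsto_nhds_unique L1 L4
    rw [this, ← integral_mul_right_eq_self _ h]
    congr 1; ext g; simp [F]
  by_contra hne
  set d : G → ℝ := fun g => F (a g) - F (a (g * h))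
  have hd : ContinuousOn d O' := by
    refine ContinuousOn.sub (hF.comp_continuousOn (ha.mono Set.inter_subset_left))
      (hF.comp_continuousOn (ha.comp (continuous_mul_const h).continuousOn ?_))
    exact fun g hg => hg.2
  have hgO' : g ∈ O' := ⟨hg, hgh⟩
  have hd0 : d g ≠ 0 := sub_ne_zero.2 hne
  -- compact neighborhood
  obtain ⟨K, hKn, hKO, hKc⟩ := local_compact_nhds (hO'.mem_nhds hgO')
  obtain ⟨φ, hφ, hφs, hφ0, hφg, hφK, -⟩ := exists_bump G muG g K hKn
  have hts : tsupport φ ⊆ K := closure_minimal (fun v hv => hφK v hv) hKc.isClosed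
  have hcts : ∀ e : G → ℝ, ContinuousOn e O' → Continuous fun g => φ g * e g := by
    intro e he
    rw [continuous_iff_continuousAt]
    intro g
    by_cases hg : g ∈ tsupport φ
    · exact hφ.continuousAt.mul (he.continuousAt (hO'.mem_nhds (hKO (hts hg))))
    · have : (fun g => φ g * e g) =ᶠ[𝓝 g] fun _ => 0 := by
        filter_upwards [(isClosed_tsupport φ).isOpen_compl.mem_nhds hg] with g' hg'
        rw [image_eq_zero_of_notMem_tsupport hg', zero_mul]
      exact (continuousAt_const).congr this.symm
  have hc1 := hcts d hd
  have hk := key (fun g => φ g * d g) hc1 hφs.mul_right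
    ((closure_mono (fun g hg => left_ne_zero_of_mul hg)).trans (hts.trans hKO))
  have hFa : ContinuousOn (fun g => F (a g)) O' :=
    hF.comp_continuousOn (ha.mono Set.inter_subset_left)
  have hFah : ContinuousOn (fun g => F (a (g * h))) O' :=
    (hF.comp_continuousOn (ha.comp (continuous_mul_const h).continuousOn fun g hg => hg.2))
  have i1 : Integrable (fun g => φ g * d g * F (a g)) muG := by
    have := hcts _ (hd.mul hFa)
    simp only [Pi.mul_apply, ← mul_assoc] at this
    exact this.integrable_of_hasCompactSupport (hφs.mul_right.mul_right)
  have i2 : Integrable (fun g => φ g * d g * F (a (g * h))) muG := by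
    have := hcts _ (hd.mul hFah)
    simp only [Pi.mul_apply, ← mul_assoc] at this
    exact this.integrable_of_hasCompactSupport (hφs.mul_right.mul_right)
  rw [← sub_eq_zero, ← integral_sub i1 i2] at hk
  have hpos : 0 < ∫ g, φ g * (d g * d g) ∂muG := by
    refine (hcts _ (hd.mul hd)).integral_pos_of_hasCompactSupport_nonneg_nonzero
      hφs.mul_right (fun v => mul_nonneg (hφ0 v) (mul_self_nonneg _)) (x := g) ?_
    exact mul_ne_zero hφg (mul_ne_zero hd0 hd0)
  refine hpos.ne' (Eq.trans ?_ hk)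
  congr 1; ext g; simp only [d]; ring
end drift

section mat
variable {n : ℕ}

instance SL_tg : IsTopologicalGroup (SL(n, ℝ)) := Matrix.SpecialLinearGroup.topologicalGroup

instance SL_t2 : T2Space (SL(n, ℝ)) :=
  inferInstanceAs (T2Space {A : Matrix (Fin n) (Fin n) ℝ // A.det = 1})
instance SL_sc : SecondCountableTopology (SL(n, ℝ)) := by
  haveI : SecondCountableTopology (Matrix (Fin n) (Fin n) ℝ) :=
    inferInstanceAs (SecondCountableTopology (Fin n → Fin n → ℝ))
  exact TopologicalSpace.Subtype.secondCountableTopology {A : Matrix (Fin n) (Fin n) ℝ | A.det = 1}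
theorem SL_emb : Topology.IsClosedEmbedding (fun g : SL(n, ℝ) => (g : Matrix (Fin n) (Fin n) ℝ)) := by
  refine IsClosed.isClosedEmbedding_subtypeVal (s := {A : Matrix (Fin n) (Fin n) ℝ | A.det = 1}) ?_
  exact isClosed_eq (by fun_prop) continuous_const
instance SL_lc : LocallyCompactSpace (SL(n, ℝ)) := by
  haveI : LocallyCompactSpace (Matrix (Fin n) (Fin n) ℝ) :=
    inferInstanceAs (LocallyCompactSpace (Fin n → Fin n → ℝ))
  exact SL_emb.locallyCompactSpace

theorem SL_cont : Continuous (fun g : SL(n, ℝ) => (g : Matrix (Fin n) (Fin n) ℝ)) := 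
  continuous_subtype_val

theorem SL_cont_apply (i j : Fin n) : Continuous (fun g : SL(n, ℝ) => g i j) :=
  (continuous_apply_apply i j).comp SL_cont

theorem SL_inv (g : SL(n, ℝ)) : ((g⁻¹ : SL(n, ℝ)) : Matrix (Fin n) (Fin n) ℝ) = (g : Matrix (Fin n) (Fin n) ℝ)⁻¹ := by
  rw [Matrix.SpecialLinearGroup.coe_inv, Matrix.inv_def]; simp

/-- block triangular subgroup -/
def Par {α : Type*} [LinearOrder α] (b : Fin n → α) : Subgroup (SL(n, ℝ)) where
  carrier := {g | BlockTriangular (g : Matrix (Fin n) (Fin n) ℝ) b}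
  mul_mem' := fun {g h} hg hh => by
    simp only [Set.mem_setOf_eq, Matrix.SpecialLinearGroup.coe_mul] at *
    exact hg.mul hh
  one_mem' := by simp only [Set.mem_setOf_eq, Matrix.SpecialLinearGroup.coe_one]; exact blockTriangular_one
  inv_mem' := fun {g} hg => by
    simp only [Set.mem_setOf_eq, SL_inv] at *
    haveI : Invertible (g : Matrix (Fin n) (Fin n) ℝ) := Matrix.invertibleOfIsUnitDet _ (by simp)
    exact blockTriangular_inv_of_blockTriangular hg

theorem mem_Par {α : Type*} [LinearOrder α] (b : Fin n → α) (g : SL(n, ℝ)) :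
    g ∈ Par b ↔ ∀ i j, b j < b i → g i j = 0 := Iff.rfl

theorem Par_closed {α : Type*} [LinearOrder α] (b : Fin n → α) : IsClosed (Par b : Set (SL(n, ℝ))) := by
  have : (Par b : Set (SL(n, ℝ))) = ⋂ i, ⋂ j, ⋂ (_ : b j < b i), {g | g i j = 0} := by
    ext g; simp [mem_Par]
  rw [this]
  exact isClosed_iInter fun i => isClosed_iInter fun j => isClosed_iInter fun _ =>
    isClosed_eq (SL_cont_apply i j) continuous_const

/-- lower triangular -/
def Bm (n : ℕ) : Subgroup (SL(n, ℝ)) := Par (fun i : Fin n => OrderDual.toDual i)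

theorem mem_Bm (g : SL(n, ℝ)) : g ∈ Bm n ↔ ∀ i j : Fin n, i < j → g i j = 0 := Iff.rfl

def UU (n : ℕ) : Subgroup (SL(n, ℝ)) where
  carrier := {g | g ∈ Par (fun i : Fin n => i) ∧ ∀ i, g i i = 1}
  mul_mem' := fun {g h} hg hh => by
    refine ⟨mul_mem hg.1 hh.1, fun i => ?_⟩
    rw [Matrix.SpecialLinearGroup.coe_mul, mul_apply, Finset.sum_eq_single i]
    · rw [hg.2, hh.2, one_mul]
    · intro j _ hj
      rcases lt_or_gt_of_ne hj with h' | h'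
      · rw [hg.1 h', zero_mul]
      · rw [hh.1 h', mul_zero]
    · simp
  one_mem' := ⟨one_mem _, by simp⟩
  inv_mem' := fun {g} hg => by
    refine ⟨inv_mem hg.1, fun i => ?_⟩
    have h1 : (g⁻¹ * g) i i = 1 := by simp
    rw [Matrix.SpecialLinearGroup.coe_mul, mul_apply, Finset.sum_eq_single i] at h1
    · rwa [hg.2, mul_one] at h1
    · intro j _ hj
      rcases lt_or_gt_of_ne hj with h' | h'
      · rw [(inv_mem hg.1 : g⁻¹ ∈ Par _) h', zero_mul]
      · rw [hg.1 h', mul_zero]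
    · simp

theorem mem_UU (g : SL(n, ℝ)) : g ∈ UU n ↔ (∀ i : Fin n, g i i = 1) ∧ ∀ i j : Fin n, j < i → g i j = 0 :=
  and_comm

theorem UU_closed : IsClosed (UU n : Set (SL(n, ℝ))) := by
  have : (UU n : Set (SL(n, ℝ))) = (Par (fun i : Fin n => i) : Set _) ∩ ⋂ i, {g | g i i = 1} := by
    ext g; simp [UU]
  rw [this]
  exact (Par_closed _).inter (isClosed_iInter fun i => isClosed_eq (SL_cont_apply i i) continuous_const)

theorem Bm_UU (g : SL(n, ℝ)) (h1 : g ∈ Bm n) (h2 : g ∈ UU n) : g = 1 := by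
  ext i j
  rcases lt_trichotomy i j with h | h | h
  · rw [(mem_Bm g).1 h1 i j h]; simp [h.ne]
  · subst h; rw [h2.2]; simp
  · rw [((mem_UU g).1 h2).2 i j h]; simp [h.ne']

theorem LU_unique (l l' v v' : SL(n, ℝ)) (hl : l ∈ Bm n) (hl' : l' ∈ Bm n) (hv : v ∈ UU n)
    (hv' : v' ∈ UU n) (h : l * v = l' * v') : l = l' ∧ v = v' := by
  have e : l'⁻¹ * l = v' * v⁻¹ := by
    rw [inv_mul_eq_iff_eq_mul, ← mul_assoc, ← h]; simp
  have := Bm_UU (l'⁻¹ * l) (mul_mem (inv_mem hl') hl) (by rw [e]; exact mul_mem hv' (inv_mem hv))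
  have h1 : l = l' := by rwa [inv_mul_eq_one, eq_comm] at this
  exact ⟨h1, by subst h1; exact mul_left_cancel h⟩

theorem Bm_diag_mul (g h : SL(n, ℝ)) (hg : g ∈ Bm n) (hh : h ∈ Bm n) (i : Fin n) :
    (g * h) i i = g i i * h i i := by
  rw [Matrix.SpecialLinearGroup.coe_mul, mul_apply, Finset.sum_eq_single i]
  · intro j _ hj
    rcases lt_or_gt_of_ne hj with h' | h'
    · rw [(mem_Bm h).1 hh _ _ h', mul_zero]
    · rw [(mem_Bm g).1 hg _ _ h', zero_mul]
  · simp

theorem Bm_prod (g : SL(n, ℝ)) (hg : g ∈ Bm n) : ∏ i, g i i = 1 := by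
  rw [← Matrix.det_of_lowerTriangular (g : Matrix (Fin n) (Fin n) ℝ) hg]; simp

theorem Bm_diag_ne (g : SL(n, ℝ)) (hg : g ∈ Bm n) (i : Fin n) : g i i ≠ 0 := fun h => by
  have h2 : ∏ i, g i i = 0 := Finset.prod_eq_zero (Finset.mem_univ i) h
  rw [Bm_prod g hg] at h2
  exact one_ne_zero h2
end mat

section LU
variable {n : ℕ}

def coordL (i j : Fin n) : (Fin n → Fin n → ℝ) →L[ℝ] ℝ :=
  (ContinuousLinearMap.proj (R := ℝ) (φ := fun _ : Fin n => ℝ) j).comp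
    (ContinuousLinearMap.proj (R := ℝ) (φ := fun _ : Fin n => Fin n → ℝ) i)

def loL (i j : Fin n) : (Fin n → Fin n → ℝ) →L[ℝ] ℝ := if j ≤ i then coordL i j else 0
def suL (i j : Fin n) : (Fin n → Fin n → ℝ) →L[ℝ] ℝ := if i < j then coordL i j else 0

def LUf (X : Fin n → Fin n → ℝ) : Fin n → Fin n → ℝ := fun i j =>
  ((1 : Matrix (Fin n) (Fin n) ℝ) i j + coordL i j X) + ∑ k, loL i k X * suL k j X

theorem LUf_deriv : HasStrictFDerivAt (LUf (n := n)) (ContinuousLinearMap.id ℝ (Fin n → Fin n → ℝ)) 0 := by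
  rw [hasStrictFDerivAt_pi']
  intro i
  rw [hasStrictFDerivAt_pi']
  intro j
  have h1 : HasStrictFDerivAt (fun X : Fin n → Fin n → ℝ => (1 : Matrix (Fin n) (Fin n) ℝ) i j + coordL i j X)
    (coordL i j) 0 := (coordL i j).hasStrictFDerivAt.const_add _
  have h2 : HasStrictFDerivAt (fun X : Fin n → Fin n → ℝ => ∑ k, loL i k X * suL k j X)
    (∑ k : Fin n, ((loL i k 0) • suL k j + (suL k j 0) • loL i k)) 0 :=
    HasStrictFDerivAt.fun_sum fun k _ => (loL i k).hasStrictFDerivAt.mul (suL k j).hasStrictFDerivAt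
  have h3 := h1.add h2
  simp only [map_zero, zero_smul, add_zero, Finset.sum_const_zero] at h3
  exact h3

theorem unip_det (X : Fin n → Fin n → ℝ) :
    (Matrix.of fun i j => (1 : Matrix (Fin n) (Fin n) ℝ) i j + suL i j X).det = 1 := by
  rw [Matrix.det_of_upperTriangular]
  · simp [suL]
  · intro i j hij
    have h : j < i := hij
    simp [suL, h.not_gt, Matrix.one_apply, h.ne']

def upX (X : Fin n → Fin n → ℝ) : SL(n, ℝ) := ⟨_, unip_det X⟩

theorem upX_mem (X : Fin n → Fin n → ℝ) : upX X ∈ UU n := by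
  rw [mem_UU]
  constructor
  · intro i; simp [upX, suL]
  · intro i j hij
    simp [upX, suL, hij.not_gt, Matrix.one_apply, hij.ne']

theorem upX_cont : Continuous (upX (n := n)) := by
  refine Continuous.subtype_mk ?_ _
  refine continuous_pi fun i => continuous_pi fun j => ?_
  exact continuous_const.add (suL i j).continuous

theorem LUf_eq (X : Fin n → Fin n → ℝ) :
    (Matrix.of (LUf X)) = (Matrix.of fun i j => (1 : Matrix (Fin n) (Fin n) ℝ) i j + loL i j X) *
      (upX X : Matrix (Fin n) (Fin n) ℝ) := by
  have : (upX X : Matrix (Fin n) (Fin n) ℝ) = 1 + Matrix.of fun i j => suL i j X := rfl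
  have h2 : (Matrix.of fun i j => (1 : Matrix (Fin n) (Fin n) ℝ) i j + loL i j X) = 1 + Matrix.of fun i j => loL i j X := rfl
  rw [this, h2, add_mul, mul_add, mul_add, one_mul, one_mul, mul_one]
  ext i j
  simp only [LUf, of_apply, Matrix.add_apply, mul_apply]
  have : coordL i j X = suL i j X + loL i j X := by
    simp only [suL, loL]
    rcases lt_or_ge i j with h | h
    · simp [h, h.not_ge]
    · simp [h, h.not_gt]
  rw [this]; ring

theorem LU_near : ∃ (O : Set (SL(n, ℝ))) (up : SL(n, ℝ) → SL(n, ℝ)), IsOpen O ∧ (1 : SL(n, ℝ)) ∈ O ∧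
    ContinuousOn up O ∧ ∀ g ∈ O, up g ∈ UU n ∧ g * (up g)⁻¹ ∈ Bm n ∧ ∀ i, 0 < (g * (up g)⁻¹) i i := by
  have hd : HasStrictFDerivAt (LUf (n := n)) ((ContinuousLinearEquiv.refl ℝ (Fin n → Fin n → ℝ) :
    (Fin n → Fin n → ℝ) →L[ℝ] (Fin n → Fin n → ℝ))) 0 := LUf_deriv
  set e := hd.toOpenPartialHomeomorph LUf with he
  have h0 : LUf (0 : Fin n → Fin n → ℝ) = fun i j => (1 : Matrix (Fin n) (Fin n) ℝ) i j := by
    funext i j; simp [LUf]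
  have hc : ∀ X, e X = LUf X := fun X => by rw [he, hd.toOpenPartialHomeomorph_coe]
  have hs0 : (0 : Fin n → Fin n → ℝ) ∈ e.source := hd.mem_toOpenPartialHomeomorph_source
  have ht0 : (fun i j => (1 : Matrix (Fin n) (Fin n) ℝ) i j) ∈ e.target := by
    rw [← h0, ← hc]; exact e.map_source hs0
  set ι : SL(n, ℝ) → (Fin n → Fin n → ℝ) := fun g i j => g i j with hι
  have hιc : Continuous ι := continuous_pi fun i => continuous_pi fun j => SL_cont_apply i j
  set X : SL(n, ℝ) → (Fin n → Fin n → ℝ) := fun g => e.symm (ι g)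
  have hX : ContinuousOn X (ι ⁻¹' e.target) :=
    e.continuousOn_symm.comp hιc.continuousOn (fun g hg => hg)
  have hpos : IsOpen {Y : Fin n → Fin n → ℝ | ∀ i, 0 < 1 + Y i i} := by
    simp only [Set.setOf_forall]
    exact isOpen_iInter_of_finite fun i => isOpen_lt continuous_const (by fun_prop)
  refine ⟨ι ⁻¹' e.target ∩ X ⁻¹' {Y | ∀ i, 0 < 1 + Y i i}, fun g => upX (X g),
    hX.isOpen_inter_preimage (e.open_target.preimage hιc) hpos, ⟨?_, ?_⟩, ?_, ?_⟩
  · change ι 1 ∈ e.target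
    exact ht0
  · change ∀ i, 0 < 1 + X 1 i i
    have : X 1 = 0 := by
      have h1 : ι 1 = e 0 := by rw [hc, h0]; rfl
      change e.symm (ι 1) = 0
      rw [h1, e.left_inv hs0]
    rw [this]; simp
  · exact upX_cont.comp_continuousOn (hX.mono Set.inter_subset_left)
  · intro g hg
    have h1 : LUf (X g) = ι g := by rw [← hc]; exact e.right_inv hg.1
    have h2 := LUf_eq (X g)
    rw [h1] at h2
    have h3 : (Matrix.of (ι g)) = (g : Matrix (Fin n) (Fin n) ℝ) := rfl
    rw [h3] at h2
    have h4 : ((g * (upX (X g))⁻¹ : SL(n, ℝ)) : Matrix (Fin n) (Fin n) ℝ) =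
      (Matrix.of fun i j => (1 : Matrix (Fin n) (Fin n) ℝ) i j + loL i j (X g)) := by
      rw [Matrix.SpecialLinearGroup.coe_mul, h2, SL_inv, Matrix.mul_assoc, Matrix.mul_nonsing_inv _ (by simp), mul_one]
    refine ⟨upX_mem _, ?_, ?_⟩
    · rw [mem_Bm]
      intro i j hij
      rw [h4]
      simp [loL, hij.not_ge, Matrix.one_apply, hij.ne]
    · intro i
      rw [h4]
      have := hg.2 i
      simpa [loL, coordL] using this
end LU

noncomputable section torus
variable {n : ℕ}

def mean (n : ℕ) (β : ℕ → ℝ) : ℝ := (∑ i : Fin n, β i) / n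

theorem D_det (β : ℕ → ℝ) :
    (Matrix.diagonal fun i : Fin n => Real.exp (β i - mean n β)).det = 1 := by
  rw [det_diagonal, ← Real.exp_sum, Finset.sum_sub_distrib]
  rcases Nat.eq_zero_or_pos n with h | h
  · subst h; simp
  · have : (n : ℝ) ≠ 0 := by positivity
    simp [mean]; field_simp; simp

def DD (n : ℕ) (β : ℕ → ℝ) : SL(n, ℝ) := ⟨_, D_det β⟩

theorem DD_coe (β : ℕ → ℝ) : (DD n β : Matrix (Fin n) (Fin n) ℝ) =
  Matrix.diagonal fun i : Fin n => Real.exp (β i - mean n β) := rfl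

theorem mean_add (β γ : ℕ → ℝ) : mean n (β + γ) = mean n β + mean n γ := by
  simp [mean, Finset.sum_add_distrib, add_div]

theorem DD_add (β γ : ℕ → ℝ) : DD n (β + γ) = DD n β * DD n γ := by
  apply Subtype.ext
  rw [Matrix.SpecialLinearGroup.coe_mul, DD_coe, DD_coe, DD_coe, diagonal_mul_diagonal]
  congr 1; ext i
  rw [← Real.exp_add, mean_add, Pi.add_apply]; congr 1; ring

theorem DD_zero : DD n 0 = 1 := by
  apply Subtype.ext
  rw [DD_coe]; simp [mean]

theorem DD_neg (β : ℕ → ℝ) : DD n (-β) = (DD n β)⁻¹ := by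
  rw [eq_inv_iff_mul_eq_one, ← DD_add, neg_add_cancel, DD_zero]

theorem DD_conj (β : ℕ → ℝ) (g : SL(n, ℝ)) (i j : Fin n) :
    (DD n β * g * (DD n β)⁻¹) i j = Real.exp (β i - β j) * g i j := by
  rw [← DD_neg, Matrix.SpecialLinearGroup.coe_mul, Matrix.SpecialLinearGroup.coe_mul, DD_coe, DD_coe,
    mul_diagonal, diagonal_mul]
  have : mean n (-β) = - mean n β := by simp [mean, neg_div]
  rw [this, Pi.neg_apply, mul_right_comm, ← Real.exp_add]
  congr 2; ring

theorem DD_cont {Y : Type*} [TopologicalSpace Y] (β : Y → ℕ → ℝ) (s : Set Y)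
    (hβ : ∀ i, i < n → ContinuousOn (fun y => β y i) s) : ContinuousOn (fun y => DD n (β y)) s := by
  have hm : ContinuousOn (fun y => mean n (β y)) s := by
    refine ContinuousOn.div_const (continuousOn_finset_sum _ fun (i : Fin n) _ => hβ i i.2) _
  rw [SL_emb.isInducing.continuousOn_iff]
  refine continuousOn_pi.2 fun i => continuousOn_pi.2 fun j => ?_
  change ContinuousOn (fun y => (DD n (β y) : Matrix (Fin n) (Fin n) ℝ) i j) s
  simp only [DD_coe, diagonal_apply]
  split_ifs
  · exact Real.continuous_exp.comp_continuousOn ((hβ i i.2).sub hm)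
  · exact continuousOn_const

def trc (n : ℕ) (c : ℕ → ℝ) (j : ℕ) : ℝ := if 0 < j ∧ j < n then c j else 0
def hh (n : ℕ) (c : ℕ → ℝ) (i : ℕ) : ℝ := trc n c (i+1) - trc n c i
def AA (n : ℕ) (c : ℕ → ℝ) : SL(n, ℝ) := DD n (hh n c)

theorem hh_add (c d : ℕ → ℝ) : hh n (c + d) = hh n c + hh n d := by
  funext i; simp only [hh, trc, Pi.add_apply]; split_ifs <;> ring

theorem AA_add (c d : ℕ → ℝ) : AA n (c + d) = AA n c * AA n d := by
  rw [AA, hh_add, DD_add]; rfl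

theorem AA_zero : AA n 0 = 1 := by
  have : hh n 0 = 0 := by funext i; simp [hh, trc]
  rw [AA, this, DD_zero]

theorem AA_neg (c : ℕ → ℝ) : AA n (-c) = (AA n c)⁻¹ := by
  rw [eq_inv_iff_mul_eq_one, ← AA_add, neg_add_cancel, AA_zero]

theorem AA_sub (c d : ℕ → ℝ) : AA n (c - d) = AA n c * (AA n d)⁻¹ := by
  rw [sub_eq_add_neg, AA_add, AA_neg]

theorem AA_congr (c d : ℕ → ℝ) (h : ∀ j, 0 < j → j < n → c j = d j) : AA n c = AA n d := by
  have : hh n c = hh n d := by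
    funext i; simp only [hh, trc]
    congr 1 <;> (split_ifs with h1; exact h _ h1.1 h1.2; rfl)
  rw [AA, this]; rfl

theorem hh_mean (c : ℕ → ℝ) : mean n (hh n c) = 0 := by
  rw [mean, Fin.sum_univ_eq_sum_range (fun i => hh n c i)]
  simp only [hh]
  rw [Finset.sum_range_sub]; simp [trc]

theorem AA_apply (c : ℕ → ℝ) : (AA n c : Matrix (Fin n) (Fin n) ℝ) =
  Matrix.diagonal fun i : Fin n => Real.exp (hh n c i) := by
  rw [AA, DD_coe, hh_mean]; simp

theorem AA_cont {Y : Type*} [TopologicalSpace Y] (c : Y → ℕ → ℝ) (s : Set Y)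
    (hβ : ∀ i, 0 < i → i < n → ContinuousOn (fun y => c y i) s) : ContinuousOn (fun y => AA n (c y)) s := by
  refine DD_cont _ s fun i _ => ?_
  have : ∀ j, ContinuousOn (fun y => trc n (c y) j) s := by
    intro j; simp only [trc]; split_ifs with h
    · exact hβ j h.1 h.2
    · exact continuousOn_const
  exact (this _).sub (this _)

/-- leading minors -/
def chi (j : ℕ) (g : SL(n, ℝ)) : ℝ :=
  ((g : Matrix (Fin n) (Fin n) ℝ).toBlock (fun i => (i : ℕ) < j) (fun i => (i : ℕ) < j)).det

theorem chi_cont (j : ℕ) : Continuous (chi (n := n) j) := by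
  refine Continuous.matrix_det ?_
  refine continuous_pi fun i => continuous_pi fun k => ?_
  exact SL_cont_apply _ _

theorem chi_mul (j : ℕ) (g h : SL(n, ℝ)) (H : (∀ i k : Fin n, (i : ℕ) < j → j ≤ (k : ℕ) → g i k = 0) ∨
    (∀ i k : Fin n, (i : ℕ) < j → j ≤ (k : ℕ) → h k i = 0)) : chi j (g * h) = chi j g * chi j h := by
  rw [chi, Matrix.SpecialLinearGroup.coe_mul, toBlock_mul_eq_add _ (fun i : Fin n => (i : ℕ) < j), chi, chi, ← det_mul]
  congr 1
  rw [add_eq_left]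
  rcases H with H | H
  · have : (g : Matrix (Fin n) (Fin n) ℝ).toBlock (fun i => (i : ℕ) < j) (fun i => ¬ (i : ℕ) < j) = 0 := by
      ext i k; exact H _ _ i.2 (not_lt.1 k.2)
    rw [this, Matrix.zero_mul]
  · have : (h : Matrix (Fin n) (Fin n) ℝ).toBlock (fun i => ¬ (i : ℕ) < j) (fun i => (i : ℕ) < j) = 0 := by
      ext i k; exact H _ _ k.2 (not_lt.1 i.2)
    rw [this, Matrix.mul_zero]

theorem chi_tri (j : ℕ) (g : SL(n, ℝ)) (H : ∀ i k : Fin n, i < k → (k : ℕ) < j → g i k = 0) :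
    chi j g = ∏ i : Fin n, if (i : ℕ) < j then g i i else 1 := by
  rw [chi, det_of_lowerTriangular]
  · rw [← Finset.prod_filter]
    symm
    rw [Finset.prod_subtype (p := fun i : Fin n => (i : ℕ) < j) _ (by simp)]
    rfl
  · intro i k hik
    exact H _ _ hik k.2

theorem chi_UU (j : ℕ) (g : SL(n, ℝ)) (hg : g ∈ UU n) : chi j g = 1 := by
  rw [chi, det_of_upperTriangular]
  · exact Finset.prod_eq_one fun i _ => hg.2 i
  · intro i k hik
    exact ((mem_UU g).1 hg).2 _ _ hik

theorem chi_mul_UU (j : ℕ) (g v : SL(n, ℝ)) (hv : v ∈ UU n) : chi j (g * v) = chi j g := by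
  rw [chi_mul, chi_UU j v hv, mul_one]
  exact Or.inr fun i k hi hk => ((mem_UU v).1 hv).2 _ _ (Fin.lt_def.2 (by omega))

theorem chi_one (j : ℕ) : chi j (1 : SL(n, ℝ)) = 1 := chi_UU j 1 (one_mem _)

def tau (g : SL(n, ℝ)) : SL(n, ℝ) := AA n fun j => Real.log (chi j g)

theorem tau_mul_UU (g v : SL(n, ℝ)) (hv : v ∈ UU n) : tau (g * v) = tau g := by
  simp only [tau, chi_mul_UU _ g v hv]

theorem tau_UU (v : SL(n, ℝ)) (hv : v ∈ UU n) : tau v = 1 := by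
  have : (fun j => Real.log (chi j v)) = 0 := by funext j; simp [chi_UU j v hv]
  rw [tau, this, AA_zero]

theorem chi_Bm (j : ℕ) (g : SL(n, ℝ)) (hg : g ∈ Bm n) :
    chi j g = ∏ i : Fin n, if (i : ℕ) < j then g i i else 1 :=
  chi_tri j g fun i k hik _ => (mem_Bm g).1 hg i k hik

theorem chi_Bm_ne (j : ℕ) (g : SL(n, ℝ)) (hg : g ∈ Bm n) : chi j g ≠ 0 := by
  rw [chi_Bm j g hg]
  exact Finset.prod_ne_zero_iff.2 fun i _ => by split_ifs; exact Bm_diag_ne g hg i; exact one_ne_zero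

theorem tau_Bm_mul (g h : SL(n, ℝ)) (hg : g ∈ Bm n) (hh : h ∈ Bm n) : tau (g * h) = tau g * tau h := by
  rw [tau, tau, tau, ← AA_add]
  congr 1; funext j
  rw [Pi.add_apply, chi_mul, Real.log_mul (chi_Bm_ne j g hg) (chi_Bm_ne j h hh)]
  exact Or.inl fun i k hi hk => (mem_Bm g).1 hg _ _ (Fin.lt_def.2 (by omega))

theorem chi_Bm_succ (g : SL(n, ℝ)) (hg : g ∈ Bm n) (i : Fin n) :
    chi ((i : ℕ) + 1) g = chi (i : ℕ) g * g i i := by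
  rw [chi_Bm _ g hg, chi_Bm _ g hg, ← Finset.mul_prod_erase Finset.univ _ (Finset.mem_univ i),
    ← Finset.mul_prod_erase Finset.univ (fun k : Fin n => if (k : ℕ) < i then g k k else 1) (Finset.mem_univ i)]
  simp only [lt_add_iff_pos_right, zero_lt_one, if_true, lt_irrefl, if_false, one_mul]
  rw [mul_comm]; congr 1
  refine Finset.prod_congr rfl fun k hk => ?_
  have : (k : ℕ) ≠ i := fun h => (Finset.mem_erase.1 hk).1 (Fin.ext h)
  simp only [show ((k : ℕ) < i + 1 ↔ (k : ℕ) < i) by omega]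

/-- tau is the (absolute value of the) diagonal -/
theorem tau_Bm (g : SL(n, ℝ)) (hg : g ∈ Bm n) :
    (tau g : Matrix (Fin n) (Fin n) ℝ) = Matrix.diagonal fun i => |g i i| := by
  rw [tau, AA_apply]; congr 1; funext i
  have key : ∀ j, j ≤ n → trc n (fun j => Real.log (chi j g)) j = Real.log (chi j g) := by
    intro j hj
    simp only [trc]
    split_ifs with h
    · rfl
    · rcases Nat.eq_zero_or_pos j with h0 | h0
      · subst h0; rw [chi_Bm _ g hg]; simp
      · have : j = n := by omega
        subst this; rw [chi_Bm _ g hg]; simp [Bm_prod g hg]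
  rw [hh, key _ (by omega), key _ (by omega), chi_Bm_succ g hg, Real.log_mul (chi_Bm_ne _ g hg) (Bm_diag_ne g hg i),
    add_sub_cancel_left, Real.exp_log_eq_abs (Bm_diag_ne g hg i)]
end torus

noncomputable section moves
variable {n : ℕ}

abbrev TV {p q : Fin n} (h : p ≠ q) (r : ℝ) : SL(n, ℝ) := Matrix.SpecialLinearGroup.transvection h r

theorem TV_zero {p q : Fin n} (hpq : p ≠ q) : TV hpq 0 = 1 := Matrix.SpecialLinearGroup.transvection_coeff_zero hpq

theorem TV_mul {p q : Fin n} (hpq : p ≠ q) (r : ℝ) (h : SL(n, ℝ)) (i j : Fin n) :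
    (TV hpq r * h) i j = h i j + if i = p then r * h q j else 0 := by
  rw [Matrix.SpecialLinearGroup.coe_mul, Matrix.SpecialLinearGroup.transvection_coe, add_mul, one_mul,
    Matrix.add_apply]
  congr 1
  split_ifs with h1
  · subst h1; simp
  · simp [h1]

theorem mul_TV {p q : Fin n} (hpq : p ≠ q) (r : ℝ) (h : SL(n, ℝ)) (i j : Fin n) :
    (h * TV hpq r) i j = h i j + if j = q then h i p * r else 0 := by
  rw [Matrix.SpecialLinearGroup.coe_mul, Matrix.SpecialLinearGroup.transvection_coe, mul_add, mul_one,
    Matrix.add_apply]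
  congr 1
  split_ifs with h1
  · subst h1; simp
  · simp [h1]

theorem TV_apply {p q : Fin n} (hpq : p ≠ q) (r : ℝ) (i j : Fin n) :
    TV hpq r i j = (1 : Matrix (Fin n) (Fin n) ℝ) i j + if i = p ∧ j = q then r else 0 := by
  rw [Matrix.SpecialLinearGroup.transvection_coe, Matrix.add_apply, Matrix.single_apply]
  congr 1
  simp only [eq_comm]

theorem TV_UU {p q : Fin n} (hpq : p < q) (r : ℝ) : TV hpq.ne r ∈ UU n := by
  rw [mem_UU]
  constructor
  · intro i; rw [TV_apply]
    have : ¬ (i = p ∧ i = q) := fun h => hpq.ne (h.1.symm.trans h.2)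
    simp [this]
  · intro i j hij
    rw [TV_apply]
    have : ¬ (i = p ∧ j = q) := fun h => by obtain ⟨rfl, rfl⟩ := h; exact lt_asymm hpq hij
    simp [this, hij.ne']

theorem TV_cont {p q : Fin n} (hpq : p ≠ q) : Continuous fun r => TV hpq r := by
  refine Continuous.subtype_mk ?_ _
  refine continuous_pi fun i => continuous_pi fun j => ?_
  change Continuous fun r => TV hpq r i j
  simp only [TV_apply]
  split_ifs <;> fun_prop

/-- the subset `I` attached to `L`. -/
def II (L : Subgroup (SL(n, ℝ))) : Set ℕ := {k | 0 < k ∧ k < n ∧ ∀ t : ℝ, AA n (Pi.single k t) ∈ L}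

theorem AA_mem (L : Subgroup (SL(n, ℝ))) (c : ℕ → ℝ) (hc : ∀ j, 0 < j → j < n → j ∉ II L → c j = 0) : AA n c ∈ L := by
  have h1 : AA n c = AA n (∑ k ∈ Finset.range n, if 0 < k then Pi.single k (c k) else 0) := by
    refine AA_congr _ _ fun j hj hjn => ?_
    rw [Finset.sum_apply, Finset.sum_eq_single j]
    · simp [hj]
    · intro k _ hk; split_ifs <;> simp [hk.symm]
    · intro h; exact absurd (Finset.mem_range.2 hjn) h
  rw [h1]
  have h2 : ∀ s : Finset ℕ, (∀ k ∈ s, k < n) → AA n (∑ k ∈ s, if 0 < k then Pi.single k (c k) else 0) ∈ L := by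
    intro s
    induction s using Finset.induction_on with
    | empty => intro _; rw [Finset.sum_empty, AA_zero]; exact one_mem _
    | insert k s hk ih =>
      intro hs
      rw [Finset.sum_insert hk, AA_add]
      refine mul_mem ?_ (ih fun j hj => hs j (Finset.mem_insert_of_mem hj))
      have hkn := hs k (Finset.mem_insert_self k s)
      split_ifs with h0
      · by_cases hI : k ∈ II L
        · exact hI.2.2 _
        · rw [hc k h0 hkn hI, Pi.single_zero, AA_zero]; exact one_mem _
      · rw [AA_zero]; exact one_mem _
  exact h2 _ fun k hk => Finset.mem_range.1 hk

theorem II_of_small (L : Subgroup (SL(n, ℝ))) (k : ℕ) (h0 : 0 < k) (hk : k < n)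
    (h : ∀ᶠ t in 𝓝 (0 : ℝ), AA n (Pi.single k t) ∈ L) : k ∈ II L := by
  refine ⟨h0, hk, fun t => ?_⟩
  have h1 : Tendsto (fun N : ℕ => t / ((N : ℝ) + 1)) atTop (𝓝 0) := by
    have := (tendsto_one_div_add_atTop_nhds_zero_nat (𝕜 := ℝ)).const_mul t
    simpa [div_eq_mul_inv] using this
  obtain ⟨N, hN⟩ := (h1.eventually h).exists
  have h2 : ∀ m : ℕ, AA n (Pi.single k ((m : ℝ) * (t / ((N : ℝ) + 1)))) ∈ L := by
    intro m
    induction m with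
    | zero => simp only [Nat.cast_zero, zero_mul, Pi.single_zero, AA_zero]; exact one_mem _
    | succ m ih =>
      have : ((m + 1 : ℕ) : ℝ) * (t / ((N : ℝ) + 1)) = m * (t / (N + 1)) + t / (N + 1) := by push_cast; ring
      rw [this, Pi.single_add, AA_add]
      exact mul_mem ih hN
  have h3 := h2 (N + 1)
  have h4 : ((N + 1 : ℕ) : ℝ) * (t / ((N : ℝ) + 1)) = t := by
    push_cast; field_simp
  rwa [h4] at h3

def Hyp (L : Subgroup (SL(n, ℝ))) (h : SL(n, ℝ)) : Prop :=
  ∀ᶠ u in 𝓝 (1 : SL(n, ℝ)), u ∈ UU n → tau (u * h) ∈ L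

theorem Hyp_stable (L : Subgroup (SL(n, ℝ))) (h : SL(n, ℝ)) (hh : Hyp L h) :
    ∀ᶠ u in 𝓝 (1 : SL(n, ℝ)), u ∈ UU n → Hyp L (u * h) := by
  filter_upwards [eventually_eventually_nhds.2 hh] with u hu huU
  have : Tendsto (fun w : SL(n, ℝ) => w * u) (𝓝 1) (𝓝 u) := by
    have := (continuous_mul_const u).tendsto (1 : SL(n, ℝ))
    rwa [one_mul] at this
  filter_upwards [this.eventually hu] with w hw hwU
  rw [← mul_assoc]; exact hw (mul_mem hwU huU)

theorem Hyp_mul (L : Subgroup (SL(n, ℝ))) (h v : SL(n, ℝ)) (hv : v ∈ UU n) (hh : Hyp L h) : Hyp L (h * v) := by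
  filter_upwards [hh] with u hu huU
  rw [← mul_assoc, tau_mul_UU _ _ hv]; exact hu huU

theorem TV_ev {p q : Fin n} (hpq : p < q) (P : SL(n, ℝ) → Prop)
    (hP : ∀ᶠ u in 𝓝 (1 : SL(n, ℝ)), u ∈ UU n → P u) : ∀ᶠ r in 𝓝 (0 : ℝ), P (TV hpq.ne r) := by
  have h1 : Tendsto (fun r => TV hpq.ne r) (𝓝 0) (𝓝 1) := by
    have := (TV_cont hpq.ne).tendsto 0
    rwa [TV_zero] at this
  filter_upwards [h1.eventually hP] with r hr using hr (TV_UU hpq r)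

/-- base case -/
theorem Hyp_base (L : Subgroup (SL(n, ℝ))) (h : SL(n, ℝ)) (hB : h ∈ Bm n) (hh : Hyp L h) (p q : Fin n)
    (hpq : (q : ℕ) = p + 1) (hq : (q : ℕ) ∉ II L) : h q p = 0 := by
  by_contra hne
  have hlt : p < q := Fin.lt_def.2 (by omega)
  apply hq
  refine II_of_small L q (by omega) q.2 ?_
  have h1 := TV_ev hlt _ hh
  set c := h q p / h p p with hc
  have hpp := Bm_diag_ne h hB p
  have hc0 : c ≠ 0 := div_ne_zero hne hpp
  have h1' : tau h ∈ L := by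
    have := h1.self_of_nhds
    rwa [TV_zero, one_mul] at this
  have h2 : Tendsto (fun t : ℝ => (Real.exp t - 1) / c) (𝓝 0) (𝓝 0) := by
    have : Continuous (fun t : ℝ => (Real.exp t - 1) / c) := by fun_prop
    have := this.tendsto 0
    simpa using this
  filter_upwards [h2.eventually h1] with t ht
  have h3 := mul_mem ht (inv_mem h1')
  rw [tau, tau, ← AA_sub] at h3
  rw [AA_congr (Pi.single (q : ℕ) t) _ ?_]
  · exact h3
  intro j hj hjn
  set r := (Real.exp t - 1) / c with hr
  have hlow : ∀ i k : Fin n, i < k → (k : ℕ) < q + 1 → k ≠ q → (TV hlt.ne r * h) i k = 0 := by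
    intro i k hik hk hkq
    rw [TV_mul, (mem_Bm h).1 hB i k hik]
    split_ifs with hi
    · subst hi
      exfalso
      have := Fin.lt_def.1 hik
      exact hkq (Fin.ext (by omega))
    · simp
  rw [Pi.sub_apply]
  by_cases hjq : j = q
  · subst hjq
    rw [Pi.single_eq_same]
    have e1 : chi (q : ℕ) (TV hlt.ne r * h) = chi q h * (1 + r * c) := by
      rw [chi_tri _ _ (fun i k hik hk => hlow i k hik (by omega) (fun e => by subst e; omega)), chi_Bm _ h hB,
        ← Finset.mul_prod_erase Finset.univ _ (Finset.mem_univ p),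
        ← Finset.mul_prod_erase Finset.univ (fun i : Fin n => if (i : ℕ) < q then h i i else 1) (Finset.mem_univ p)]
      have hpq' : (p : ℕ) < q := by omega
      simp only [hpq', if_true]
      rw [TV_mul, if_pos rfl, mul_right_comm]
      congr 1
      · rw [hc]; field_simp
      · refine Finset.prod_congr rfl fun k hk => ?_
        rw [TV_mul, if_neg (Finset.mem_erase.1 hk).1, add_zero]
    have e2 : 1 + r * c = Real.exp t := by rw [hr]; field_simp; ring
    rw [e1, e2, Real.log_mul (chi_Bm_ne _ h hB) (Real.exp_ne_zero t), Real.log_exp]; ring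
  · rw [Pi.single_eq_of_ne hjq]
    have e1 : chi j (TV hlt.ne r * h) = chi j h := by
      rw [chi_mul, chi_UU j _ (TV_UU hlt r), one_mul]
      left
      intro i k hi hk
      rw [TV_apply, Matrix.one_apply_ne (by rintro rfl; omega), if_neg, add_zero]
      rintro ⟨rfl, rfl⟩; omega
    rw [e1, sub_self]

/-- one move -/
theorem Hyp_move (L : Subgroup (SL(n, ℝ))) (h : SL(n, ℝ)) (hB : h ∈ Bm n) (hh : Hyp L h) (p q : Fin n)
    (hpq : (q : ℕ) = p + 1) : ∃ (r r' : ℝ) (l : SL(n, ℝ)), r ≠ 0 ∧ r' ≠ 0 ∧ l ∈ Bm n ∧ Hyp L l ∧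
      (∀ j, j ≠ q → l p j = h p j + r * h q j) ∧ (∀ i, i ≠ p → l i q = h i q - r' * h i p) := by
  have hlt : p < q := Fin.lt_def.2 (by omega)
  have h1 := TV_ev hlt _ (Hyp_stable L h hh)
  have hpp := Bm_diag_ne h hB p
  have h2 : ∀ᶠ r : ℝ in 𝓝 0, h p p + r * h q p ≠ 0 := by
    have : Tendsto (fun r : ℝ => h p p + r * h q p) (𝓝 0) (𝓝 (h p p)) := by
      have : Continuous (fun r : ℝ => h p p + r * h q p) := by fun_prop
      have := this.tendsto 0
      simpa using this
    exact this.eventually_ne hpp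
  have h3 : ∀ᶠ r in 𝓝[≠] (0 : ℝ), r ≠ 0 := eventually_mem_nhdsWithin
  obtain ⟨r, hr1, hr2, hr3⟩ := ((h1.filter_mono nhdsWithin_le_nhds).and
    ((h2.filter_mono nhdsWithin_le_nhds).and h3)).exists
  set r' := r * h q q / (h p p + r * h q p) with hr'
  have key : ∀ i j, (TV hlt.ne r * h * TV hlt.ne (-r')) i j = h i j + (if i = p then r * h q j else 0)
      + if j = q then (h i p + if i = p then r * h q p else 0) * (-r') else 0 := by
    intro i j
    rw [mul_TV, TV_mul, TV_mul]
  refine ⟨r, r', TV hlt.ne r * h * TV hlt.ne (-r'), hr3, ?_, ?_, Hyp_mul L _ _ (TV_UU hlt _) hr1, ?_, ?_⟩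
  · exact div_ne_zero (mul_ne_zero hr3 (Bm_diag_ne h hB q)) hr2
  · rw [mem_Bm]
    intro i j hij
    rw [key, (mem_Bm h).1 hB i j hij]
    by_cases hi : i = p
    · subst hi
      by_cases hj : j = q
      · subst hj
        simp only [if_true, hr']
        field_simp; ring
      · have : q < j := by
          refine Fin.lt_def.2 ?_
          have := Fin.lt_def.1 hij
          have h5 : (j : ℕ) ≠ q := fun e => hj (Fin.ext e)
          omega
        simp [hj, (mem_Bm h).1 hB q j this]
    · by_cases hj : j = q
      · subst hj
        have : i < p := by
          refine Fin.lt_def.2 ?_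
          have := Fin.lt_def.1 hij
          have h5 : (i : ℕ) ≠ p := fun e => hi (Fin.ext e)
          omega
        simp [hi, (mem_Bm h).1 hB i p this]
      · simp [hi, hj]
  · intro j hj
    rw [key, if_pos rfl, if_neg hj, add_zero]
  · intro i hi
    rw [key, if_neg hi, if_pos rfl, if_neg hi]; ring

theorem Hyp_claim (L : Subgroup (SL(n, ℝ))) : ∀ (d : ℕ) (h : SL(n, ℝ)), h ∈ Bm n → Hyp L h →
    ∀ (i j : Fin n) (m : ℕ), (i : ℕ) = j + d → m ∉ II L → (j : ℕ) < m → m ≤ i → h i j = 0 := by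
  intro d
  induction d with
  | zero => intro h _ _ i j m hd hm h1 h2; omega
  | succ d ih =>
    intro h hB hh i j m hd hm h1 h2
    rcases Nat.eq_zero_or_pos d with h0 | h0
    · subst h0
      have : m = i := by omega
      subst this
      exact Hyp_base L h hB hh j i hd hm
    rcases h2.lt_or_eq with h3 | h3
    · have hp : (i : ℕ) - 1 < n := by omega
      obtain ⟨r, r', l, hr, hr', hl, hl2, k1, k2⟩ := Hyp_move L h hB hh ⟨i - 1, hp⟩ i (by simp; omega)
      have e1 := ih l hl hl2 ⟨i - 1, hp⟩ j m (by simp; omega) hm h1 (by simp; omega)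
      have e2 := ih h hB hh ⟨i - 1, hp⟩ j m (by simp; omega) hm h1 (by simp; omega)
      rw [k1 j (by rintro rfl; omega), e2, zero_add] at e1
      exact (mul_eq_zero.1 e1).resolve_left hr
    · have hp : (j : ℕ) + 1 < n := by omega
      obtain ⟨r, r', l, hr, hr', hl, hl2, k1, k2⟩ := Hyp_move L h hB hh j ⟨j + 1, hp⟩ (by simp)
      have e1 := ih l hl hl2 i ⟨j + 1, hp⟩ m (by simp; omega) hm (by simp; omega) h2
      have e2 := ih h hB hh i ⟨j + 1, hp⟩ m (by simp; omega) hm (by simp; omega) h2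
      rw [k2 i (by rintro rfl; omega), e2, zero_sub, neg_eq_zero] at e1
      exact (mul_eq_zero.1 e1).resolve_left hr'
end moves

section stabm
variable {G X : Type*} [Group G] [TopologicalSpace G] [IsTopologicalGroup G]
    [LocallyCompactSpace G] [SecondCountableTopology G] [T2Space G] [MeasurableSpace G]
    [BorelSpace G] [TopologicalSpace X] [SecondCountableTopology X] [MeasurableSpace X]
    [BorelSpace X] [MulAction G X] [ContinuousSMul G X] [LocallyCompactSpace X] [T2Space X]

theorem meas_smul (g : G) : Measurable (fun x : X => g • x) := (continuous_const_smul g).measurable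

variable (G) in
/-- invariance group of a measure -/
def Lst (μ : Measure X) : Subgroup G where
  carrier := {g | MeasurePreserving (fun x : X => g • x) μ μ}
  mul_mem' := fun {g h} hg hh => by
    have := hg.comp hh
    simp only [Set.mem_setOf_eq, mul_smul]
    exact this
  one_mem' := by
    simp only [Set.mem_setOf_eq, one_smul]; exact MeasurePreserving.id μ
  inv_mem' := fun {g} hg => by
    refine ⟨meas_smul _, ?_⟩
    have h := hg.map_eq
    conv_lhs => rw [← h]
    rw [Measure.map_map (meas_smul _) (meas_smul _)]
    convert Measure.map_id
    funext x; simp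

theorem mem_Lst (μ : Measure X) (g : G) : g ∈ Lst G μ ↔ MeasurePreserving (fun x : X => g • x) μ μ := Iff.rfl

theorem finite_ext (μ ν : Measure X) [IsFiniteMeasure μ] [IsFiniteMeasure ν]
    (h : ∀ f : X → ℝ, Continuous f → HasCompactSupport f → ∫ x, f x ∂μ = ∫ x, f x ∂ν) : μ = ν := by
  letI := TopologicalSpace.metrizableSpaceMetric X
  haveI := sigmaCompactSpace_of_locallyCompact_secondCountable (X := X)
  refine Measure.ext_of_integral_eq_on_compactlySupported fun f => h f f.continuous f.hasCompactSupport

theorem Lst_of_int (μ : Measure X) [IsProbabilityMeasure μ] (a a' : G)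
    (h : ∀ f : X → ℝ, Continuous f → HasCompactSupport f → ∫ x, f (a • x) ∂μ = ∫ x, f (a' • x) ∂μ) :
    a⁻¹ * a' ∈ Lst G μ := by
  haveI : ∀ a : G, IsFiniteMeasure (μ.map (fun x => a • x)) := fun a => Measure.isFiniteMeasure_map μ _
  have e : μ.map (fun x => a • x) = μ.map (fun x => a' • x) := by
    refine finite_ext _ _ fun f hf hfs => ?_
    rw [integral_map (meas_smul a).aemeasurable hf.aestronglyMeasurable,
      integral_map (meas_smul a').aemeasurable hf.aestronglyMeasurable, h f hf hfs]
  refine ⟨meas_smul _, ?_⟩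
  have e2 : (fun x : X => (a⁻¹ * a') • x) = (fun x => a⁻¹ • x) ∘ (fun x => a' • x) := by
    funext x; simp [mul_smul]
  rw [e2, ← Measure.map_map (meas_smul _) (meas_smul _), ← e, Measure.map_map (meas_smul _) (meas_smul _)]
  convert Measure.map_id
  funext x; simp

theorem Lst_closed (μ : Measure X) [IsProbabilityMeasure μ] : IsClosed (Lst G μ : Set G) := by
  have : (Lst G μ : Set G) = ⋂ f : {f : X → ℝ // Continuous f ∧ HasCompactSupport f},
      {g | ∫ x, f.1 (g • x) ∂μ = ∫ x, f.1 x ∂μ} := by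
    ext g
    simp only [SetLike.mem_coe, Set.mem_iInter, Set.mem_setOf_eq, Subtype.forall, and_imp]
    constructor
    · intro hg f hf _
      have h := ((mem_Lst μ g).1 hg).map_eq
      conv_rhs => rw [← h]
      rw [integral_map (meas_smul g).aemeasurable hf.aestronglyMeasurable]
    · intro h
      have := Lst_of_int μ (1 : G) g (fun f hf hfs => by simpa using (h f hf hfs).symm)
      simpa using this
  rw [this]
  exact isClosed_iInter fun f => isClosed_eq (F_cont μ f.1 f.2.1 f.2.2) continuous_const
end stabm

def conjE {G : Type*} [Group G] [TopologicalSpace G] [IsTopologicalGroup G] (U : Subgroup G) (b : G)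
    (h : ∀ u ∈ U, b * u * b⁻¹ ∈ U) (h' : ∀ u ∈ U, b⁻¹ * u * b ∈ U) : U ≃ₜ* U where
  toFun u := ⟨b * u * b⁻¹, h u u.2⟩
  invFun u := ⟨b⁻¹ * u * b, h' u u.2⟩
  left_inv u := by apply Subtype.ext; simp [mul_assoc]
  right_inv u := by apply Subtype.ext; simp [mul_assoc]
  map_mul' u v := by apply Subtype.ext; simp [mul_assoc]
  continuous_toFun := by fun_prop
  continuous_invFun := by fun_prop

noncomputable section conj
variable {n : ℕ}

theorem DD_smul_conj (β : ℕ → ℝ) (t : ℕ) (g : SL(n, ℝ)) (i j : Fin n) :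
    (DD n ((t : ℝ) • β) * g * (DD n ((t : ℝ) • β))⁻¹) i j = Real.exp (t * (β i - β j)) * g i j := by
  rw [DD_conj]; simp [mul_sub]

theorem DD_smul_conj' (β : ℕ → ℝ) (t : ℕ) (g : SL(n, ℝ)) (i j : Fin n) :
    ((DD n ((t : ℝ) • β))⁻¹ * g * (DD n ((t : ℝ) • β))) i j = Real.exp (t * (β j - β i)) * g i j := by
  have : (DD n ((t : ℝ) • β)) = (DD n (-((t : ℝ) • β)))⁻¹ := by rw [DD_neg, inv_inv]
  rw [this, inv_inv, DD_conj]; congr 2; simp; ring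

theorem DD_UU (β : ℕ → ℝ) (g : SL(n, ℝ)) (hg : g ∈ UU n) : DD n β * g * (DD n β)⁻¹ ∈ UU n := by
  rw [mem_UU] at *
  constructor
  · intro i; rw [DD_conj, hg.1]; simp
  · intro i j h; rw [DD_conj, hg.2 i j h, mul_zero]

theorem DD_UU' (β : ℕ → ℝ) (g : SL(n, ℝ)) (hg : g ∈ UU n) : (DD n β)⁻¹ * g * DD n β ∈ UU n := by
  have := DD_UU (-β) g hg
  rwa [DD_neg, inv_inv] at this

def cT (β : ℕ → ℝ) : UU n ≃ₜ* UU n := conjE (UU n) (DD n β) (DD_UU β) (DD_UU' β)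

theorem SL_tendsto {ι : Type*} {l : Filter ι} (f : ι → SL(n, ℝ)) (g : SL(n, ℝ))
    (h : ∀ i j, Tendsto (fun k => f k i j) l (𝓝 (g i j))) : Tendsto f l (𝓝 g) := by
  rw [SL_emb.isInducing.tendsto_nhds_iff]
  exact tendsto_pi_nhds.2 fun i => tendsto_pi_nhds.2 fun j => h i j

theorem beta_lt (β : ℕ → ℝ) (hβ : ∀ i, β (i+1) + 1 ≤ β i) : StrictAnti β :=
  strictAnti_nat_of_succ_lt fun i => by linarith [hβ i]

theorem exp_t_zero (c : ℝ) (hc : c < 0) : Tendsto (fun t : ℕ => Real.exp (t * c)) atTop (𝓝 0) := by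
  refine Real.tendsto_exp_atBot.comp ?_
  exact tendsto_natCast_atTop_atTop.atTop_mul_const_of_neg hc

theorem conj_lim (β : ℕ → ℝ) (hβ : ∀ i, β (i+1) + 1 ≤ β i) (g : SL(n, ℝ)) (hg : g ∈ Bm n)
    (hp : ∀ i, 0 < g i i) :
    Tendsto (fun t : ℕ => DD n ((t : ℝ) • β) * g * (DD n ((t : ℝ) • β))⁻¹) atTop (𝓝 (tau g)) := by
  refine SL_tendsto _ _ fun i j => ?_
  simp only [DD_smul_conj, tau_Bm g hg]
  rcases lt_trichotomy i j with h | h | h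
  · rw [(mem_Bm g).1 hg i j h, diagonal_apply_ne _ h.ne]; simp
  · subst h; simp [abs_of_pos (hp i)]
  · rw [diagonal_apply_ne _ h.ne']
    have := (exp_t_zero (β i - β j) (by linarith [beta_lt β hβ (Fin.lt_def.1 h)])).mul_const (g i j)
    simpa using this

theorem cT_symm_lim (β : ℕ → ℝ) (hβ : ∀ i, β (i+1) + 1 ≤ β i) (u : UU n) :
    Tendsto (fun t : ℕ => (cT ((t : ℝ) • β)).symm u) atTop (𝓝 1) := by
  rw [tendsto_subtype_rng]
  change Tendsto (fun t : ℕ => (DD n ((t : ℝ) • β))⁻¹ * (u : SL(n, ℝ)) * DD n ((t : ℝ) • β)) atTop (𝓝 1)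
  refine SL_tendsto _ _ fun i j => ?_
  simp only [DD_smul_conj']
  rcases lt_trichotomy i j with h | h | h
  · have := (exp_t_zero (β j - β i) (by linarith [beta_lt β hβ (Fin.lt_def.1 h)])).mul_const ((u : SL(n, ℝ)) i j)
    simpa [h.ne] using this
  · subst h; simp [((mem_UU _).1 u.2).1]
  · rw [((mem_UU _).1 u.2).2 i j h]; simp [h.ne']

def boxU (n : ℕ) (R : ℝ) : Set (UU n) := {u | ∀ i j, |(u : SL(n, ℝ)) i j| ≤ R}

theorem boxU_compact (R : ℝ) : IsCompact (boxU n R) := by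
  have hc : Topology.IsClosedEmbedding (fun u : UU n => ((u : SL(n, ℝ)) : Matrix (Fin n) (Fin n) ℝ)) :=
    SL_emb.comp UU_closed.isClosedEmbedding_subtypeVal
  have hK : IsCompact {A : Matrix (Fin n) (Fin n) ℝ | ∀ i, A i ∈ {v : Fin n → ℝ | ∀ j, v j ∈ Set.Icc (-R) R}} :=
    isCompact_pi_infinite fun i => isCompact_pi_infinite fun j => isCompact_Icc
  have := hc.isCompact_preimage hK
  convert this using 1
  ext u
  simp [boxU, abs_le]

theorem cT_box (β : ℕ → ℝ) (hβ : ∀ i, β (i+1) + 1 ≤ β i) (K : Set (UU n)) (hK : IsCompact K) :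
    ∃ B, IsCompact B ∧ B ∈ 𝓝 (1 : UU n) ∧ K ⊆ B ∧
      Monotone (fun k : ℕ => cT ((k : ℝ) • β) '' B) := by
  have hb : ∀ i j : Fin n, ∃ R, ∀ u ∈ K, |(u : SL(n, ℝ)) i j| ≤ R := by
    intro i j
    obtain ⟨R, hR⟩ := (hK.image ((SL_cont_apply i j).comp continuous_subtype_val)).isBounded.exists_norm_le
    exact ⟨R, fun u hu => hR _ ⟨u, hu, rfl⟩⟩
  choose R hR using hb
  set R0 := 2 + ∑ i, ∑ j, |R i j| with hR0
  have hR1 : ∀ i j, R i j ≤ R0 := by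
    intro i j
    have h1 : |R i j| ≤ ∑ j, |R i j| := Finset.single_le_sum (f := fun j => |R i j|) (fun _ _ => abs_nonneg _) (Finset.mem_univ j)
    have h2 : ∑ j, |R i j| ≤ ∑ i, ∑ j, |R i j| :=
      Finset.single_le_sum (f := fun i => ∑ j, |R i j|) (fun _ _ => Finset.sum_nonneg fun _ _ => abs_nonneg _) (Finset.mem_univ i)
    linarith [le_abs_self (R i j)]
  have hR2 : 2 ≤ R0 := by
    have : 0 ≤ ∑ i, ∑ j, |R i j| := Finset.sum_nonneg fun _ _ => Finset.sum_nonneg fun _ _ => abs_nonneg _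
    linarith
  refine ⟨boxU n R0, boxU_compact R0, ?_, fun u hu i j => (hR i j u hu).trans (hR1 i j), ?_⟩
  · have : ∀ i j : Fin n, ∀ᶠ u : UU n in 𝓝 1, |(u : SL(n, ℝ)) i j| ≤ R0 := by
      intro i j
      have h1 : Tendsto (fun u : UU n => |(u : SL(n, ℝ)) i j|) (𝓝 1) (𝓝 |(1 : SL(n, ℝ)) i j|) :=
        (((SL_cont_apply i j).comp continuous_subtype_val).abs).tendsto (1 : UU n)
      refine (h1.eventually_lt_const (u := R0) ?_).mono fun u hu => le_of_lt hu
      rw [Matrix.SpecialLinearGroup.coe_one, Matrix.one_apply]; split_ifs <;> simp <;> linarith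
    exact eventually_all.2 fun i => eventually_all.2 fun j => this i j
  · refine monotone_nat_of_le_succ fun k => ?_
    rintro _ ⟨w, hw, rfl⟩
    refine ⟨(cT ((1 : ℝ) • β)).symm w, ?_, ?_⟩
    · intro i j
      change |((DD n ((1 : ℝ) • β))⁻¹ * (w : SL(n, ℝ)) * DD n ((1 : ℝ) • β)) i j| ≤ R0
      have := DD_smul_conj' β 1 (w : SL(n, ℝ)) i j
      rw [Nat.cast_one] at this
      rw [this, abs_mul, Real.abs_exp]
      rcases lt_or_ge j i with h | h
      · rw [((mem_UU _).1 w.2).2 i j h]; simp; linarith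
      · have h1 : Real.exp (1 * (β j - β i)) ≤ 1 := by
          rw [Real.exp_le_one_iff]; linarith [(beta_lt β hβ).antitone (Fin.le_def.1 h)]
        calc _ ≤ 1 * |(w : SL(n, ℝ)) i j| := by gcongr
          _ ≤ R0 := by rw [one_mul]; exact hw i j
    · apply Subtype.ext
      change DD n (((k+1 : ℕ) : ℝ) • β) * ((DD n ((1 : ℝ) • β))⁻¹ * (w : SL(n, ℝ)) * DD n ((1 : ℝ) • β)) * (DD n (((k+1 : ℕ) : ℝ) • β))⁻¹
        = DD n ((k : ℝ) • β) * (w : SL(n, ℝ)) * (DD n ((k : ℝ) • β))⁻¹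
      have : DD n (((k+1 : ℕ) : ℝ) • β) = DD n ((k : ℝ) • β) * DD n ((1 : ℝ) • β) := by
        rw [← DD_add, ← add_smul]; push_cast; rfl
      rw [this]; group
end conj

noncomputable section om
variable {n : ℕ}

instance UU_lc : LocallyCompactSpace (UU n) := UU_closed.isClosedEmbedding_subtypeVal.locallyCompactSpace
instance UU_sc : SecondCountableTopology (UU n) :=
  TopologicalSpace.Subtype.secondCountableTopology (UU n : Set (SL(n, ℝ)))

theorem tau_contOn (O : Set (SL(n, ℝ))) (up : SL(n, ℝ) → SL(n, ℝ))
    (hLU : ∀ g ∈ O, up g ∈ UU n ∧ g * (up g)⁻¹ ∈ Bm n ∧ ∀ i, 0 < (g * (up g)⁻¹) i i) :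
    ContinuousOn (tau (n := n)) O := by
  refine AA_cont _ O fun j _ _ => ?_
  refine (chi_cont j).continuousOn.log fun g hg => ?_
  obtain ⟨h1, h2, _⟩ := hLU g hg
  have : chi j g = chi j (g * (up g)⁻¹) := by rw [chi_mul_UU _ _ _ (inv_mem h1)]
  rw [this]; exact chi_Bm_ne j _ h2

variable {X : Type*} [TopologicalSpace X] [SecondCountableTopology X] [MeasurableSpace X]
    [BorelSpace X] [MulAction (SL(n, ℝ)) X] [ContinuousSMul (SL(n, ℝ)) X] [LocallyCompactSpace X] [T2Space X]
    (μ : Measure X) [IsProbabilityMeasure μ]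

theorem exists_Om (hμ : UU n ≤ Lst (SL(n, ℝ)) μ)
    (herg : ∀ A : Set X, MeasurableSet A →
      (∀ v ∈ UU n, (fun x : X => v • x) ⁻¹' A = A) → μ A = 0 ∨ μ A = 1)
    (O : Set (SL(n, ℝ))) (up : SL(n, ℝ) → SL(n, ℝ)) (hO : IsOpen O)
    (hLU : ∀ g ∈ O, up g ∈ UU n ∧ g * (up g)⁻¹ ∈ Bm n ∧ ∀ i, 0 < (g * (up g)⁻¹) i i)
    (β : ℕ → ℝ) (hβ : ∀ i, β (i+1) + 1 ≤ β i) (ε : ℝ≥0∞) (hε : 0 < ε) :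
    ∃ Ω : Set X, MeasurableSet Ω ∧ μ Ωᶜ ≤ ε ∧ ∀ (x : ℕ → X) (γ : ℕ → SL(n, ℝ)) (t : ℕ → ℕ) (h : SL(n, ℝ)),
      (∀ k, x k ∈ Ω) → (∀ k, γ k • x k ∈ Ω) → Tendsto t atTop atTop →
      Tendsto (fun k => (DD n ((t k : ℝ) • β))⁻¹ * γ k * DD n ((t k : ℝ) • β)) atTop (𝓝 h) →
      ∀ g ∈ O, g * h ∈ O → (tau g)⁻¹ * tau (g * h) ∈ Lst (SL(n, ℝ)) μ := by
  set lam : Measure (UU n) := Measure.haar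
  haveI : lam.IsMulRightInvariant := unimod_of_contract (fun t : ℕ => cT ((t : ℝ) • β)) (cT_symm_lim β hβ) lam
  obtain ⟨Ω, hΩm, hΩ, hΩ2⟩ := unif_equi lam μ (fun u => hμ u.2) (fun A hA h => herg A hA fun v hv => h ⟨v, hv⟩)
    (fun t : ℕ => cT ((t : ℝ) • β)) (cT_symm_lim β hβ) (cT_box β hβ) ε hε
  refine ⟨Ω, hΩm, hΩ, ?_⟩
  intro x γ t h hx hy ht hγ g hg hgh
  refine Lst_of_int μ _ _ fun f hf hfs => ?_
  refine drift_inv μ (UU n) (Measure.haar (G := SL(n, ℝ))).inv lam Ω (fun t : ℕ => DD n ((t : ℝ) • β))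
    ?_ O hO (fun g => g * (up g)⁻¹) up tau (tau_contOn O up hLU) (fun g hg => (hLU g hg).1) (fun g hg => by simp)
    (fun g hg v hv _ => tau_mul_UU g v hv) ?_ x hx t ht γ hy h hγ g hg hgh f hf hfs
  · intro φ hφ hφs f hf hfs
    exact hΩ2 φ hφ hφs f hf hfs
  · intro g hg
    obtain ⟨h1, h2, h3⟩ := hLU g hg
    have := conj_lim β hβ _ h2 h3
    rwa [tau_mul_UU _ _ (inv_mem h1)] at this
end om

noncomputable section garsia
variable {X : Type*} [MeasurableSpace X]

def gM (T : X → X) (f : X → ℝ) : ℕ → X → ℝ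
  | 0 => fun _ => 0
  | N + 1 => fun x => max 0 (f x + gM T f N (T x))

theorem gM_meas (T : X → X) (hT : Measurable T) (f : X → ℝ) (hf : Measurable f) (N : ℕ) : Measurable (gM T f N) := by
  induction N with
  | zero => exact measurable_const
  | succ N ih => exact measurable_const.max (hf.add (ih.comp hT))

theorem gM_nonneg (T : X → X) (f : X → ℝ) (N : ℕ) (x : X) : 0 ≤ gM T f N x := by
  cases N with
  | zero => exact le_refl _
  | succ N => exact le_max_left _ _

theorem gM_le (T : X → X) (f : X → ℝ) (hf : ∀ x, f x ≤ 1) (N : ℕ) (x : X) : gM T f N x ≤ N := by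
  induction N generalizing x with
  | zero => simp [gM]
  | succ N ih =>
    refine max_le (by positivity) ?_
    have := ih (T x); have := hf x
    push_cast; linarith

theorem gM_mono (T : X → X) (f : X → ℝ) (N : ℕ) (x : X) : gM T f N x ≤ gM T f (N+1) x := by
  induction N generalizing x with
  | zero => exact le_max_left _ _
  | succ N ih =>
    refine max_le_max le_rfl ?_
    have := ih (T x)
    linarith

theorem gM_sum (T : X → X) (f : X → ℝ) (N : ℕ) (x : X) : birkhoffSum T f N x ≤ gM T f N x := by
  induction N generalizing x with
  | zero => simp [gM]
  | succ N ih =>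
    rw [birkhoffSum_succ']
    refine le_trans ?_ (le_max_right _ _)
    have := ih (T x)
    linarith

theorem garsia (μ : Measure X) [IsProbabilityMeasure μ] (T : X → X) (hT : MeasurePreserving T μ μ)
    (Ω : Set X) (hΩ : MeasurableSet Ω) (δ : ℝ) (hδ : 0 < δ) :
    ∃ Ω1 : Set X, MeasurableSet Ω1 ∧ δ * μ.real Ω1ᶜ ≤ μ.real Ωᶜ ∧
      ∀ x ∈ Ω1, ∀ N : ℕ, ∑ k ∈ Finset.range N, Set.indicator Ωᶜ (fun _ => (1 : ℝ)) (T^[k] x) ≤ δ * N := by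
  set f : X → ℝ := fun x => Set.indicator Ωᶜ (fun _ => (1 : ℝ)) x - δ with hf
  have hi : ∀ x, Set.indicator Ωᶜ (fun _ => (1 : ℝ)) x ≤ 1 := fun x => by
    by_cases h : x ∈ Ωᶜ
    · rw [Set.indicator_of_mem h]
    · rw [Set.indicator_of_notMem h]; norm_num
  have hi0 : ∀ x, 0 ≤ Set.indicator Ωᶜ (fun _ => (1 : ℝ)) x := fun x => Set.indicator_nonneg (fun _ _ => zero_le_one) x
  have hfm : Measurable f := (measurable_const.indicator hΩ.compl).sub measurable_const
  have hf1 : ∀ x, f x ≤ 1 := fun x => by have := hi x; simp only [hf]; linarith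
  have hMm := gM_meas T hT.measurable f hfm
  set E : ℕ → Set X := fun N => {x | 0 < gM T f N x} with hE
  have hEm : ∀ N, MeasurableSet (E N) := fun N => measurableSet_lt measurable_const (hMm N)
  have hMi : ∀ N, Integrable (gM T f N) μ := fun N =>
    Integrable.of_bound (hMm N).aestronglyMeasurable N (Eventually.of_forall fun x => by
      rw [Real.norm_of_nonneg (gM_nonneg T f N x)]; exact gM_le T f hf1 N x)
  have hfi : Integrable f μ := Integrable.of_bound hfm.aestronglyMeasurable (1 + δ) (Eventually.of_forall fun x => by
    rw [Real.norm_eq_abs, abs_le]; have := hi x; have := hi0 x; simp only [hf]; constructor <;> linarith)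
  have key : ∀ N, δ * μ.real (E N) ≤ μ.real Ωᶜ := by
    intro N
    have hMT : ∫ x, gM T f N (T x) ∂μ = ∫ x, gM T f N x ∂μ := by
      conv_rhs => rw [← hT.map_eq]
      rw [integral_map hT.measurable.aemeasurable (hMm N).aestronglyMeasurable]
    have hMTi : Integrable (fun x => gM T f N (T x)) μ := hT.integrable_comp_of_integrable (hMi N)
    have h1 : ∫ x in E N, gM T f N x ∂μ = ∫ x, gM T f N x ∂μ :=
      setIntegral_eq_integral_of_forall_compl_eq_zero fun x hx =>
        le_antisymm (not_lt.1 hx) (gM_nonneg T f N x)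
    have h2 : ∫ x in E N, gM T f N (T x) ∂μ ≤ ∫ x, gM T f N (T x) ∂μ :=
      setIntegral_le_integral hMTi (Eventually.of_forall fun x => gM_nonneg T f N (T x))
    have h3 : ∫ x in E N, gM T f N x ∂μ ≤ ∫ x in E N, (f x + gM T f N (T x)) ∂μ := by
      refine setIntegral_mono_on (hMi N).integrableOn (hfi.add hMTi).integrableOn (hEm N) fun x hx => ?_
      cases N with
      | zero => simp [hE, gM] at hx
      | succ N =>
        have hx' : 0 < max 0 (f x + gM T f N (T x)) := hx
        have h4 : gM T f (N+1) x = max 0 (f x + gM T f N (T x)) := rfl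
        have h5 : max 0 (f x + gM T f N (T x)) = f x + gM T f N (T x) := by
          rcases max_choice 0 (f x + gM T f N (T x)) with h | h
          · rw [h] at hx'; exact absurd hx' (lt_irrefl _)
          · exact h
        rw [h4, h5]
        have := gM_mono T f N (T x)
        linarith
    rw [integral_add hfi.integrableOn hMTi.integrableOn] at h3
    have h4 : 0 ≤ ∫ x in E N, f x ∂μ := by linarith
    have hind : Integrable (Set.indicator Ωᶜ (fun _ => (1 : ℝ))) μ :=
      (integrable_const (1:ℝ)).indicator hΩ.compl
    have h5 : ∫ x in E N, f x ∂μ = ∫ x in E N, Set.indicator Ωᶜ (fun _ => (1 : ℝ)) x ∂μ - δ * μ.real (E N) := by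
      simp only [hf]
      rw [integral_sub hind.integrableOn (integrable_const _)]
      simp [mul_comm]
    have h6 : ∫ x in E N, Set.indicator Ωᶜ (fun _ => (1 : ℝ)) x ∂μ ≤ ∫ x, Set.indicator Ωᶜ (fun _ => (1 : ℝ)) x ∂μ :=
      setIntegral_le_integral hind (Eventually.of_forall hi0)
    have h7 : ∫ x, Set.indicator Ωᶜ (fun _ => (1 : ℝ)) x ∂μ = μ.real Ωᶜ := by
      rw [integral_indicator hΩ.compl]; simp
    linarith
  refine ⟨(⋃ N, E N)ᶜ, (MeasurableSet.iUnion hEm).compl, ?_, ?_⟩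
  · rw [compl_compl]
    have hmono : Monotone E := monotone_nat_of_le_succ fun N x hx => lt_of_lt_of_le hx (gM_mono T f N x)
    have ht : Tendsto (fun N => μ.real (E N)) atTop (𝓝 (μ.real (⋃ N, E N))) :=
      (ENNReal.tendsto_toReal (measure_ne_top _ _)).comp (tendsto_measure_iUnion_atTop hmono)
    exact le_of_tendsto (ht.const_mul δ) (Eventually.of_forall key)
  · intro x hx N
    have h1 : gM T f N x ≤ 0 := by
      by_contra h
      exact hx (Set.mem_iUnion.2 ⟨N, not_le.1 h⟩)
    have h2 := gM_sum T f N x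
    simp only [birkhoffSum, hf, Finset.sum_sub_distrib, Finset.sum_const, Finset.card_range, nsmul_eq_mul] at h2
    linarith

/-- existence of common good times -/
theorem good_time (p : ℕ → Prop) (q : ℕ → Prop) [DecidablePred p] [DecidablePred q] (N : ℕ) (hN : 8 ≤ N)
    (h1 : ∑ k ∈ Finset.range N, (if p k then (0 : ℝ) else 1) ≤ 1/16 * N)
    (h2 : ∑ k ∈ Finset.range N, (if q k then (0 : ℝ) else 1) ≤ 1/16 * N) :
    ∃ ν, ν < N ∧ 3 * N ≤ 4 * ν ∧ p ν ∧ q ν := by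
  by_contra hcon
  push Not at hcon
  have h3 : ∑ k ∈ Finset.range N, (if 3 * N ≤ 4 * k then (1 : ℝ) else 0) ≤
      ∑ k ∈ Finset.range N, ((if p k then (0 : ℝ) else 1) + (if q k then (0 : ℝ) else 1)) := by
    refine Finset.sum_le_sum fun k hk => ?_
    have := hcon k (Finset.mem_range.1 hk)
    by_cases hk3 : 3 * N ≤ 4 * k
    · by_cases hp : p k
      · have hq := this hk3 hp
        simp [hk3, hp, hq]
      · simp only [hk3, hp, if_true, if_false]; split_ifs <;> norm_num
    · simp only [hk3, if_false]; split_ifs <;> norm_num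
  rw [Finset.sum_add_distrib] at h3
  have h4 : ((N : ℝ) - 3) / 4 ≤ ∑ k ∈ Finset.range N, (if 3 * N ≤ 4 * k then (1 : ℝ) else 0) := by
    rw [← Finset.sum_filter, Finset.sum_const, nsmul_eq_mul, mul_one]
    have h5 : Finset.Ico ((3 * N + 3) / 4) N ⊆ (Finset.range N).filter (fun k => 3 * N ≤ 4 * k) := by
      intro k hk
      rw [Finset.mem_Ico] at hk
      rw [Finset.mem_filter, Finset.mem_range]
      omega
    have h6 := Finset.card_le_card h5
    rw [Nat.card_Ico] at h6
    have h7 : N ≤ 4 * ((Finset.range N).filter (fun k => 3 * N ≤ 4 * k)).card + 3 := by omega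
    have h8 : (N : ℝ) ≤ 4 * ((Finset.range N).filter (fun k => 3 * N ≤ 4 * k)).card + 3 := by exact_mod_cast h7
    linarith
  have : (8 : ℝ) ≤ N := by exact_mod_cast hN
  linarith
end garsia

noncomputable section params

def dif (I : Set ℕ) (k l : ℕ) : Prop := ∃ m, m ∉ I ∧ l < m ∧ m ≤ k

open Classical in
theorem exists_params (n : ℕ) (I : Set ℕ) (hI : ∀ k ∈ I, 0 < k ∧ k < n) : ∃ c β : ℕ → ℝ,
    (∀ j, j ∉ I → c j = 0) ∧ (∀ i, β (i+1) + 1 ≤ β i) ∧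
    (∀ k l, k < n → l < n → dif I k l → 1 + |hh n c l - hh n c k| ≤ β l - β k) ∧
    (∀ k l, l ≤ k → ¬ dif I k l → 2 * (β l - β k) ≤ hh n c l - hh n c k) := by
  set c : ℕ → ℝ := fun j => if j ∈ I then (n:ℝ)^2 + 2 - (j:ℝ)^2 else 0 with hc
  set M : ℝ := 1 + 2 * ∑ i ∈ Finset.range n, |hh n c i| with hM
  have hM0 : 0 ≤ ∑ i ∈ Finset.range n, |hh n c i| := Finset.sum_nonneg fun _ _ => abs_nonneg _
  set e : ℕ → ℝ := fun m => if m ∈ I then 1 else M with he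
  have he1 : ∀ m, 1 ≤ e m := fun m => by simp only [he]; split_ifs <;> linarith
  set β : ℕ → ℝ := fun i => - ∑ m ∈ Finset.range i, e (m+1) with hβ
  have hβs : ∀ i, β i = β (i+1) + e (i+1) := fun i => by
    simp only [hβ, Finset.sum_range_succ]; ring
  have hβ1 : ∀ i, β (i+1) + 1 ≤ β i := fun i => by rw [hβs i]; linarith [he1 (i+1)]
  have hanti : Antitone β := (beta_lt β hβ1).antitone
  have htr : ∀ j, trc n c j = c j := by
    intro j
    simp only [trc]
    split_ifs with h
    · rfl
    · simp only [hc]; rw [if_neg fun h' => h (hI j h')]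
  refine ⟨c, β, fun j hj => if_neg hj, hβ1, ?_, ?_⟩
  · rintro k l hk hl ⟨m, hm, h1, h2⟩
    have e1 : |hh n c l| ≤ ∑ i ∈ Finset.range n, |hh n c i| :=
      Finset.single_le_sum (f := fun i => |hh n c i|) (fun _ _ => abs_nonneg _) (Finset.mem_range.2 hl)
    have e2 : |hh n c k| ≤ ∑ i ∈ Finset.range n, |hh n c i| :=
      Finset.single_le_sum (f := fun i => |hh n c i|) (fun _ _ => abs_nonneg _) (Finset.mem_range.2 hk)
    have e3 : |hh n c l - hh n c k| ≤ |hh n c l| + |hh n c k| := abs_sub _ _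
    have e4 : β l ≥ β (m-1) := hanti (by omega)
    have e5 := hβs (m-1)
    rw [Nat.sub_add_cancel (by omega)] at e5
    have e6 : β k ≤ β m := hanti h2
    have e7 : e m = M := if_neg hm
    linarith
  · intro k l hlk
    induction k, hlk using Nat.le_induction with
    | base => intro _; simp
    | succ k hk ih =>
      intro hd
      have h1 := ih fun ⟨m, hm, h1, h2⟩ => hd ⟨m, hm, h1, by omega⟩
      have h2 : k + 1 ∈ I := by
        by_contra h
        exact hd ⟨k+1, h, by omega, le_rfl⟩
      have h3 := hβs k
      have h4 : e (k+1) = 1 := if_pos h2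
      have hkn := (hI _ h2).2
      have hpos : ∀ j : ℕ, j ≤ n → c j ≤ (n:ℝ)^2 + 2 - (j:ℝ)^2 := by
        intro j hj
        simp only [hc]
        split_ifs
        · exact le_rfl
        · have : (j:ℝ) ≤ n := by exact_mod_cast hj
          nlinarith [(Nat.cast_nonneg j : (0:ℝ) ≤ j)]
      have h5 : hh n c k - hh n c (k+1) = 2 * c (k+1) - c k - c (k+2) := by
        simp only [hh, htr]; ring
      have h6 : c (k+1) = (n:ℝ)^2 + 2 - ((k+1 : ℕ):ℝ)^2 := if_pos h2
      have h7 := hpos k (by omega)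
      have h8 := hpos (k+2) (by omega)
      push_cast at h6 h8
      nlinarith

theorem times {ι : Type*} [Finite ι] (a E D : ι → ℝ) (ε Kmax : ℝ) (hε : 0 < ε) (ha : ∀ p, 0 ≤ a p)
    (ha0 : ∃ p, 0 < a p) (hED : ∀ p, 1 + |D p| ≤ E p) (hEK : ∀ p, E p ≤ Kmax) (good : ℕ → Prop)
    (hgood : ∀ N, 8 ≤ N → ∃ ν < N, 3 * N ≤ 4 * ν ∧ good ν) (K : ℕ) (hK : 8 ≤ K)
    (hsmall : ∀ N ≤ K, ∀ p, a p * Real.exp (N * (E p - D p)) < ε) :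
    ∃ ν t : ℕ, good ν ∧ 3 * K ≤ 4 * ν ∧ ν ≤ t ∧ 4 * t + K ≤ 8 * ν ∧
      (∃ p, ε ≤ a p * Real.exp (t * E p - ν * D p)) ∧
      ∀ p, a p * Real.exp (t * E p - ν * D p) ≤ ε * Real.exp Kmax := by
  have hD1 : ∀ p, D p ≤ E p - 1 := fun p => by linarith [le_abs_self (D p), hED p]
  have hD2 : ∀ p, - (E p - 1) ≤ D p := fun p => by linarith [neg_abs_le (D p), hED p]
  have hE1 : ∀ p, 1 ≤ E p := fun p => by linarith [abs_nonneg (D p), hED p]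
  have exN : ∃ N : ℕ, ∃ p, ε ≤ a p * Real.exp (N * (E p - D p)) := by
    obtain ⟨p, hp⟩ := ha0
    have : Tendsto (fun N : ℕ => a p * Real.exp (N * (E p - D p))) atTop atTop := by
      refine Tendsto.const_mul_atTop hp (Real.tendsto_exp_atTop.comp ?_)
      exact tendsto_natCast_atTop_atTop.atTop_mul_const (by linarith [hD1 p])
    obtain ⟨N, hN⟩ := (this.eventually_ge_atTop ε).exists
    exact ⟨N, p, hN⟩
  classical
  set N := Nat.find exN with hNdef
  obtain ⟨p, hp⟩ := Nat.find_spec exN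
  have hNmin : ∀ N' < N, ∀ p, a p * Real.exp (N' * (E p - D p)) < ε := by
    intro N' hN' p
    by_contra h
    exact Nat.find_min exN hN' ⟨p, not_lt.1 h⟩
  have hKN : K < N := by
    by_contra h
    exact absurd (hsmall N (not_lt.1 h) p) (not_lt.2 hp)
  obtain ⟨ν, hν1, hν2, hν3⟩ := hgood N (by omega)
  have hνr : (ν : ℝ) + 1 ≤ N := by exact_mod_cast hν1
  have exT : ∃ t : ℕ, ∃ p, ε ≤ a p * Real.exp (t * E p - ν * D p) := by
    refine ⟨2 * N - ν, p, hp.trans ?_⟩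
    have : ((2 * N - ν : ℕ) : ℝ) = 2 * N - ν := by
      rw [Nat.cast_sub (by omega)]; push_cast; ring
    rw [this]
    refine mul_le_mul_of_nonneg_left (Real.exp_le_exp.2 ?_) (ha p)
    nlinarith [hD2 p]
  set t := Nat.find exT with htdef
  have ht1 : t ≤ 2 * N - ν := by
    refine Nat.find_min' exT ⟨p, hp.trans ?_⟩
    have : ((2 * N - ν : ℕ) : ℝ) = 2 * N - ν := by
      rw [Nat.cast_sub (by omega)]; push_cast; ring
    rw [this]
    refine mul_le_mul_of_nonneg_left (Real.exp_le_exp.2 ?_) (ha p)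
    nlinarith [hD2 p]
  obtain ⟨p', hp'⟩ := Nat.find_spec exT
  have htmin : ∀ t' < t, ∀ p, a p * Real.exp (t' * E p - ν * D p) < ε := by
    intro t' ht' p
    by_contra h
    exact Nat.find_min exT ht' ⟨p, not_lt.1 h⟩
  have ht2 : ν ≤ t := by
    by_contra h
    push Not at h
    have h1 := hNmin (N-1) (by omega) p'
    have h2 : ((N - 1 : ℕ) : ℝ) = N - 1 := by rw [Nat.cast_sub (by omega)]; simp
    rw [h2] at h1
    have h3 : a p' * Real.exp (t * E p' - ν * D p') ≤ a p' * Real.exp ((N - 1 : ℝ) * (E p' - D p')) := by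
      refine mul_le_mul_of_nonneg_left (Real.exp_le_exp.2 ?_) (ha p')
      have h4 : (t : ℝ) + 1 ≤ ν := by exact_mod_cast h
      have h5 : (t : ℝ) * E p' ≤ ν * E p' := by nlinarith [hE1 p']
      nlinarith [hD1 p']
    linarith
  refine ⟨ν, t, hν3, by omega, ht2, by omega, ⟨p', hp'⟩, fun q => ?_⟩
  have h1 := htmin (t-1) (by omega) q
  have h2 : ((t - 1 : ℕ) : ℝ) = t - 1 := by rw [Nat.cast_sub (by omega)]; simp
  rw [h2] at h1
  have h3 : Real.exp (t * E q - ν * D q) = Real.exp ((t - 1) * E q - ν * D q) * Real.exp (E q) := by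
    rw [← Real.exp_add]; congr 1; ring
  rw [h3, ← mul_assoc]
  exact mul_le_mul h1.le (Real.exp_le_exp.2 (hEK q)) (Real.exp_pos _).le hε.le
end params

noncomputable section P14
variable {n : ℕ}

theorem DD_pow (β : ℕ → ℝ) (ν : ℕ) : DD n β ^ ν = DD n ((ν:ℝ) • β) := by
  induction ν with
  | zero => simp [DD_zero]
  | succ k ih => rw [pow_succ, ih, ← DD_add]; congr 1; push_cast; rw [add_smul, one_smul]

theorem box_sub (O : Set (SL(n, ℝ))) (hO : O ∈ 𝓝 1) : ∃ r : ℝ, 0 < r ∧ ∀ h : SL(n, ℝ),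
    (∀ k l, |h k l - (1 : Matrix (Fin n) (Fin n) ℝ) k l| ≤ r) → h ∈ O := by
  rw [SL_emb.isInducing.nhds_eq_comap] at hO
  obtain ⟨S, hS, hSO⟩ := hO
  have h1 : ∃ r : ℝ, 0 < r ∧ ∀ A : Matrix (Fin n) (Fin n) ℝ, (∀ k l, |A k l - (1 : Matrix (Fin n) (Fin n) ℝ) k l| ≤ r) → A ∈ S := by
    have h2 : S ∈ 𝓝 ((1 : Matrix (Fin n) (Fin n) ℝ) : Fin n → Fin n → ℝ) := hS
    obtain ⟨r, hr, hrS⟩ := (Metric.mem_nhds_iff (α := Fin n → Fin n → ℝ)).1 h2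
    refine ⟨r/2, by linarith, fun A hA => hrS ?_⟩
    refine (Metric.mem_ball (α := Fin n → Fin n → ℝ)).2 ?_
    refine lt_of_le_of_lt (?_ : _ ≤ r/2) (by linarith)
    refine (dist_pi_le_iff (by linarith)).2 fun k => (dist_pi_le_iff (by linarith)).2 fun l => ?_
    rw [Real.dist_eq]; exact hA k l
  obtain ⟨r, hr, h⟩ := h1
  exact ⟨r, hr, fun g hg => hSO (h _ hg)⟩

theorem box_nhds (r : ℝ) (hr : 0 < r) : {h : SL(n, ℝ) | ∀ k l, |h k l - (1 : Matrix (Fin n) (Fin n) ℝ) k l| ≤ r} ∈ 𝓝 1 := by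
  have : ∀ᶠ h : SL(n, ℝ) in 𝓝 1, ∀ k l, |h k l - (1 : Matrix (Fin n) (Fin n) ℝ) k l| ≤ r := by
    rw [eventually_all]; intro k; rw [eventually_all]; intro l
    have hc : Continuous fun h : SL(n, ℝ) => |h k l - (1 : Matrix (Fin n) (Fin n) ℝ) k l| :=
      ((SL_cont_apply k l).sub continuous_const).abs
    have := hc.tendsto 1
    have h2 := this.eventually (gt_mem_nhds (b := |((1:SL(n, ℝ)) k l) - (1 : Matrix (Fin n) (Fin n) ℝ) k l|) (a := r) (by rw [Matrix.SpecialLinearGroup.coe_one, sub_self, abs_zero]; exact hr))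
    exact h2.mono fun h hh => le_of_lt hh
  exact this

theorem box_compact (r : ℝ) : IsCompact {h : SL(n, ℝ) | ∀ k l, |h k l - (1 : Matrix (Fin n) (Fin n) ℝ) k l| ≤ r} := by
  have h2 : IsCompact (Set.univ.pi fun k : Fin n => Set.univ.pi fun l : Fin n =>
      Set.Icc ((1 : Matrix (Fin n) (Fin n) ℝ) k l - r) ((1 : Matrix (Fin n) (Fin n) ℝ) k l + r)) :=
    isCompact_univ_pi fun k => isCompact_univ_pi fun l => isCompact_Icc
  have h3 := SL_emb.isCompact_preimage h2
  convert h3 using 1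
  ext h
  constructor
  · intro H k _ l _
    have := abs_le.1 (H k l)
    exact ⟨by linarith, by linarith⟩
  · intro H k l
    have := H k trivial l trivial
    exact abs_le.2 ⟨by linarith [this.1], by linarith [this.2]⟩

variable {X : Type*} [MulAction (SL(n, ℝ)) X]

open Classical in
theorem good_times (s : SL(n, ℝ)) (Ω Ω1 : Set X)
    (hg : ∀ x ∈ Ω1, ∀ N : ℕ, ∑ k ∈ Finset.range N, Set.indicator Ωᶜ (fun _ => (1 : ℝ)) ((fun x => s • x)^[k] x) ≤ 1/16 * N)
    (x y : X) (hx : x ∈ Ω1) (hy : y ∈ Ω1) (N : ℕ) (hN : 8 ≤ N) :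
    ∃ ν < N, 3 * N ≤ 4 * ν ∧ s ^ ν • x ∈ Ω ∧ s ^ ν • y ∈ Ω := by
  have key : ∀ z ∈ Ω1, ∑ k ∈ Finset.range N, (if s ^ k • z ∈ Ω then (0 : ℝ) else 1) ≤ 1/16 * N := by
    intro z hz
    refine le_trans (le_of_eq (Finset.sum_congr rfl fun k _ => ?_)) (hg z hz N)
    rw [smul_iterate]
    by_cases h : s ^ k • z ∈ Ω <;> simp [h]
  obtain ⟨ν, h1, h2, h3, h4⟩ := good_time (fun k => s ^ k • x ∈ Ω) (fun k => s ^ k • y ∈ Ω) N hN (key x hx) (key y hy)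
  exact ⟨ν, h1, h2, h3, h4⟩

theorem conj_entry (c β : ℕ → ℝ) (ν t : ℕ) (g : SL(n, ℝ)) (k l : Fin n) :
    ((DD n ((t:ℝ) • β))⁻¹ * ((AA n c)^ν * g * ((AA n c)^ν)⁻¹) * DD n ((t:ℝ) • β)) k l =
     g k l * Real.exp (t * (β l - β k) - ν * (hh n c l - hh n c k)) := by
  rw [DD_smul_conj', AA, DD_pow, DD_smul_conj, ← mul_assoc, ← Real.exp_add, mul_comm]
  congr 2; ring

section
variable (L : Subgroup (SL(n, ℝ))) (O : Set (SL(n, ℝ))) (hO : O ∈ 𝓝 1) (hO2 : IsOpen O)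
  (c β : ℕ → ℝ) (hβ : ∀ i, β (i+1) + 1 ≤ β i)
  (h3 : ∀ k l, k < n → l < n → dif (II L) k l → 1 + |hh n c l - hh n c k| ≤ β l - β k)
  (h4 : ∀ k l, l ≤ k → ¬ dif (II L) k l → 2 * (β l - β k) ≤ hh n c l - hh n c k)
  (Ω Ω1 : Set X)
  (hΩ : ∀ (x : ℕ → X) (γ : ℕ → SL(n, ℝ)) (t : ℕ → ℕ) (h : SL(n, ℝ)),
      (∀ k, x k ∈ Ω) → (∀ k, γ k • x k ∈ Ω) → Tendsto t atTop atTop →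
      Tendsto (fun k => (DD n ((t k : ℝ) • β))⁻¹ * γ k * DD n ((t k : ℝ) • β)) atTop (𝓝 h) →
      ∀ g ∈ O, g * h ∈ O → (tau g)⁻¹ * tau (g * h) ∈ L)
  (hg : ∀ x ∈ Ω1, ∀ N : ℕ, ∑ k ∈ Finset.range N, Set.indicator Ωᶜ (fun _ => (1 : ℝ)) ((fun x => AA n c • x)^[k] x) ≤ 1/16 * N)
include hO hβ h3 h4 hΩ hg

theorem A6_2 : ∃ O' ∈ 𝓝 (1 : SL(n, ℝ)), ∀ x g, x ∈ Ω1 → g • x ∈ Ω1 → g ∈ Bm n → g ∈ O' →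
    (∀ k l : Fin n, dif (II L) k l → g k l = 0) → tau g ∈ L := by
  obtain ⟨r, hr, hrO⟩ := box_sub O hO
  refine ⟨_, box_nhds (min r (1/2)) (by positivity), fun x g hx hgx hB hgO hP => ?_⟩
  have hpos : ∀ i, 0 < g i i := fun i => by
    have := (hgO i i).trans (min_le_right _ _)
    rw [Matrix.one_apply_eq, abs_le] at this; linarith
  have htau : ∀ k l, tau g k l = if k = l then g k k else 0 := fun k l => by
    have := congrFun (congrFun (tau_Bm g hB) k) l
    rw [this, Matrix.diagonal_apply, abs_of_pos (hpos k)]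
  have htB : tau g ∈ Bm n := by
    rw [mem_Bm]; intro i j hij; rw [htau, if_neg hij.ne]
  have htt : tau (tau g) = tau g := by
    apply Matrix.SpecialLinearGroup.ext
    intro i j
    have := congrFun (congrFun (tau_Bm (tau g) htB) i) j
    rw [this, htau, Matrix.diagonal_apply, htau, if_pos rfl, abs_of_pos (hpos i)]
  have htO : tau g ∈ O := hrO _ fun k l => by
    rw [htau]
    split_ifs with h
    · subst h; exact (hgO k k).trans (min_le_left _ _)
    · rw [Matrix.one_apply_ne h]; simp [hr.le]
  choose ν hν1 hν2 hν3 hν4 using fun k : ℕ => good_times (AA n c) Ω Ω1 hg x (g • x) hx hgx (k+8) (by omega)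
  have hνt : Tendsto ν atTop atTop := by
    refine tendsto_atTop_mono' atTop (Eventually.of_forall fun k => ?_ : ∀ᶠ k in atTop, k / 2 ≤ ν k) ?_
    · have := hν2 k; omega
    · exact Nat.tendsto_div_const_atTop (by norm_num)
  have := hΩ (fun k => AA n c ^ ν k • x) (fun k => AA n c ^ ν k * g * (AA n c ^ ν k)⁻¹) ν (tau g) hν3
    (fun k => by simpa [mul_smul] using hν4 k) hνt ?_ 1 (mem_of_mem_nhds hO) (by simpa using htO)
  · rw [one_mul, htt, tau_UU 1 (one_mem _), inv_one, one_mul] at this; exact this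
  refine SL_tendsto _ _ fun k l => ?_
  simp only [conj_entry, htau]
  rcases lt_trichotomy k l with h | h | h
  · rw [if_neg h.ne, (mem_Bm g).1 hB k l h]; simp
  · subst h; simp
  · rw [if_neg h.ne']
    by_cases hd : dif (II L) k l
    · rw [hP k l hd]; simp
    · rw [← mul_zero (g k l)]
      refine Tendsto.const_mul _ ?_
      have hE : 1 ≤ β l - β k := by
        have h9 := (beta_lt β hβ).antitone (Nat.succ_le_of_lt (Fin.lt_def.1 h)); have := hβ l; simp only [Nat.succ_eq_add_one] at h9; linarith
      have hD := h4 k l (Fin.lt_def.1 h).le hd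
      have ht : Tendsto (fun j => - (ν j : ℝ)) atTop atBot :=
        tendsto_neg_atTop_atBot.comp (tendsto_natCast_atTop_atTop.comp hνt)
      refine Real.tendsto_exp_atBot.comp (tendsto_atBot_mono (fun j => ?_) ht)
      have : (0:ℝ) ≤ ν j := Nat.cast_nonneg _
      nlinarith

theorem A6_1 (hO2 : IsOpen O) : ∃ O' ∈ 𝓝 (1 : SL(n, ℝ)), ∀ x g, x ∈ Ω1 → g • x ∈ Ω1 → g ∈ Bm n → g ∈ O' →
    (∀ k l : Fin n, dif (II L) k l → g k l = 0) := by
  classical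
  obtain ⟨r, hr, hrO⟩ := box_sub O hO
  let ι := {p : Fin n × Fin n // dif (II L) p.1 p.2}
  let E : ι → ℝ := fun p => β p.1.2 - β p.1.1
  let D : ι → ℝ := fun p => hh n c p.1.2 - hh n c p.1.1
  obtain ⟨Kmax, hEK⟩ : ∃ K, ∀ p, E p ≤ K := by
    obtain ⟨K, hK⟩ := (Set.finite_range E).bddAbove
    exact ⟨K, fun p => hK ⟨p, rfl⟩⟩
  have hED : ∀ p, 1 + |D p| ≤ E p := fun p => h3 _ _ p.1.1.2 p.1.2.2 p.2
  set ε : ℝ := r * Real.exp (-Kmax) with hεd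
  have hε : 0 < ε := by positivity
  have hεK : ε * Real.exp Kmax = r := by rw [hεd, mul_assoc, ← Real.exp_add]; simp
  by_contra hcon
  push Not at hcon
  obtain ⟨B, hB⟩ := (𝓝 (1 : SL(n, ℝ))).exists_antitone_basis
  have hW : ∀ m : ℕ, ∀ᶠ g : SL(n, ℝ) in 𝓝 1, ∀ N ∈ Finset.range (m+8+1), ∀ p : ι,
      |g p.1.1 p.1.2| * Real.exp (N * (E p - D p)) < ε := by
    intro m
    rw [Finset.eventually_all]; intro N _
    rw [eventually_all]; intro p
    have hc : Continuous fun g : SL(n, ℝ) => |g p.1.1 p.1.2| * Real.exp (N * (E p - D p)) :=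
      (SL_cont_apply _ _).abs.mul continuous_const
    refine (hc.tendsto 1).eventually (gt_mem_nhds ?_)
    obtain ⟨m', _, hm2, hm3⟩ := p.2
    have : p.1.1 ≠ p.1.2 := fun h => by rw [h] at hm3; omega
    rw [Matrix.SpecialLinearGroup.coe_one, Matrix.one_apply_ne this]; simpa using hε
  choose x g hx hgx hgB hgO hgP using fun m : ℕ => hcon (B m ∩ _) (inter_mem (hB.1.mem_of_mem trivial) (hW m))
  have hg1 : Tendsto g atTop (𝓝 1) := hB.tendsto fun m => (hgO m).1
  have key := fun m : ℕ => times (fun p : ι => |g m p.1.1 p.1.2|) E D ε Kmax hε (fun p => abs_nonneg _)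
    (by obtain ⟨k, l, h1, h2⟩ := hgP m; exact ⟨⟨(k,l), h1⟩, abs_pos.2 h2⟩) hED hEK _
    (fun N hN => good_times (AA n c) Ω Ω1 hg (x m) (g m • x m) (hx m) (hgx m) N hN) (m+8) (by omega)
    (fun N hN p => (hgO m).2 N (Finset.mem_range.2 (by omega)) p)
  choose ν t hgood hν hνt htν hlow hup using key
  have htt : Tendsto t atTop atTop := by
    refine tendsto_atTop_mono' atTop (Eventually.of_forall fun k => ?_ : ∀ᶠ k in atTop, k / 2 ≤ t k) ?_
    · have := hν k; have := hνt k; omega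
    · exact Nat.tendsto_div_const_atTop (by norm_num)
  set H : ℕ → SL(n, ℝ) := fun m => (DD n ((t m:ℝ) • β))⁻¹ * ((AA n c)^(ν m) * g m * ((AA n c)^(ν m))⁻¹) * DD n ((t m:ℝ) • β) with hH
  have hHe : ∀ m k l, H m k l = g m k l * Real.exp (t m * (β l - β k) - ν m * (hh n c l - hh n c k)) := fun m k l =>
    conj_entry c β _ _ _ k l
  have hgkl : ∀ k l, Tendsto (fun m => g m k l) atTop (𝓝 ((1 : Matrix (Fin n) (Fin n) ℝ) k l)) := fun k l => by
    have := ((SL_cont_apply k l).tendsto 1).comp hg1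
    rwa [Matrix.SpecialLinearGroup.coe_one] at this
  have hbox : ∀ᶠ m in atTop, ∀ k l, |H m k l - (1 : Matrix (Fin n) (Fin n) ℝ) k l| ≤ r := by
    rw [eventually_all]; intro k; rw [eventually_all]; intro l
    by_cases hd : dif (II L) k l
    · refine Eventually.of_forall fun m => ?_
      have hne : k ≠ l := fun h => by
        obtain ⟨m', _, hm2, hm3⟩ := hd
        rw [h] at hm3; omega
      rw [Matrix.one_apply_ne hne, sub_zero, hHe, abs_mul, abs_of_pos (Real.exp_pos _), ← hεK]
      exact hup m ⟨(k,l), hd⟩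
    · have h0 : Tendsto (fun m => |g m k l - (1 : Matrix (Fin n) (Fin n) ℝ) k l|) atTop (𝓝 0) := by
        have := ((hgkl k l).sub_const ((1 : Matrix (Fin n) (Fin n) ℝ) k l)).abs
        simpa using this
      filter_upwards [h0.eventually (gt_mem_nhds hr)] with m hm
      refine le_trans ?_ hm.le
      rcases lt_trichotomy k l with h | h | h
      · rw [hHe, (mem_Bm _).1 (hgB m) k l h]; simp
      · subst h; rw [hHe]; simp
      · rw [Matrix.one_apply_ne h.ne', sub_zero, sub_zero, hHe, abs_mul, abs_of_pos (Real.exp_pos _)]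
        refine mul_le_of_le_one_right (abs_nonneg _) (Real.exp_le_one_iff.2 ?_)
        have hE : 1 ≤ β l - β k := by
          have h9 := (beta_lt β hβ).antitone (Nat.succ_le_of_lt (Fin.lt_def.1 h)); have := hβ l; simp only [Nat.succ_eq_add_one] at h9; linarith
        have hD := h4 k l (Fin.lt_def.1 h).le hd
        have h5 : (t m : ℝ) ≤ 2 * ν m := by have := htν m; exact_mod_cast (by omega : t m ≤ 2 * ν m)
        have h6 : (0:ℝ) ≤ ν m := Nat.cast_nonneg _
        nlinarith
  obtain ⟨h, hhC, φ, hφ, hlim⟩ := (box_compact (n := n) r).tendsto_subseq' hbox.frequently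
  have hhO : h ∈ O := hrO h hhC
  have hlimkl : ∀ k l, Tendsto (fun m => H (φ m) k l) atTop (𝓝 (h k l)) := fun k l =>
    ((SL_cont_apply k l).tendsto h).comp hlim
  have hhB : h ∈ Bm n := by
    rw [mem_Bm]; intro k l hkl
    refine tendsto_nhds_unique (hlimkl k l) ?_
    have : (fun m => H (φ m) k l) = fun _ => 0 := by
      funext m; rw [hHe, (mem_Bm _).1 (hgB _) k l hkl, zero_mul]
    rw [this]; exact tendsto_const_nhds
  have hHyp : Hyp L h := by
    have hc : Tendsto (fun u : SL(n, ℝ) => u * h) (𝓝 1) (𝓝 h) := by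
      have := (continuous_mul_const h).tendsto (1 : SL(n, ℝ)); rwa [one_mul] at this
    filter_upwards [hO, hc (hO2.mem_nhds hhO)] with u hu hu2 huU
    have := hΩ (fun k => AA n c ^ ν (φ k) • x (φ k)) (fun k => AA n c ^ ν (φ k) * g (φ k) * (AA n c ^ ν (φ k))⁻¹)
      (fun k => t (φ k)) h (fun k => (hgood (φ k)).1)
      (fun k => by simpa [mul_smul] using (hgood (φ k)).2) (htt.comp hφ.tendsto_atTop) hlim u hu hu2
    rwa [tau_UU u huU, inv_one, one_mul] at this
  have hz : ∀ k l : Fin n, dif (II L) k l → h k l = 0 := by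
    rintro k l ⟨m, hm1, hm2, hm3⟩
    exact Hyp_claim L (k - l) h hhB hHyp k l m (by omega) hm1 hm2 hm3
  have hsum : Tendsto (fun m => ∑ p : ι, |H (φ m) p.1.1 p.1.2|) atTop (𝓝 (∑ p : ι, |h p.1.1 p.1.2|)) :=
    tendsto_finsetSum _ fun p _ => (hlimkl _ _).abs
  have h7 : ε ≤ ∑ p : ι, |h p.1.1 p.1.2| := by
    refine ge_of_tendsto' hsum fun m => ?_
    obtain ⟨p, hp⟩ := hlow (φ m)
    refine hp.trans ?_
    have : |H (φ m) p.1.1 p.1.2| = |g (φ m) p.1.1 p.1.2| * Real.exp (t (φ m) * E p - ν (φ m) * D p) := by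
      rw [hHe, abs_mul, abs_of_pos (Real.exp_pos _)]
    rw [← this]
    exact Finset.single_le_sum (f := fun p : ι => |H (φ m) p.1.1 p.1.2|) (fun _ _ => abs_nonneg _) (Finset.mem_univ p)
  have h8 : ∑ p : ι, |h p.1.1 p.1.2| = 0 := Finset.sum_eq_zero fun p _ => by rw [hz _ _ p.2, abs_zero]
  linarith

end
end P14

noncomputable section P15
section gen
variable {G X : Type*} [Group G] [TopologicalSpace G] [IsTopologicalGroup G] [LocallyCompactSpace G]
  [SecondCountableTopology G] [T2Space G] [MeasurableSpace G] [BorelSpace G]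
  [TopologicalSpace X] [SecondCountableTopology X] [MeasurableSpace X]
    [BorelSpace X] [MulAction G X] [ContinuousSMul G X] [LocallyCompactSpace X] [T2Space X]

theorem A7_gen (Q : Subgroup G) (μ : Measure X) [IsProbabilityMeasure μ] (Ω1 : Set X) (hm : MeasurableSet Ω1)
    (hΩ1 : μ Ω1ᶜ ≤ 1/10) (hopen : ∀ x : X, ∀ V ∈ 𝓝 (1:G), (fun g : G => g • x) '' V ∈ 𝓝 x)
    (O1 : Set G) (hO1 : IsOpen O1) (h1 : 1 ∈ O1) (K0 : Set G) (hK0 : IsCompact K0) (hOK : O1 ⊆ K0)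
    (up : G → G) (hupc : ContinuousOn up O1)
    (hupQ : ∀ h ∈ O1, up h ∈ Q) (hupL : ∀ h ∈ O1, up h ∈ Lst G μ)
    (hkey : ∀ x h h', h ∈ O1 → h' ∈ O1 → up h' • x ∈ Ω1 →
      ((h*(up h)⁻¹)⁻¹*(h'*(up h')⁻¹)) • up h' • x ∈ Ω1 → (h*(up h)⁻¹)⁻¹*(h'*(up h')⁻¹) ∈ Q) :
    ∃ x1 : X, 0 < μ {y | ∃ q ∈ Q, q • x1 = y} := by
  classical
  set lam : Measure G := (Measure.haar : Measure G).inv with hlam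
  haveI : lam.IsMulRightInvariant := by rw [hlam]; infer_instance
  haveI : lam.Regular := by rw [hlam]; infer_instance
  haveI : lam.IsOpenPosMeasure := by rw [hlam]; infer_instance
  haveI : SFinite lam := by
    haveI := sigmaCompactSpace_of_locallyCompact_secondCountable (X := G)
    infer_instance
  have hM0 : 0 < lam O1 := hO1.measure_pos lam ⟨1, h1⟩
  have hMt : lam O1 ≠ ∞ := ((measure_mono hOK).trans_lt hK0.measure_lt_top).ne
  set up' : G → G := O1.piecewise up (fun _ => 1) with hup'
  have hup'm : Measurable up' := hupc.measurable_piecewise continuousOn_const hO1.measurableSet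
  have hup'e : ∀ h ∈ O1, up' h = up h := fun h hh => Set.piecewise_eq_of_mem _ _ _ hh
  set S : Set (G × X) := {p | p.1 ∈ O1 ∧ up' p.1 • p.2 ∈ Ω1ᶜ} with hS
  have hSm : MeasurableSet S := by
    refine (measurable_fst hO1.measurableSet).inter ?_
    have : Measurable fun p : G × X => up' p.1 • p.2 := 
      (continuous_smul (M := G) (X := X)).measurable.comp ((hup'm.comp measurable_fst).prodMk measurable_snd)
    exact this hm.compl
  have hSe : (lam.prod μ) S ≤ lam O1 * (1/10) := by
    rw [Measure.prod_apply hSm]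
    calc ∫⁻ h, μ (Prod.mk h ⁻¹' S) ∂lam ≤ ∫⁻ h, O1.indicator (fun _ => 1/10) h ∂lam := by
          refine lintegral_mono fun h => ?_
          by_cases hh : h ∈ O1
          · rw [Set.indicator_of_mem hh]
            have : Prod.mk h ⁻¹' S = (fun x : X => up h • x) ⁻¹' Ω1ᶜ := by
              ext x; simp [hS, hh, hup'e h hh]
            rw [this, ((mem_Lst μ _).1 (hupL h hh)).measure_preimage hm.compl.nullMeasurableSet]
            exact hΩ1
          · have : Prod.mk h ⁻¹' S = ∅ := by ext x; simp [hS, hh]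
            rw [this]; simp
      _ = _ := by rw [lintegral_indicator_const hO1.measurableSet, mul_comm]
  rw [Measure.prod_apply_symm hSm] at hSe
  set f : X → ℝ≥0∞ := fun x => lam ((fun h => (h, x)) ⁻¹' S) with hf
  have hfm : Measurable f := measurable_measure_prodMk_right hSm
  set Ω2 : Set X := {x | f x < lam O1 * (2/5)} with hΩ2
  have hpos : μ Ω2 ≠ 0 := by
    intro h0
    have : ∀ᵐ x ∂μ, lam O1 * (2/5) ≤ f x := by
      rw [ae_iff]; simpa [hΩ2] using h0
    have h3 := lintegral_mono_ae this
    rw [lintegral_const, measure_univ, mul_one] at h3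
    have h4 := h3.trans hSe
    rw [ENNReal.mul_le_mul_iff_right hM0.ne' hMt] at h4
    have : ((1:ℝ≥0∞)/10).toReal < ((2:ℝ≥0∞)/5).toReal := by norm_num [ENNReal.toReal_div]
    have h5 := (ENNReal.toReal_lt_toReal (by norm_num [ENNReal.div_eq_top]) (by norm_num [ENNReal.div_eq_top])).1 this
    exact absurd h4 (not_le.2 h5)
  obtain ⟨K, hKO, hKc, hK⟩ : ∃ K ⊆ O1, IsCompact K ∧ lam O1 * (4/5) < lam K := by
    refine hO1.exists_lt_isCompact ?_
    conv_rhs => rw [← mul_one (lam O1)]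
    rw [ENNReal.mul_lt_mul_iff_right hM0.ne' hMt]
    rw [← ENNReal.toReal_lt_toReal (by norm_num [ENNReal.div_eq_top]) (by norm_num)]
    norm_num [ENNReal.toReal_div]
  obtain ⟨V, hV, hVK⟩ : ∃ V ∈ 𝓝 (1 : G), ∀ g ∈ V, ∀ h ∈ K, h * g ∈ O1 := by
    obtain ⟨V, hV, h⟩ := compact_open_separated_mul_right hKc hO1 hKO
    exact ⟨V, hV, fun g hg h' hh => h ⟨h', hh, g, hg, rfl⟩⟩
  have main : ∀ x ∈ Ω2, ∀ g ∈ V, g • x ∈ Ω2 → ∃ q ∈ Q, q • x = g • x := by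
    intro x hx g hg hgx
    set B1 := (fun h => (h, g • x)) ⁻¹' S
    set B2 := (fun h => h * g) ⁻¹' ((fun h => (h, x)) ⁻¹' S)
    have hB2 : lam B2 = f x := measure_preimage_mul_right lam g _
    have : lam (B1 ∪ B2) < lam K := by
      refine (measure_union_le _ _).trans_lt (lt_trans (?_ : _ < lam O1 * (4/5)) hK)
      rw [hB2]
      refine (ENNReal.add_lt_add hgx hx).trans_le ?_
      rw [← mul_add]
      refine mul_le_mul_right (le_of_eq ?_) _
      rw [ENNReal.div_add_div_same]; norm_num
    obtain ⟨h, hhK, hhB⟩ : ∃ h ∈ K, h ∉ B1 ∪ B2 := by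
      by_contra hcon
      push Not at hcon
      exact absurd (measure_mono (μ := lam) hcon) (not_le.2 this)
    have a1 : h ∈ O1 := hKO hhK
    have a2 : h * g ∈ O1 := hVK g hg h hhK
    have b1 : up h • g • x ∈ Ω1 := by
      by_contra hb
      exact hhB (Or.inl (by simp only [B1, hS, Set.mem_preimage, Set.mem_setOf_eq, hup'e h a1]; exact ⟨a1, hb⟩))
    have b2 : up (h * g) • x ∈ Ω1 := by
      by_contra hb
      exact hhB (Or.inr (by simp only [B2, hS, Set.mem_preimage, Set.mem_setOf_eq, hup'e _ a2]; exact ⟨a2, hb⟩))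
    have e : ((h*(up h)⁻¹)⁻¹*((h*g)*(up (h*g))⁻¹)) • up (h*g) • x = up h • g • x := by
      simp only [smul_smul]; congr 1; group
    have hq := hkey x h (h*g) a1 a2 b2 (by rw [e]; exact b1)
    refine ⟨(up h)⁻¹ * (((h*(up h)⁻¹)⁻¹*((h*g)*(up (h*g))⁻¹)) * up (h*g)),
      mul_mem (inv_mem (hupQ _ a1)) (mul_mem hq (hupQ _ a2)), ?_⟩
    rw [mul_smul, mul_smul, e, inv_smul_smul]
  obtain ⟨x1, hx1, hx1'⟩ := exists_mem_forall_mem_nhdsWithin_pos_measure hpos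
  refine ⟨x1, (hx1' (Ω2 ∩ (fun g : G => g • x1) '' V) ?_).trans_le (measure_mono ?_)⟩
  · exact inter_mem self_mem_nhdsWithin (mem_nhdsWithin_of_mem_nhds (hopen x1 V hV))
  · rintro _ ⟨h1, g, hg, rfl⟩
    exact main x1 hx1 g hg h1

end gen
end P15

noncomputable section P16
variable {n : ℕ}

def PI (n : ℕ) (I : Set ℕ) : Subgroup (SL(n, ℝ)) :=
  ⨅ m : {m : ℕ // m ∉ I}, Par (fun i : Fin n => if m.1 ≤ (i:ℕ) then (1:ℕ) else 0)

theorem mem_PI (I : Set ℕ) (g : SL(n, ℝ)) : g ∈ PI n I ↔ ∀ k l : Fin n, dif I k l → g k l = 0 := by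
  simp only [PI, Subgroup.mem_iInf, mem_Par]
  constructor
  · rintro h k l ⟨m, h1, h2, h3⟩
    exact h ⟨m, h1⟩ k l (by simp [h3, h2])
  · rintro h ⟨m, hm⟩ k l h1
    refine h k l ⟨m, hm, ?_, ?_⟩
    · by_contra hc; push Not at hc; simp only [hc, if_true] at h1; split_ifs at h1 <;> omega
    · by_contra hc; simp only [hc, if_false] at h1; omega

theorem PI_closed (I : Set ℕ) : IsClosed (PI n I : Set (SL(n, ℝ))) := by
  rw [PI, Subgroup.coe_iInf]
  exact isClosed_iInter fun m => Par_closed _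

theorem chi_PI (I : Set ℕ) (j : ℕ) (hj : j ∉ I) (g h : SL(n, ℝ)) (hh : h ∈ PI n I) :
    chi j (g * h) = chi j g * chi j h :=
  chi_mul j g h (Or.inr fun i k hi hk => (mem_PI I h).1 hh k i ⟨j, hj, hi, hk⟩)

theorem chi_PI_ne (I : Set ℕ) (j : ℕ) (hj : j ∉ I) (g : SL(n, ℝ)) (hg : g ∈ PI n I) : chi j g ≠ 0 := by
  have := chi_PI I j hj g⁻¹ g hg
  rw [inv_mul_cancel, chi_one] at this
  intro h; rw [h, mul_zero] at this; norm_num at this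

open Classical in
def psi (I : Set ℕ) (g : SL(n, ℝ)) (j : ℕ) : ℝ := if j ∈ I then 0 else Real.log (chi j g)

theorem psi_mul (I : Set ℕ) (g h : SL(n, ℝ)) (hg : g ∈ PI n I) (hh : h ∈ PI n I) :
    psi I (g * h) = psi I g + psi I h := by
  funext j
  by_cases hj : j ∈ I
  · simp [psi, hj]
  · simp only [psi, hj, if_false, Pi.add_apply]
    rw [chi_PI I j hj g h hh, Real.log_mul (chi_PI_ne I j hj g hg) (chi_PI_ne I j hj h hh)]

theorem psi_UU (I : Set ℕ) (g : SL(n, ℝ)) (hg : g ∈ UU n) : psi I g = 0 := by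
  funext j; simp [psi, chi_UU j g hg]

def QQ (L : Subgroup (SL(n, ℝ))) : Subgroup (SL(n, ℝ)) where
  carrier := {g | g ∈ PI n (II L) ∧ AA n (psi (II L) g) ∈ L}
  mul_mem' := fun {g h} hg hh => ⟨mul_mem hg.1 hh.1, by
    rw [psi_mul _ g h hg.1 hh.1, AA_add]; exact mul_mem hg.2 hh.2⟩
  one_mem' := ⟨one_mem _, by rw [psi_UU _ _ (one_mem _), AA_zero]; exact one_mem _⟩
  inv_mem' := fun {g} hg => ⟨inv_mem hg.1, by
    have := psi_mul (II L) g g⁻¹ hg.1 (inv_mem hg.1)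
    rw [mul_inv_cancel, psi_UU _ _ (one_mem _)] at this
    have e : psi (II L) g⁻¹ = - psi (II L) g := by
      rw [eq_neg_iff_add_eq_zero, add_comm]; exact this.symm
    rw [e, AA_neg]; exact inv_mem hg.2⟩

theorem QQ_closed (L : Subgroup (SL(n, ℝ))) (hL : IsClosed (L : Set (SL(n, ℝ)))) : IsClosed (QQ L : Set (SL(n, ℝ))) := by
  have h : ContinuousOn (fun g : SL(n, ℝ) => AA n (psi (II L) g)) (PI n (II L) : Set (SL(n, ℝ))) := by
    refine AA_cont _ _ fun j _ _ => ?_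
    by_cases hj : j ∈ II L
    · simp only [psi, hj, if_true]; exact continuousOn_const
    · simp only [psi, hj, if_false]
      exact (chi_cont j).continuousOn.log fun g hg => chi_PI_ne _ j hj g hg
  exact h.preimage_isClosed_of_isClosed (PI_closed _) hL

theorem UU_QQ (L : Subgroup (SL(n, ℝ))) : UU n ≤ QQ L := fun g hg => by
  refine ⟨?_, by rw [psi_UU _ _ hg, AA_zero]; exact one_mem _⟩
  rw [mem_PI]; rintro k l ⟨m, _, h2, h3⟩
  exact ((mem_UU g).1 hg).2 k l (Fin.lt_def.2 (by omega))

theorem mem_QQ_iff (L : Subgroup (SL(n, ℝ))) (p : SL(n, ℝ)) (hp : p ∈ PI n (II L)) :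
    p ∈ QQ L ↔ tau p ∈ L := by
  have h1 : p ∈ QQ L ↔ AA n (psi (II L) p) ∈ L := ⟨fun h => h.2, fun h => ⟨hp, h⟩⟩
  have h2 : AA n ((fun j => Real.log (chi j p)) - psi (II L) p) ∈ L := AA_mem L _ fun j _ _ hj => by
    simp [psi, hj]
  rw [AA_sub] at h2
  rw [h1, tau]
  constructor
  · intro h; have := mul_mem h2 h; simpa using this
  · intro h; have := mul_mem (inv_mem h2) h; simpa using this

/-- unipotent lower triangular part of `PI` -/
def UI (n : ℕ) (I : Set ℕ) : Set (SL(n, ℝ)) := {w | w ∈ PI n I ∧ w ∈ Bm n ∧ ∀ i, w i i = 1}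

theorem tau_diag1 (w : SL(n, ℝ)) (hw : w ∈ Bm n) (h : ∀ i, w i i = 1) : tau w = 1 := by
  apply Matrix.SpecialLinearGroup.ext
  intro i j
  rw [congrFun (congrFun (tau_Bm w hw) i) j, Matrix.diagonal_apply, h, abs_one]; rfl

theorem UI_QQ (L : Subgroup (SL(n, ℝ))) (w : SL(n, ℝ)) (hw : w ∈ UI n (II L)) : w ∈ QQ L := by
  rw [mem_QQ_iff L w hw.1, tau_diag1 w hw.2.1 hw.2.2]; exact one_mem _

theorem AA_Bm (c : ℕ → ℝ) : AA n c ∈ Bm n := by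
  rw [mem_Bm]; intro i j hij; rw [AA_apply, Matrix.diagonal_apply_ne _ hij.ne]

theorem tau_AA (c : ℕ → ℝ) : tau (AA n c) = AA n c := by
  apply Matrix.SpecialLinearGroup.ext
  intro i j
  rw [congrFun (congrFun (tau_Bm _ (AA_Bm c)) i) j, AA_apply, Matrix.diagonal_apply, Matrix.diagonal_apply_eq,
    abs_of_pos (Real.exp_pos _), Matrix.diagonal_apply]

theorem AA_PI (I : Set ℕ) (c : ℕ → ℝ) : AA n c ∈ PI n I := by
  rw [mem_PI]; rintro k l ⟨m, _, h2, h3⟩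
  rw [AA_apply, Matrix.diagonal_apply_ne]
  intro h; subst h; omega

theorem AA_QQ (L : Subgroup (SL(n, ℝ))) (c : ℕ → ℝ) (hc : AA n c ∈ L) : AA n c ∈ QQ L := by
  rw [mem_QQ_iff L _ (AA_PI _ c), tau_AA]; exact hc

/-- near the identity, elements of `QQ` are of the form `w * l`. -/
theorem QQ_fac (L : Subgroup (SL(n, ℝ))) (hUL : UU n ≤ L) (q v : SL(n, ℝ)) (hq : q ∈ QQ L) (hv : v ∈ UU n)
    (hb : q * v⁻¹ ∈ Bm n) (hp : ∀ i, 0 < (q * v⁻¹) i i) : ∃ w ∈ UI n (II L), w = q * v⁻¹ * (tau (q * v⁻¹))⁻¹ ∧ ∃ l ∈ L, l ∈ QQ L ∧ q = w * l := by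
  set b := q * v⁻¹ with hbd
  have hbQ : b ∈ QQ L := mul_mem hq (inv_mem (UU_QQ L hv))
  have ht : tau b ∈ L := (mem_QQ_iff L b hbQ.1).1 hbQ
  have htQ : tau b ∈ QQ L := AA_QQ L _ ht
  have htB : tau b ∈ Bm n := AA_Bm _
  have hwB : b * (tau b)⁻¹ ∈ Bm n := mul_mem hb (inv_mem htB)
  refine ⟨b * (tau b)⁻¹, ⟨(mul_mem hbQ (inv_mem htQ)).1, hwB, fun i => ?_⟩, rfl, tau b * v,
    mul_mem ht (hUL hv), mul_mem htQ (UU_QQ L hv), by rw [hbd]; group⟩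
  have h1 := Bm_diag_mul _ _ hwB htB i
  rw [inv_mul_cancel_right] at h1
  have h2 : tau b i i = b i i := by
    rw [congrFun (congrFun (tau_Bm b hb) i) i, Matrix.diagonal_apply_eq, abs_of_pos (hp i)]
  rw [h2] at h1
  exact (mul_eq_right₀ (hp i).ne').1 h1.symm

end P16

noncomputable section P17
variable {H X : Type*} [Group H] [TopologicalSpace H] [IsTopologicalGroup H] [LocallyCompactSpace H]
  [SecondCountableTopology H] [T2Space H] [MeasurableSpace H] [BorelSpace H]
  [TopologicalSpace X] [MeasurableSpace X]
    [BorelSpace X] [MulAction H X] [ContinuousSMul H X] [T2Space X]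

theorem pi_cont (x : X) : Continuous fun h : H => h • x := continuous_id.smul continuous_const

theorem stab_countable (x1 : X) (V : Set H) (hV : V ∈ 𝓝 1) (hinj : Set.InjOn (fun h : H => h • x1) V) :
    Countable (MulAction.stabilizer H x1) := by
  haveI : SecondCountableTopology (MulAction.stabilizer H x1) :=
    TopologicalSpace.Subtype.secondCountableTopology (MulAction.stabilizer H x1 : Set H)
  haveI : DiscreteTopology (MulAction.stabilizer H x1) := by
    rw [discreteTopology_iff_isOpen_singleton_one, isOpen_singleton_iff_nhds_eq_pure]
    refine le_antisymm ?_ (pure_le_nhds _)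
    rw [le_pure_iff]
    have : (Subtype.val : MulAction.stabilizer H x1 → H) ⁻¹' V ∈ 𝓝 (1 : MulAction.stabilizer H x1) :=
      continuous_subtype_val.continuousAt.preimage_mem_nhds hV
    refine mem_of_superset this ?_
    rintro ⟨g, hg⟩ hgV
    refine Subtype.ext (hinj hgV (mem_of_mem_nhds hV) ?_)
    simpa using hg
  exact countable_of_Lindelof_of_discrete

theorem chart (K : Set H) (hK : IsCompact K) (x1 : X) (hinj : Set.InjOn (fun h : H => h • x1) K) :
    ∃ ς : X → H, Measurable ς ∧ ∀ h ∈ K, ς (h • x1) = h := by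
  classical
  set P : Set X := (fun h : H => h • x1) '' K with hP
  have hPc : IsCompact P := hK.image (pi_cont x1)
  choose! f hf using fun (x : X) (hx : x ∈ P) => hx
  refine ⟨P.piecewise f (fun _ => 1), ?_, fun h hh => ?_⟩
  · refine measurable_of_isClosed fun B hB => ?_
    have : P.piecewise f (fun _ => 1) ⁻¹' B = ((fun h : H => h • x1) '' (K ∩ B)) ∪ (Pᶜ ∩ {x | (1 : H) ∈ B}) := by
      ext x
      by_cases hx : x ∈ P
      · simp only [Set.mem_preimage, Set.piecewise_eq_of_mem _ _ _ hx, Set.mem_union, Set.mem_inter_iff,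
          Set.mem_compl_iff, hx, not_true, false_and, or_false]
        constructor
        · intro h; exact ⟨f x, ⟨(hf x hx).1, h⟩, (hf x hx).2⟩
        · rintro ⟨h, ⟨h1, h2⟩, h3⟩
          have : f x = h := hinj (hf x hx).1 h1 (by rw [h3]; exact (hf x hx).2)
          rwa [this]
      · simp only [Set.mem_preimage, Set.piecewise_eq_of_notMem _ _ _ hx, Set.mem_union, Set.mem_inter_iff,
          Set.mem_compl_iff, hx, not_false_eq_true, true_and, Set.mem_setOf_eq]
        constructor
        · intro h; exact Or.inr h
        · rintro (⟨h, ⟨h1, h2⟩, h3⟩ | h)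
          · exact absurd ⟨h, h1, h3⟩ hx
          · exact h
    rw [this]
    exact ((hK.inter_right hB).image (pi_cont x1)).isClosed.measurableSet.union
      (hPc.isClosed.measurableSet.compl.inter (MeasurableSet.const _))
  · have hx : h • x1 ∈ P := ⟨h, hh, rfl⟩
    rw [Set.piecewise_eq_of_mem _ _ _ hx]
    exact hinj (hf _ hx).1 hh (hf _ hx).2

theorem exists_section (x1 : X) (V : Set H) (hV : V ∈ 𝓝 1) (hinj : Set.InjOn (fun h : H => h • x1) V) :
    ∃ ς : X → H, Measurable ς ∧ ∀ h : H, ς (h • x1) • x1 = h • x1 := by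
  classical
  obtain ⟨K, hKn, hKV, hK⟩ := local_compact_nhds hV
  obtain ⟨T, hTc, hT⟩ := TopologicalSpace.countable_cover_nhds (f := fun h : H => (fun x => h⁻¹ * x) ⁻¹' K)
    (fun h => (continuous_const_mul h⁻¹).continuousAt.preimage_mem_nhds (by simpa using hKn))
  have hTne : T.Nonempty := by
    by_contra h
    rw [Set.not_nonempty_iff_eq_empty] at h
    rw [h] at hT; simp at hT
    exact (Set.empty_ne_univ hT)
  obtain ⟨e, he⟩ := hTc.exists_eq_range hTne
  have hcov : ∀ h : H, ∃ i : ℕ, (e i)⁻¹ * h ∈ K := by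
    intro h
    have : h ∈ ⋃ x ∈ T, (fun y => x⁻¹ * y) ⁻¹' K := by rw [hT]; trivial
    simp only [Set.mem_iUnion, he, Set.mem_range] at this
    obtain ⟨_, ⟨i, rfl⟩, h2⟩ := this
    exact ⟨i, h2⟩
  have hch : ∀ i : ℕ, ∃ ς : X → H, Measurable ς ∧ ∀ h ∈ (fun x => e i * x) '' K, ς (h • x1) = h := by
    intro i
    refine chart _ (hK.image (continuous_const_mul _)) x1 ?_
    rintro _ ⟨a, ha, rfl⟩ _ ⟨b, hb, rfl⟩ hab
    have : a • x1 = b • x1 := by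
      simpa [mul_smul] using hab
    simp only; rw [hinj (hKV ha) (hKV hb) this]
  choose σ hσm hσ using hch
  set P : ℕ → Set X := fun i => (fun h : H => h • x1) '' ((fun x => e i * x) '' K) with hP
  have hPm : ∀ i, MeasurableSet (P i) := fun i =>
    ((hK.image (continuous_const_mul _)).image (pi_cont x1)).isClosed.measurableSet
  set p : ℕ → X → Prop := fun i x => x ∈ P i ∪ (⋃ j, P j)ᶜ with hp
  have hpe : ∀ x, ∃ i, p i x := by
    intro x
    by_cases h : x ∈ ⋃ j, P j
    · obtain ⟨i, hi⟩ := Set.mem_iUnion.1 h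
      exact ⟨i, Or.inl hi⟩
    · exact ⟨0, Or.inr h⟩
  refine ⟨_, Measurable.find (f := σ) (p := p) hσm (fun i => (hPm i).union (MeasurableSet.iUnion hPm).compl) hpe, ?_⟩
  intro h
  have h1 := Nat.find_spec (hpe (h • x1))
  rcases h1 with h1 | h1
  · obtain ⟨k, hk, hk2⟩ := h1
    simp only at hk2
    generalize Nat.find (hpe (h • x1)) = i at *
    rw [← hk2, hσ i k hk]
  · exfalso
    obtain ⟨i, hi⟩ := hcov h
    exact h1 (Set.mem_iUnion.2 ⟨i, h, ⟨_, hi, by simp⟩, rfl⟩)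

end P17

noncomputable section P18
variable {H X : Type*} [Group H] [TopologicalSpace H] [IsTopologicalGroup H] [LocallyCompactSpace H]
  [SecondCountableTopology H] [T2Space H] [MeasurableSpace H] [BorelSpace H]

theorem TVcont (lam : Measure H) [lam.IsHaarMeasure] (ν : Measure H) [IsFiniteMeasure ν] (hν : ν ≪ lam)
    (ε : ℝ) (hε : 0 < ε) : ∀ᶠ v in 𝓝 (1:H), ∀ B, MeasurableSet B →
      |ν.real ((fun y => v * y) ⁻¹' B) - ν.real B| ≤ ε := by
  haveI := sigmaCompactSpace_of_locallyCompact_secondCountable (X := H)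
  set f : H → ℝ := fun x => (ν.rnDeriv lam x).toReal with hf
  have hfi : Integrable f lam := Measure.integrable_toReal_rnDeriv
  have hfν : ∀ B, ν.real B = ∫ x in B, f x ∂lam := fun B => 
    (Measure.setIntegral_toReal_rnDeriv hν B).symm
  obtain ⟨φ, hφs, hφf, hφ, hφi⟩ := hfi.exists_hasCompactSupport_integral_sub_le (by positivity : 0 < ε / 3)
  have hL := (L1_cont lam φ hφ hφs).eventually (gt_mem_nhds (by positivity : 0 < ε/3))
  filter_upwards [hL] with v hv B hB
  have e1 : ν.real ((fun y => v * y) ⁻¹' B) = ∫ x in B, f (v⁻¹ * x) ∂lam := by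
    rw [hfν, ← integral_indicator (measurable_const_mul v hB), ← integral_indicator hB,
      ← integral_mul_left_eq_self _ v⁻¹]
    congr 1; funext x
    by_cases hx : x ∈ B <;> simp [Set.indicator, hx]
  have hfvi : Integrable (fun x => f (v⁻¹ * x)) lam := hfi.comp_mul_left v⁻¹
  have hφvi : Integrable (fun x => φ (v⁻¹ * x)) lam := hφi.comp_mul_left v⁻¹
  rw [e1, hfν B, ← integral_sub hfvi.integrableOn hfi.integrableOn]
  refine (abs_integral_le_integral_abs).trans ?_
  have i1 : Integrable (fun x => |f (v⁻¹ * x) - φ (v⁻¹ * x)|) lam := (hfvi.sub hφvi).abs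
  have i2 : Integrable (fun x => |φ x - φ (v⁻¹ * x)|) lam := (hφi.sub hφvi).abs
  have i3 : Integrable (fun x => |f x - φ x|) lam := (hfi.sub hφi).abs
  have e2 : ∫ x, |f (v⁻¹ * x) - φ (v⁻¹ * x)| ∂lam = ∫ x, |f x - φ x| ∂lam :=
    integral_mul_left_eq_self (fun x => |f x - φ x|) v⁻¹
  calc ∫ x in B, |f (v⁻¹ * x) - f x| ∂lam ≤ ∫ x, |f (v⁻¹ * x) - f x| ∂lam :=
        setIntegral_le_integral (hfvi.sub hfi).abs (Eventually.of_forall fun x => abs_nonneg _)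
    _ ≤ ∫ x, (|f (v⁻¹ * x) - φ (v⁻¹ * x)| + |φ x - φ (v⁻¹ * x)| + |f x - φ x|) ∂lam := by
        refine integral_mono (hfvi.sub hfi).abs ((i1.add i2).add i3) fun x => ?_
        have : f (v⁻¹ * x) - f x = (f (v⁻¹ * x) - φ (v⁻¹ * x)) + -(φ x - φ (v⁻¹ * x)) + -(f x - φ x) := by ring
        simp only
        rw [this]
        refine (abs_add_three _ _ _).trans ?_
        rw [abs_neg, abs_neg]
    _ = ∫ x, |f (v⁻¹ * x) - φ (v⁻¹ * x)| ∂lam + ∫ x, |φ x - φ (v⁻¹ * x)| ∂lam + ∫ x, |f x - φ x| ∂lam := by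
        rw [integral_add (f := fun x => |f (v⁻¹ * x) - φ (v⁻¹ * x)| + |φ x - φ (v⁻¹ * x)|) (i1.add i2) i3, integral_add i1 i2]
    _ ≤ ε / 3 + ε / 3 + ε / 3 := by
        rw [e2]
        simp only [Real.norm_eq_abs] at hφf
        linarith
    _ = ε := by ring

theorem inv_left_of_mod (s : H) (hs : Measure.modularCharacterFun s = 1) (B : Set H) (hB : MeasurableSet B) :
    (Measure.haar : Measure H).inv ((fun x => s * x) ⁻¹' B) = (Measure.haar : Measure H).inv B := by
  have h1 : Measure.modularCharacterFun s⁻¹ = 1 := by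
    have := Measure.modularCharacterFun_map_mul s⁻¹ s
    rw [inv_mul_cancel, Measure.modularCharacterFun_map_one, hs, mul_one] at this
    exact this.symm
  have := mod_spec (Measure.haar : Measure H) s⁻¹ (B⁻¹) hB.inv
  rw [h1] at this
  rw [Measure.inv_apply, Measure.inv_apply, ← one_mul (Measure.haar B⁻¹)]
  simp only [ENNReal.coe_one] at this
  rw [← this]
  congr 1
  ext x; simp

variable [TopologicalSpace X] [MeasurableSpace X] [SecondCountableTopology X]
    [BorelSpace X] [MulAction H X] [ContinuousSMul H X] [T2Space X] [LocallyCompactSpace X]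

theorem Lst_measure (μ : Measure X) (l : H) (hl : l ∈ Lst H μ) (A : Set X) : μ ((fun x => l • x) ⁻¹' A) = μ A := by
  have : (fun x : X => l • x) = (Homeomorph.smul l).toMeasurableEquiv := rfl
  have h2 := (mem_Lst μ l).1 hl
  rw [this] at h2 ⊢
  exact h2.measure_preimage_equiv A

section
variable (μ : Measure X) [IsProbabilityMeasure μ] (x1 : X) (hx1 : μ (Set.range fun h : H => h • x1)ᶜ = 0)
  (ς : X → H) (hςm : Measurable ς) (hς : ∀ h : H, ς (h • x1) • x1 = h • x1)
  [Countable (MulAction.stabilizer H x1)]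
include hςm hς

theorem TVX (hx1 : μ (Set.range fun h : H => h • x1)ᶜ = 0) (lam : Measure H) [lam.IsHaarMeasure] (hν : μ.map ς ≪ lam) (ε : ℝ) (hε : 0 < ε) :
    ∀ᶠ v in 𝓝 (1:H), ∀ A, MeasurableSet A → |μ.real ((fun y => v • y) ⁻¹' A) - μ.real A| ≤ ε := by
  haveI : IsFiniteMeasure (μ.map ς) := Measure.isFiniteMeasure_map μ _
  filter_upwards [TVcont lam (μ.map ς) hν ε hε] with v hv A hA
  have hpm := (pi_cont (H := H) x1).measurable
  have key : ∀ A, MeasurableSet A → (μ.map ς).real ((fun h : H => h • x1) ⁻¹' A) = μ.real A := by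
    intro A hA
    rw [map_measureReal_apply hςm (hpm hA)]
    refine measureReal_congr ?_
    have : ∀ᵐ x ∂μ, x ∈ Set.range fun h : H => h • x1 := hx1
    filter_upwards [this] with x hx
    obtain ⟨h, rfl⟩ := hx
    refine propext ?_
    change ς (h • x1) • x1 ∈ A ↔ _
    rw [hς]; rfl
  have h1 := hv _ (hpm hA)
  rw [key A hA] at h1
  have h2 := key _ ((meas_smul v) hA)
  rw [← h2]
  convert h1 using 4
  ext h; simp [mul_smul]

theorem sec_null (ρ : Measure H) [ρ.IsMulRightInvariant] (B : Set H) (hB : ρ B = 0) (h : H) :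
    ρ {q | ς (q • h • x1) ∈ B} = 0 := by
  have : {q : H | ς (q • h • x1) ∈ B} ⊆ ⋃ σ : MulAction.stabilizer H x1, (fun q => q * (h * σ)) ⁻¹' B := by
    intro q hq
    have e := hς (q * h)
    rw [mul_smul] at e
    refine Set.mem_iUnion.2 ⟨⟨(q * h)⁻¹ * ς (q • h • x1), ?_⟩, ?_⟩
    · rw [MulAction.mem_stabilizer_iff, mul_smul, e, ← mul_smul, ← mul_smul]; simp
    · simp only [Set.mem_preimage]
      have : q * (h * ((q * h)⁻¹ * ς (q • h • x1))) = ς (q • h • x1) := by group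
      rw [this]; exact hq
  refine measure_mono_null this (measure_iUnion_null fun σ => ?_)
  rw [measure_preimage_mul_right, hB]

theorem sec_count (ρ : Measure H) [ρ.IsMulRightInvariant] (B : Set H) (hB : MeasurableSet B) :
    ρ {h | ς (h • x1) = h ∧ h • x1 ∈ (fun h : H => h • x1) '' B} ≤ ρ B := by
  set F : Set H := {h | ς (h • x1) = h} with hF
  have hFm : MeasurableSet F := measurableSet_eq_fun (hςm.comp (pi_cont x1).measurable) measurable_id
  have h1 : {h : H | ς (h • x1) = h ∧ h • x1 ∈ (fun h : H => h • x1) '' B} ⊆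
      ⋃ σ : MulAction.stabilizer H x1, (F ∩ (fun q => q * (σ:H)) ⁻¹' B) := by
    rintro h ⟨h1, b, hb, hb2⟩
    refine Set.mem_iUnion.2 ⟨⟨h⁻¹ * b, ?_⟩, h1, ?_⟩
    · simp only at hb2
      rw [MulAction.mem_stabilizer_iff, mul_smul, hb2, inv_smul_smul]
    · simpa using hb
  refine (measure_mono h1).trans ((measure_iUnion_le _).trans ?_)
  have h2 : ∀ σ : MulAction.stabilizer H x1, ρ (F ∩ (fun q => q * (σ:H)) ⁻¹' B) =
      ρ ((fun q => q * (σ:H)⁻¹) ⁻¹' F ∩ B) := by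
    intro σ
    rw [← measure_preimage_mul_right ρ (σ:H) ((fun q => q * (σ:H)⁻¹) ⁻¹' F ∩ B)]
    congr 1; ext q; simp
  rw [tsum_congr h2, ← measure_iUnion]
  · exact measure_mono (Set.iUnion_subset fun σ => Set.inter_subset_right)
  · intro σ τ hst
    refine Set.disjoint_left.2 ?_
    rintro q ⟨h3, _⟩ ⟨h4, _⟩
    apply hst
    simp only [hF, Set.mem_preimage, Set.mem_setOf_eq] at h3 h4
    have e1 : ∀ τ : MulAction.stabilizer H x1, (q * (τ:H)⁻¹) • x1 = q • x1 := fun τ => by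
      rw [mul_smul, MulAction.mem_stabilizer_iff.1 (inv_mem τ.2)]
    rw [e1] at h3 h4
    have := h3.symm.trans h4
    exact Subtype.ext (inv_injective (mul_left_cancel this))
  · intro σ; exact (measurable_mul_const _ hFm).inter hB

end
end P18

noncomputable section P19
variable {H X : Type*} [Group H] [TopologicalSpace H] [IsTopologicalGroup H] [LocallyCompactSpace H]
  [SecondCountableTopology H] [T2Space H] [MeasurableSpace H] [BorelSpace H]
variable [TopologicalSpace X] [MeasurableSpace X] [SecondCountableTopology X]
    [BorelSpace X] [MulAction H X] [ContinuousSMul H X] [T2Space X] [LocallyCompactSpace X]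

section
variable (μ : Measure X) [IsProbabilityMeasure μ] (x1 : X)
  (ς : X → H) (hςm : Measurable ς) (hς : ∀ h : H, ς (h • x1) • x1 = h • x1)
  [Countable (MulAction.stabilizer H x1)]
include hςm hς

theorem eta_ac (hx1 : μ (Set.range fun h : H => h • x1)ᶜ = 0) (ρ : Measure H) [ρ.IsMulRightInvariant] [SFinite ρ]
    (S : Set H) : ((ρ.restrict S).prod μ).map (fun p => ς (p.1 • p.2)) ≪ ρ := by
  have hm : Measurable (fun p : H × X => ς (p.1 • p.2)) :=
    hςm.comp (continuous_smul (M := H) (X := X)).measurable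
  refine Measure.AbsolutelyContinuous.mk fun B hB h0 => ?_
  rw [Measure.map_apply hm hB, Measure.prod_apply_symm (hm hB)]
  refine lintegral_eq_zero_of_ae_eq_zero ?_
  have : ∀ᵐ x ∂μ, x ∈ Set.range fun h : H => h • x1 := hx1
  filter_upwards [this] with x hx
  obtain ⟨h, rfl⟩ := hx
  refine le_antisymm ((Measure.restrict_apply_le _ _).trans ?_) (zero_le)
  exact (sec_null x1 ς hςm hς ρ B h0 h).le

theorem A8_null (hx1 : μ (Set.range fun h : H => h • x1)ᶜ = 0) (s : H) (hsL : s ∈ Lst H μ)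
    (hs : Measure.modularCharacterFun s = 1) (S : Set H) (hS : S ∈ 𝓝 1) (hSc : IsCompact S)
    (hcontr : ∀ N ∈ 𝓝 (1 : H), ∃ t : ℕ, ∀ q ∈ S, ∃ w, w⁻¹ * q ∈ Lst H μ ∧ s^t * w * (s^t)⁻¹ ∈ N)
    (C : Set H) (hC : IsCompact C) (hC0 : (Measure.haar : Measure H).inv C = 0) :
    μ ((fun h : H => h • x1) '' C) = 0 := by
  haveI := sigmaCompactSpace_of_locallyCompact_secondCountable (X := H)
  set ρ : Measure H := (Measure.haar : Measure H).inv with hρ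
  haveI : ρ.IsMulRightInvariant := by rw [hρ]; infer_instance
  haveI : ρ.Regular := by rw [hρ]; infer_instance
  haveI : ρ.IsOpenPosMeasure := by rw [hρ]; infer_instance
  have hSpos : 0 < ρ S := Measure.measure_pos_of_mem_nhds ρ hS
  have hSfin : ρ S < ∞ := hSc.measure_lt_top
  haveI : IsFiniteMeasure (ρ.restrict S) := ⟨by rw [Measure.restrict_apply_univ]; exact hSfin⟩
  have hm : Measurable (fun p : H × X => ς (p.1 • p.2)) :=
    hςm.comp (continuous_smul (M := H) (X := X)).measurable
  set κ : Measure H := ((ρ.restrict S).prod μ).map (fun p => ς (p.1 • p.2)) with hκ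
  haveI : IsFiniteMeasure κ := Measure.isFiniteMeasure_map _ _
  have hac : κ ≪ ρ := eta_ac μ x1 ς hςm hς hx1 ρ S
  have hst : ∀ t : ℕ, Measure.modularCharacterFun (s^t) = 1 := fun t => by
    induction t with
    | zero => rw [pow_zero, Measure.modularCharacterFun_map_one]
    | succ t ih => rw [pow_succ, Measure.modularCharacterFun_map_mul, ih, hs, mul_one]
  have hae : ∀ᵐ x ∂μ, x ∈ Set.range fun h : H => h • x1 := hx1
  by_contra hne
  set ε : ℝ≥0∞ := ρ S * μ ((fun h : H => h • x1) '' C) with hε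
  have hε0 : ε ≠ 0 := mul_ne_zero hSpos.ne' hne
  have hκfin : ∫⁻ x, κ.rnDeriv ρ x ∂ρ ≠ ∞ := (Measure.lintegral_rnDeriv_lt_top κ ρ).ne
  obtain ⟨δ, hδ, hδ2⟩ := exists_pos_setLIntegral_lt_of_measure_lt hκfin hε0
  obtain ⟨O, hCO, hO, hOδ⟩ := C.exists_isOpen_lt_of_lt (μ := ρ) δ (by rw [hC0]; exact hδ)
  obtain ⟨N, hN, hNC⟩ := compact_open_separated_mul_left hC hO hCO
  obtain ⟨t, ht⟩ := hcontr N hN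
  set B : Set H := (fun x => s^t * x) ⁻¹' O with hB
  have hBm : MeasurableSet B := measurable_const_mul _ hO.measurableSet
  have hBρ : ρ B = ρ O := inv_left_of_mod (s^t) (hst t) O hO.measurableSet
  set D : Set H := {h | ς (h • x1) = h ∧ h • x1 ∈ (fun h : H => h • x1) '' B} with hD
  have hDρ : ρ D ≤ ρ B := sec_count x1 ς hςm hς ρ B hBm
  set D' := toMeasurable ρ D with hD'
  have hD'm : MeasurableSet D' := measurableSet_toMeasurable _ _
  have h1 : κ D' < ε := by
    rw [← Measure.setLIntegral_rnDeriv hac]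
    refine hδ2 _ ?_
    rw [hD', measure_toMeasurable]
    exact hDρ.trans_lt (hBρ ▸ hOδ)
  refine absurd h1 (not_lt.2 ?_)
  rw [hκ, Measure.map_apply hm hD'm, Measure.prod_apply (hm hD'm)]
  calc ε = ∫⁻ q in S, μ ((fun h : H => h • x1) '' C) ∂ρ := by
        rw [lintegral_const, Measure.restrict_apply_univ, mul_comm]
    _ ≤ _ := by
        refine setLIntegral_mono_ae' hSc.measurableSet (Eventually.of_forall fun q hq => ?_)
        obtain ⟨w, hw1, hw2⟩ := ht q hq
        set A : Set X := (fun h : H => h • x1) '' B with hA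
        have g1 : μ ((fun h : H => h • x1) '' C) ≤ μ ((fun x : X => q • x) ⁻¹' A) := by
          have e1 : (fun x : X => q • x) ⁻¹' A = (fun x : X => (w⁻¹ * q) • x) ⁻¹' ((fun x : X => w • x) ⁻¹' A) := by
            ext x; simp [mul_smul]
          rw [e1, Lst_measure μ _ hw1, ← Lst_measure μ _ (inv_mem (pow_mem hsL t)) ((fun x : X => w • x) ⁻¹' A)]
          refine measure_mono ?_
          rintro _ ⟨c, hc, rfl⟩
          refine ⟨w * (s^t)⁻¹ * c, ?_, by simp [mul_smul]⟩
          have : s ^ t * (w * (s^t)⁻¹ * c) = (s^t * w * (s^t)⁻¹) * c := by group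
          simp only [hB, Set.mem_preimage]
          rw [this]
          exact hNC ⟨_, hw2, c, hc, rfl⟩
        refine g1.trans (measure_mono_ae ?_)
        filter_upwards [hae] with x hx hxA
        obtain ⟨h, rfl⟩ := hx
        refine subset_toMeasurable ρ D ?_
        change ς (ς (q • h • x1) • x1) = ς (q • h • x1) ∧ ς (q • h • x1) • x1 ∈ A
        have e : ς (q • h • x1) • x1 = q • h • x1 := by have := hς (q * h); rwa [mul_smul] at this
        rw [e]
        exact ⟨rfl, hxA⟩

theorem A8_gen (hx1 : μ (Set.range fun h : H => h • x1)ᶜ = 0) (s : H) (hsL : s ∈ Lst H μ)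
    (hs : Measure.modularCharacterFun s = 1) (S : Set H) (hS : S ∈ 𝓝 1) (hSc : IsCompact S)
    (hcontr : ∀ N ∈ 𝓝 (1 : H), ∃ t : ℕ, ∀ q ∈ S, ∃ w, w⁻¹ * q ∈ Lst H μ ∧ s^t * w * (s^t)⁻¹ ∈ N)
    (w : H) (hw : Tendsto (fun t : ℕ => s^t * w * (s^t)⁻¹) atTop (𝓝 1)) : w ∈ Lst H μ := by
  haveI := sigmaCompactSpace_of_locallyCompact_secondCountable (X := H)
  set lam : Measure H := Measure.haar with hlam
  have hν : μ.map ς ≪ lam := by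
    haveI : IsFiniteMeasure (μ.map ς) := Measure.isFiniteMeasure_map μ _
    refine Measure.AbsolutelyContinuous.mk fun B hB h0 => ?_
    by_contra hne
    letI := TopologicalSpace.metrizableSpaceMetric H
    obtain ⟨C, hCB, hCc, hC⟩ := hB.exists_lt_isCompact (μ := μ.map ς) (pos_iff_ne_zero.2 hne)
    have hC0 : lam.inv C = 0 := measure_mono_null hCB (inv_absolutelyContinuous lam h0)
    have := A8_null μ x1 ς hςm hς hx1 s hsL hs S hS hSc hcontr C hCc hC0
    rw [Measure.map_apply hςm hCc.measurableSet] at hC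
    refine absurd hC (not_lt.2 ?_)
    rw [← this]
    refine measure_mono_ae ?_
    have hae : ∀ᵐ x ∂μ, x ∈ Set.range fun h : H => h • x1 := hx1
    filter_upwards [hae] with x hx hxC
    obtain ⟨h, rfl⟩ := hx
    exact ⟨ς (h • x1), hxC, hς h⟩
  rw [mem_Lst]
  refine ⟨meas_smul w, ?_⟩
  ext A hA
  rw [Measure.map_apply (meas_smul w) hA]
  have key : ∀ ε > 0, |μ.real ((fun y => w • y) ⁻¹' A) - μ.real A| ≤ ε := by
    intro ε hε
    obtain ⟨t, ht⟩ := (hw.eventually (TVX μ x1 ς hςm hς hx1 lam hν ε hε)).exists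
    have h1 := ht ((fun x : X => (s^t)⁻¹ • x) ⁻¹' A) (meas_smul _ hA)
    have hst := pow_mem hsL t
    have e1 : μ.real ((fun x : X => (s^t)⁻¹ • x) ⁻¹' A) = μ.real A := by
      rw [Measure.real, Lst_measure μ _ (inv_mem hst)]; rfl
    have e2 : (fun y : X => (s ^ t * w * (s ^ t)⁻¹) • y) ⁻¹' ((fun x : X => (s^t)⁻¹ • x) ⁻¹' A) =
        (fun x : X => (s^t)⁻¹ • x) ⁻¹' ((fun y => w • y) ⁻¹' A) := by
      ext y; simp [mul_smul]
    rw [e2, e1] at h1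
    rwa [Measure.real, Lst_measure μ _ (inv_mem hst)] at h1
  have h0 : μ.real ((fun y => w • y) ⁻¹' A) - μ.real A = 0 := by
    rw [← abs_nonpos_iff]
    exact le_of_forall_pos_le_add fun ε hε => by simpa using key ε hε
  have h1 := sub_eq_zero.1 h0
  exact (ENNReal.toReal_eq_toReal_iff' (measure_ne_top _ _) (measure_ne_top _ _)).1 h1

end
end P19

noncomputable section P20
variable {n : ℕ}

theorem weyl (p q : Fin n) (hpq : p < q) (α : Fin n → ℝ) (a : SL(n, ℝ))
    (ha : (a : Matrix (Fin n) (Fin n) ℝ) = Matrix.diagonal α) (h1 : α p * α q = 1) (h2 : ∀ i, i ≠ p → i ≠ q → α i = 1) :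
    a * (TV hpq.ne 1 * (TV hpq.ne' (-1) * TV hpq.ne 1)) * a = TV hpq.ne 1 * (TV hpq.ne' (-1) * TV hpq.ne 1) := by
  apply Matrix.SpecialLinearGroup.ext
  intro i j
  rw [Matrix.SpecialLinearGroup.coe_mul, Matrix.SpecialLinearGroup.coe_mul a, ha, mul_diagonal, diagonal_mul]
  simp only [TV_mul, TV_apply]
  have hqp := hpq.ne'
  have hpq' := hpq.ne
  have h1' : α q * α p = 1 := by rw [mul_comm]; exact h1
  by_cases hi : i = p
  · subst hi
    by_cases hj : j = q
    · subst hj; simp [hpq', hqp, h1]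
    · by_cases hj' : i = j <;> simp [hpq', hqp, hj, Matrix.one_apply, Ne.symm hj, hj']
  · by_cases hi' : i = q
    · subst hi'
      by_cases hj : j = p
      · subst hj; simp [hpq', hqp, h1']
      · by_cases hj' : j = i
        · subst hj'; simp [hqp, hpq']
        · simp [hqp, hj, Matrix.one_apply, Ne.symm hj, hj', Ne.symm hj']
    · by_cases hij : i = j
      · subst hij; simp [hi, hi', h2 i hi hi']
      · simp [hi, hi', hij]

theorem mod_AA (L : Subgroup (SL(n, ℝ))) [LocallyCompactSpace (QQ L)] (c : ℕ → ℝ) (hc : ∀ j, j ∉ II L → c j = 0)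
    (hcL : AA n c ∈ QQ L) : Measure.modularCharacterFun (⟨AA n c, hcL⟩ : QQ L) = 1 := by
  set L' : Subgroup (SL(n, ℝ)) := (Measure.modularCharacter (G := QQ L)).ker.map (QQ L).subtype with hL'
  have hII : ∀ k, k ∈ II L → k ∈ II L' := by
    rintro k ⟨hk0, hkn, hk⟩
    refine ⟨hk0, hkn, fun t => ?_⟩
    set p : Fin n := ⟨k - 1, by omega⟩ with hp
    set q : Fin n := ⟨k, hkn⟩ with hq
    have hpq : p < q := Fin.lt_def.2 (by simp [hp, hq]; omega)
    have haQ : AA n (Pi.single k t) ∈ QQ L := AA_QQ L _ (hk t)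
    have hT1 : TV hpq.ne 1 ∈ QQ L := UU_QQ L (TV_UU hpq 1)
    have hT2 : TV hpq.ne' (-1) ∈ QQ L := by
      have hne : ∀ i j : Fin n, i ≠ j → ¬ (i = q ∧ j = p) → TV hpq.ne' (-1) i j = 0 := fun i j h h' => by
        rw [TV_apply]; simp [h, h']
      refine UI_QQ L _ ⟨?_, ?_, fun i => ?_⟩
      · rw [mem_PI]
        rintro i j ⟨m, hm1, hm2, hm3⟩
        refine hne i j ?_ ?_
        · rintro rfl; omega
        · rintro ⟨rfl, rfl⟩
          simp only [hp, hq] at hm2 hm3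
          have : m = k := by omega
          exact hm1 (this ▸ ⟨hk0, hkn, hk⟩)
      · rw [mem_Bm]; intro i j hij
        refine hne i j hij.ne ?_
        rintro ⟨rfl, rfl⟩; exact lt_asymm hij hpq
      · rw [TV_apply]
        have : ¬ (i = q ∧ i = p) := fun h => hpq.ne (h.2.symm.trans h.1)
        simp [this]
    have hw := weyl p q hpq _ _ (AA_apply (Pi.single k t)) (by
      rw [← Real.exp_add]
      have e1 : hh n (Pi.single k t) p = t := by
        have : k - 1 + 1 = k := by omega
        have h2 : k - 1 ≠ k := by omega
        simp [hh, trc, hp, this, hk0, hkn, h2, Pi.single_apply]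
      have e2 : hh n (Pi.single k t) q = -t := by
        simp [hh, trc, hq, hk0, hkn, Pi.single_apply]
      rw [e1, e2]; simp) (fun i hip hiq => by
      have h1 : (i : ℕ) ≠ k := fun h => hiq (Fin.ext h)
      have h2 : (i : ℕ) + 1 ≠ k := fun h => hip (Fin.ext (by simp [hp]; omega))
      simp [hh, trc, Pi.single_apply, h1, h2])
    set W : QQ L := ⟨_, mul_mem hT1 (mul_mem hT2 hT1)⟩ with hW
    set a : QQ L := ⟨_, haQ⟩ with ha
    have h3 : a * W * a = W := Subtype.ext hw
    refine ⟨a, ?_, rfl⟩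
    change Measure.modularCharacterFun a = 1
    have h4 := congrArg Measure.modularCharacterFun h3
    rw [Measure.modularCharacterFun_map_mul, Measure.modularCharacterFun_map_mul] at h4
    have hWp := (Measure.modularCharacterFun_pos W).ne'
    have h5 : Measure.modularCharacterFun a * Measure.modularCharacterFun a = 1 := by
      apply mul_right_cancel₀ hWp
      rw [one_mul]; rw [← h4]; rw [h4]; nth_rewrite 2 [← h4]; ring
    rw [← sq] at h5
    exact (pow_eq_one_iff.1 h5).resolve_right two_ne_zero
  obtain ⟨y, hy, hy2⟩ := AA_mem L' c fun j _ _ hj => hc j fun h => hj (hII j h)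
  have : y = ⟨AA n c, hcL⟩ := Subtype.ext hy2
  rw [← this]; exact hy

/-- contraction on `UI` -/
theorem UI_contr (I : Set ℕ) (c β : ℕ → ℝ) (hβ : ∀ i, β (i+1) + 1 ≤ β i)
    (h4 : ∀ k l, l ≤ k → ¬ dif I k l → 2 * (β l - β k) ≤ hh n c l - hh n c k)
    (R : ℝ) (t : ℕ) (w : SL(n, ℝ)) (hw : w ∈ UI n I) (hR : ∀ i j, |w i j| ≤ R) (i j : Fin n) :
    |((AA n c)^t * w * ((AA n c)^t)⁻¹) i j - (1 : SL(n, ℝ)) i j| ≤ Real.exp (t * (-1)) * R := by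
  have hR0 : 0 ≤ R := (abs_nonneg _).trans (hR i j)
  have hpos : 0 ≤ Real.exp (t * (-1)) * R := by positivity
  rw [AA, DD_pow, DD_smul_conj]
  rcases lt_trichotomy i j with h | h | h
  · rw [(mem_Bm w).1 hw.2.1 i j h]; simpa [h.ne] using hpos
  · subst h; simpa [hw.2.2 i] using hpos
  · by_cases hd : dif I i j
    · rw [(mem_PI I w).1 hw.1 i j hd]; simpa [h.ne'] using hpos
    · have e1 := h4 i j (Fin.lt_def.1 h).le hd
      have e2 : β i + 1 ≤ β j := by
        have := (beta_lt β hβ).antitone (Nat.succ_le_of_lt (Fin.lt_def.1 h))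
        have h2 := hβ j
        simp only [Nat.succ_eq_add_one] at this
        linarith
      have e3 : hh n c i - hh n c j ≤ -1 := by linarith
      rw [show (1 : SL(n, ℝ)) i j = 0 by simp [h.ne'], sub_zero, abs_mul, abs_of_pos (Real.exp_pos _)]
      gcongr
      exact hR i j

theorem UI_contr_unif (I : Set ℕ) (c β : ℕ → ℝ) (hβ : ∀ i, β (i+1) + 1 ≤ β i)
    (h4 : ∀ k l, l ≤ k → ¬ dif I k l → 2 * (β l - β k) ≤ hh n c l - hh n c k)
    (R : ℝ) (N : Set (SL(n, ℝ))) (hN : N ∈ 𝓝 1) : ∀ᶠ t : ℕ in atTop, ∀ w ∈ UI n I, (∀ i j, |w i j| ≤ R) →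
      (AA n c)^t * w * ((AA n c)^t)⁻¹ ∈ N := by
  obtain ⟨r, hr, hrN⟩ := box_sub N hN
  have h1 := (exp_t_zero (-1) (by norm_num)).mul_const R
  rw [zero_mul] at h1
  filter_upwards [h1.eventually (gt_mem_nhds hr)] with t ht w hw hR
  exact hrN _ fun i j => (UI_contr I c β hβ h4 R t w hw hR i j).trans ht.le

end P20

noncomputable section P21
variable {n : ℕ}
variable {X : Type*} [TopologicalSpace X] [SecondCountableTopology X] [MeasurableSpace X]
    [BorelSpace X] [MulAction (SL(n, ℝ)) X] [ContinuousSMul (SL(n, ℝ)) X] [LocallyCompactSpace X] [T2Space X]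
    (μ : Measure X) [IsProbabilityMeasure μ]

theorem orbit_meas {H X : Type*} [Group H] [TopologicalSpace H] [LocallyCompactSpace H]
    [SecondCountableTopology H] [TopologicalSpace X] [MeasurableSpace X] [BorelSpace X] [T2Space X]
    [MulAction H X] [ContinuousSMul H X] (x : X) : MeasurableSet (Set.range fun h : H => h • x) := by
  haveI := sigmaCompactSpace_of_locallyCompact_secondCountable (X := H)
  have hc : Continuous fun h : H => h • x := continuous_id.smul continuous_const
  rw [← Set.image_univ, ← iUnion_compactCovering, Set.image_iUnion]
  exact MeasurableSet.iUnion fun i => ((isCompact_compactCovering H i).image hc).measurableSet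

theorem sub_orbit {G X : Type*} [Group G] [MulAction G X] (Q : Subgroup G) (x : X) :
    {y | ∃ q ∈ Q, q • x = y} = Set.range fun h : Q => h • x := by
  ext y
  exact ⟨fun ⟨q, hq, h⟩ => ⟨⟨q, hq⟩, h⟩, fun ⟨q, h⟩ => ⟨q, q.2, h⟩⟩

theorem erg_orbit (herg : ∀ A : Set X, MeasurableSet A →
      (∀ v ∈ UU n, (fun x : X => v • x) ⁻¹' A = A) → μ A = 0 ∨ μ A = 1)
    (Q : Subgroup (SL(n, ℝ))) (hQ : IsClosed (Q : Set (SL(n, ℝ)))) (hUQ : UU n ≤ Q) (x : X)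
    (hpos : μ {y | ∃ q ∈ Q, q • x = y} ≠ 0) : μ {y | ∃ q ∈ Q, q • x = y} = 1 := by
  haveI : LocallyCompactSpace Q := hQ.isClosedEmbedding_subtypeVal.locallyCompactSpace
  haveI : SecondCountableTopology Q := TopologicalSpace.Subtype.secondCountableTopology (Q : Set (SL(n, ℝ)))
  refine (herg _ ?_ ?_).resolve_left hpos
  · rw [sub_orbit]; exact orbit_meas x
  · intro v hv
    ext y
    constructor
    · rintro ⟨q, hq, h⟩
      refine ⟨v⁻¹ * q, mul_mem (inv_mem (hUQ hv)) hq, ?_⟩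
      rw [mul_smul, h]; simp
    · rintro ⟨q, hq, h⟩
      exact ⟨v * q, mul_mem (hUQ hv) hq, by rw [mul_smul, h]⟩

theorem A7 (hμ : UU n ≤ Lst (SL(n, ℝ)) μ)
    (herg : ∀ A : Set X, MeasurableSet A →
      (∀ v ∈ UU n, (fun x : X => v • x) ⁻¹' A = A) → μ A = 0 ∨ μ A = 1)
    (hopen : ∀ x : X, ∀ V ∈ 𝓝 (1: SL(n, ℝ)), (fun g : SL(n, ℝ) => g • x) '' V ∈ 𝓝 x)
    (c β : ℕ → ℝ) (hc : ∀ j, j ∉ II (Lst (SL(n, ℝ)) μ) → c j = 0) (hβ : ∀ i, β (i+1) + 1 ≤ β i)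
    (h3 : ∀ k l, k < n → l < n → dif (II (Lst (SL(n, ℝ)) μ)) k l → 1 + |hh n c l - hh n c k| ≤ β l - β k)
    (h4 : ∀ k l, l ≤ k → ¬ dif (II (Lst (SL(n, ℝ)) μ)) k l → 2 * (β l - β k) ≤ hh n c l - hh n c k) :
    ∃ x1 : X, μ {y | ∃ q ∈ QQ (Lst (SL(n, ℝ)) μ), q • x1 = y} = 1 := by
  set L := Lst (SL(n, ℝ)) μ with hL
  obtain ⟨O, up, hO, h1O, hupc, hLU⟩ := LU_near (n := n)
  obtain ⟨Ω, hΩm, hΩε, hΩ⟩ := exists_Om μ hμ herg O up hO hLU β hβ (ENNReal.ofReal (1/160)) (by simp)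
  have hs : AA n c ∈ L := AA_mem L c fun j _ _ hj => hc j hj
  obtain ⟨Ω1, hΩ1m, hΩ1, hg⟩ := garsia μ (fun x => AA n c • x) hs Ω hΩm (1/16) (by norm_num)
  have hΩ1' : μ Ω1ᶜ ≤ 1/10 := by
    have e1 : μ.real Ωᶜ ≤ 1/160 := ENNReal.toReal_le_of_le_ofReal (by norm_num) hΩε
    have e2 : μ.real Ω1ᶜ ≤ 1/10 := by linarith
    have : μ Ω1ᶜ ≤ ENNReal.ofReal (1/10) := by
      rw [← ENNReal.ofReal_toReal (measure_ne_top μ Ω1ᶜ)]; exact ENNReal.ofReal_le_ofReal e2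
    refine this.trans (le_of_eq ?_)
    rw [ENNReal.ofReal_div_of_pos (by norm_num)]; simp
  obtain ⟨Oa, hOa, ha⟩ := A6_1 L O (hO.mem_nhds h1O) c β hβ h3 h4 Ω Ω1 hΩ hg hO
  obtain ⟨Ob, hOb, hb⟩ := A6_2 L O (hO.mem_nhds h1O) c β hβ h3 h4 Ω Ω1 hΩ hg
  have hup1 : up 1 = 1 := by
    have h := hLU 1 h1O
    exact (LU_unique (1 * (up 1)⁻¹) 1 (up 1) 1 h.2.1 (one_mem _) h.1 (one_mem _) (by group)).2
  set lo : SL(n, ℝ) → SL(n, ℝ) := fun h => h * (up h)⁻¹ with hlo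
  have hloc : ContinuousAt lo 1 :=
    continuousAt_id.mul (hupc.continuousAt (hO.mem_nhds h1O)).inv
  have hlo1 : lo 1 = 1 := by simp [hlo, hup1]
  have hpair : ∀ᶠ p : SL(n, ℝ) × SL(n, ℝ) in 𝓝 1 ×ˢ 𝓝 1, (lo p.1)⁻¹ * lo p.2 ∈ Oa ∩ Ob := by
    have t1 : Tendsto lo (𝓝 1) (𝓝 1) := by have := hloc.tendsto; rwa [hlo1] at this
    have t2 : Tendsto (fun p : SL(n, ℝ) × SL(n, ℝ) => (lo p.1)⁻¹ * lo p.2) (𝓝 1 ×ˢ 𝓝 1) (𝓝 (1⁻¹ * 1)) :=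
      (t1.comp tendsto_fst).inv.mul (t1.comp tendsto_snd)
    rw [inv_one, one_mul] at t2
    exact t2 (inter_mem hOa hOb)
  obtain ⟨S, hS, hSp⟩ := (eventually_prod_self_iff (r := fun a b => (lo a)⁻¹ * lo b ∈ Oa ∩ Ob)).1 hpair
  obtain ⟨K0, hK0, hK1⟩ := exists_compact_mem_nhds (1 : SL(n, ℝ))
  set O1 := O ∩ interior S ∩ interior K0 with hO1
  have hO1o : IsOpen O1 := (hO.inter isOpen_interior).inter isOpen_interior
  have h1 : (1 : SL(n, ℝ)) ∈ O1 := ⟨⟨h1O, mem_interior_iff_mem_nhds.2 hS⟩, mem_interior_iff_mem_nhds.2 hK1⟩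
  obtain ⟨x1, hx1⟩ := A7_gen (QQ L) μ Ω1 hΩ1m hΩ1' hopen O1 hO1o h1 K0 hK0
    (fun x hx => interior_subset hx.2) up (hupc.mono fun x hx => hx.1.1)
    (fun h hh => UU_QQ L (hLU h hh.1.1).1) (fun h hh => hμ (hLU h hh.1.1).1) (by
    intro x h h' hh hh' hx hy
    have hm : (lo h)⁻¹ * lo h' ∈ Oa ∩ Ob := hSp _ (interior_subset hh.1.2) _ (interior_subset hh'.1.2)
    have hB : (lo h)⁻¹ * lo h' ∈ Bm n := mul_mem (inv_mem (hLU h hh.1.1).2.1) (hLU h' hh'.1.1).2.1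
    have hP := ha _ _ hx hy hB hm.1
    rw [mem_QQ_iff L _ ((mem_PI _ _).2 hP)]
    exact hb _ _ hx hy hB hm.2 hP)
  exact ⟨x1, erg_orbit μ herg (QQ L) (QQ_closed L (Lst_closed μ)) (UU_QQ L) x1 hx1.ne'⟩

end P21

noncomputable section P22
variable {n : ℕ}
variable {X : Type*} [TopologicalSpace X] [SecondCountableTopology X] [MeasurableSpace X]
    [BorelSpace X] [MulAction (SL(n, ℝ)) X] [ContinuousSMul (SL(n, ℝ)) X] [LocallyCompactSpace X] [T2Space X]
    (μ : Measure X) [IsProbabilityMeasure μ]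

theorem A8 (hμ : UU n ≤ Lst (SL(n, ℝ)) μ)
    (herg : ∀ A : Set X, MeasurableSet A →
      (∀ v ∈ UU n, (fun x : X => v • x) ⁻¹' A = A) → μ A = 0 ∨ μ A = 1)
    (hdisc : ∀ x : X, ∃ V ∈ 𝓝 (1: SL(n, ℝ)), Set.InjOn (fun g : SL(n, ℝ) => g • x) V)
    (hopen : ∀ x : X, ∀ V ∈ 𝓝 (1: SL(n, ℝ)), (fun g : SL(n, ℝ) => g • x) '' V ∈ 𝓝 x) :
    ∃ x0 : X, μ {y | ∃ q ∈ Lst (SL(n, ℝ)) μ, q • x0 = y} = 1 := by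
  set L := Lst (SL(n, ℝ)) μ with hL
  obtain ⟨c, β, hc, hβ, h3, h4⟩ := exists_params n (II L) fun k hk => ⟨hk.1, hk.2.1⟩
  obtain ⟨x1, hx1⟩ := A7 μ hμ herg hopen c β hc hβ h3 h4
  have hQ : IsClosed (QQ L : Set (SL(n, ℝ))) := QQ_closed L (Lst_closed μ)
  haveI : LocallyCompactSpace (QQ L) := hQ.isClosedEmbedding_subtypeVal.locallyCompactSpace
  haveI : SecondCountableTopology (QQ L) := TopologicalSpace.Subtype.secondCountableTopology (QQ L : Set (SL(n, ℝ)))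
  rw [sub_orbit] at hx1
  obtain ⟨V, hV, hVi⟩ := hdisc x1
  have hV' : (Subtype.val : QQ L → SL(n, ℝ)) ⁻¹' V ∈ 𝓝 (1 : QQ L) :=
    continuous_subtype_val.continuousAt.preimage_mem_nhds hV
  have hVi' : Set.InjOn (fun h : QQ L => h • x1) ((Subtype.val : QQ L → SL(n, ℝ)) ⁻¹' V) :=
    fun a ha b hb hab => Subtype.ext (hVi ha hb hab)
  haveI := stab_countable x1 _ hV' hVi'
  obtain ⟨ς, hςm, hς⟩ := exists_section x1 _ hV' hVi'
  have hx1' : μ (Set.range fun h : QQ L => h • x1)ᶜ = 0 :=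
    (prob_compl_eq_zero_iff (orbit_meas x1)).2 hx1
  have hsL : AA n c ∈ L := AA_mem L c fun j _ _ hj => hc j hj
  have hsQ : AA n c ∈ QQ L := AA_QQ L c hsL
  obtain ⟨O, up, hO, h1O, hupc, hLU⟩ := LU_near (n := n)
  have hfac : ∀ q ∈ QQ L, q ∈ O → ∃ w ∈ UI n (II L), w = q * (up q)⁻¹ * (tau q)⁻¹ ∧ ∃ l ∈ L, l ∈ QQ L ∧ q = w * l := by
    intro q hq hqO
    obtain ⟨a1, a2, a3⟩ := hLU q hqO
    obtain ⟨w, hw, hw2, h⟩ := QQ_fac L hμ q (up q) hq a1 a2 a3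
    rw [tau_mul_UU _ _ (inv_mem a1)] at hw2
    exact ⟨w, hw, hw2, h⟩
  obtain ⟨S, hS1, hSO, hSc⟩ := local_compact_nhds (continuous_subtype_val.continuousAt.preimage_mem_nhds
    (hO.mem_nhds h1O) : (Subtype.val : QQ L → SL(n, ℝ)) ⁻¹' O ∈ 𝓝 (1 : QQ L))
  have hR : ∃ R : ℝ, ∀ q ∈ S, ∀ i j, |((q : SL(n, ℝ)) * (up q)⁻¹ * (tau (q : SL(n, ℝ)))⁻¹) i j| ≤ R := by
    have hcont : ContinuousOn (fun q : SL(n, ℝ) => q * (up q)⁻¹ * (tau q)⁻¹) O :=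
      (continuousOn_id.mul hupc.inv).mul (tau_contOn O up hLU).inv
    have h : ∀ i j, ∃ R : ℝ, ∀ q ∈ S, |((q : SL(n, ℝ)) * (up q)⁻¹ * (tau (q : SL(n, ℝ)))⁻¹) i j| ≤ R := by
      intro i j
      have h2 : ContinuousOn (fun q : QQ L => ((q : SL(n, ℝ)) * (up q)⁻¹ * (tau (q : SL(n, ℝ)))⁻¹) i j) S :=
        (SL_cont_apply i j).comp_continuousOn (hcont.comp continuous_subtype_val.continuousOn hSO)
      obtain ⟨R, hR⟩ := hSc.exists_bound_of_continuousOn h2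
      exact ⟨R, hR⟩
    choose R hR using h
    refine ⟨∑ i, ∑ j, |R i j|, fun q hq i j => (hR i j q hq).trans ((le_abs_self _).trans ?_)⟩
    refine (Finset.single_le_sum (f := fun j => |R i j|) (fun _ _ => abs_nonneg _) (Finset.mem_univ j)).trans ?_
    exact Finset.single_le_sum (f := fun i => ∑ j, |R i j|) (fun _ _ => Finset.sum_nonneg fun _ _ => abs_nonneg _) (Finset.mem_univ i)
  obtain ⟨R, hR⟩ := hR
  have hnh : ∀ N ∈ 𝓝 (1 : QQ L), ∃ N' ∈ 𝓝 (1 : SL(n, ℝ)), ∀ q : QQ L, (q : SL(n, ℝ)) ∈ N' → q ∈ N := by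
    intro N hN
    obtain ⟨N', hN', h⟩ := mem_nhds_subtype _ _ _ |>.1 hN
    exact ⟨N', hN', fun q hq => h hq⟩
  have hUIL : ∀ w ∈ UI n (II L), w ∈ L := by
    intro w hw
    have := A8_gen μ x1 ς hςm hς hx1' (⟨AA n c, hsQ⟩ : QQ L) hsL (mod_AA L c hc hsQ) S hS1 hSc (by
      intro N hN
      obtain ⟨N', hN', hNN⟩ := hnh N hN
      obtain ⟨t, ht⟩ := (UI_contr_unif (II L) c β hβ h4 R N' hN').exists
      refine ⟨t, fun q hq => ?_⟩
      obtain ⟨w, hw, hw2, l, hl, hlQ, hql⟩ := hfac q q.2 (hSO hq)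
      refine ⟨⟨w, UI_QQ L w hw⟩, ?_, ?_⟩
      · have e : (⟨w, UI_QQ L w hw⟩ : QQ L)⁻¹ * q = ⟨l, hlQ⟩ := by
          rw [inv_mul_eq_iff_eq_mul]; exact Subtype.ext hql
        rw [e]; exact hl
      · exact hNN _ (ht w hw fun i j => by rw [hw2]; exact hR q hq i j)) (⟨w, UI_QQ L w hw⟩ : QQ L) (by
      intro N hN
      obtain ⟨N', hN', hNN⟩ := hnh N hN
      have := UI_contr_unif (II L) c β hβ h4 (∑ i, ∑ j, |w i j|) N' hN'
      rw [mem_map]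
      filter_upwards [this] with t ht
      refine hNN _ (ht w hw fun i j => ?_)
      refine (Finset.single_le_sum (f := fun j => |w i j|) (fun _ _ => abs_nonneg _) (Finset.mem_univ j)).trans ?_
      exact Finset.single_le_sum (f := fun i => ∑ j, |w i j|) (fun _ _ => Finset.sum_nonneg fun _ _ => abs_nonneg _) (Finset.mem_univ i))
    exact this
  have hQO : ∀ q ∈ QQ L, q ∈ O → q ∈ L := fun q hq hqO => by
    obtain ⟨w, hw, _, l, hl, _, hql⟩ := hfac q hq hqO
    rw [hql]; exact mul_mem (hUIL w hw) hl
  obtain ⟨s, hs, hcov⟩ := TopologicalSpace.countable_cover_nhds (α := QQ L)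
    (f := fun q => {q' | ((q' * q⁻¹ : QQ L) : SL(n, ℝ)) ∈ O}) (fun q => by
      have : Continuous fun q' : QQ L => ((q' * q⁻¹ : QQ L) : SL(n, ℝ)) :=
        continuous_subtype_val.comp (continuous_mul_const _)
      refine (hO.preimage this).mem_nhds ?_
      simpa using h1O)
  by_contra hno
  push Not at hno
  have hz : ∀ x : X, μ {y | ∃ q ∈ L, q • x = y} = 0 := fun x => by
    by_contra h
    exact hno x (erg_orbit μ herg L (Lst_closed μ) hμ x h)
  have hsub : (Set.range fun h : QQ L => h • x1) ⊆ ⋃ q ∈ s, {y | ∃ l ∈ L, l • (q • x1) = y} := by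
    rintro _ ⟨q', rfl⟩
    have : q' ∈ ⋃ x ∈ s, {q' : QQ L | ((q' * x⁻¹ : QQ L) : SL(n, ℝ)) ∈ O} := by rw [hcov]; trivial
    simp only [Set.mem_iUnion] at this ⊢
    obtain ⟨q, hq, h⟩ := this
    refine ⟨q, hq, _, hQO _ (q' * q⁻¹ : QQ L).2 h, ?_⟩
    change (q' * q⁻¹ : QQ L) • q • x1 = q' • x1
    rw [← mul_smul, inv_mul_cancel_right]
  have h0 := measure_mono_null hsub ((measure_biUnion_null_iff hs).2 fun q _ => hz _)
  rw [hx1] at h0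
  exact one_ne_zero h0

end P22

noncomputable section P23
variable {H X : Type*} [Group H] [TopologicalSpace H] [IsTopologicalGroup H] [LocallyCompactSpace H]
  [SecondCountableTopology H] [T2Space H] [MeasurableSpace H] [BorelSpace H]
variable [TopologicalSpace X] [MeasurableSpace X] [SecondCountableTopology X]
    [BorelSpace X] [MulAction H X] [ContinuousSMul H X] [T2Space X]

theorem mod_meas (lam : Measure H) [lam.IsHaarMeasure] : Measurable (Measure.modularCharacterFun (G := H)) := by
  obtain ⟨K, hK1, hKV, hKc⟩ := local_compact_nhds (univ_mem : Set.univ ∈ 𝓝 (1 : H))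
  have hK0 : lam K ≠ 0 := (Measure.measure_pos_of_mem_nhds _ hK1).ne'
  have hKt : lam K ≠ ∞ := hKc.measure_lt_top.ne
  have hsp : (Measure.modularCharacterFun (G := H)) = fun g => (lam ((fun h => h * g) ⁻¹' K) / lam K).toNNReal := by
    funext g
    rw [mod_spec lam g K hKc.measurableSet, ENNReal.mul_div_cancel_right hK0 hKt, ENNReal.toNNReal_coe]
  haveI : SigmaCompactSpace H := sigmaCompactSpace_of_locallyCompact_secondCountable
  have hmm : Measurable fun g : H => lam ((fun h => h * g) ⁻¹' K) := by
    have : MeasurableSet {p : H × H | p.2 * p.1 ∈ K} :=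
      (measurable_snd.mul measurable_fst) hKc.measurableSet
    exact measurable_measure_prodMk_left (ν := lam) this
  rw [hsp]
  exact (hmm.div_const _).ennreal_toNNReal

def NN (x0 : X) (ς : X → H) (B : Set H) (x : X) : ℝ≥0∞ :=
  ∑' σ : MulAction.stabilizer H x0, B.indicator 1 (ς x * σ)

theorem NN_orb (x0 : X) (ς : X → H) (hς : ∀ h : H, ς (h • x0) • x0 = h • x0) (B : Set H) (h : H) :
    NN x0 ς B (h • x0) = ∑' σ : MulAction.stabilizer H x0, B.indicator 1 (h * σ) := by
  have h0 : h⁻¹ * ς (h • x0) ∈ MulAction.stabilizer H x0 := by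
    rw [MulAction.mem_stabilizer_iff, mul_smul, hς, inv_smul_smul]
  rw [NN, ← (Equiv.mulLeft (⟨_, h0⟩ : MulAction.stabilizer H x0)).tsum_eq
    (fun σ : MulAction.stabilizer H x0 => B.indicator (1 : H → ℝ≥0∞) (h * σ))]
  refine tsum_congr fun σ => ?_
  simp [mul_assoc]

theorem NN_meas (x0 : X) [Countable (MulAction.stabilizer H x0)] (ς : X → H) (hςm : Measurable ς) (B : Set H)
    (hB : MeasurableSet B) : Measurable (NN x0 ς B) :=
  Measurable.ennreal_tsum fun σ => (measurable_one.indicator hB).comp (hςm.mul_const _)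

theorem NN_inj (x0 : X) (ς : X → H) (hς : ∀ h : H, ς (h • x0) • x0 = h • x0) (B : Set H)
    (hB : Set.InjOn (fun h : H => h • x0) B) (h : H) :
    NN x0 ς B (h • x0) ≤ ((fun h : H => h • x0) '' B).indicator 1 (h • x0) := by
  rw [NN_orb x0 ς hς]
  by_cases hex : ∃ σ : MulAction.stabilizer H x0, h * σ ∈ B
  · obtain ⟨σ, hσ⟩ := hex
    have e : ∀ τ : MulAction.stabilizer H x0, (h * (τ : H)) • x0 = h • x0 := fun τ => by
      rw [mul_smul, τ.2]
    rw [tsum_eq_single σ, Set.indicator_of_mem hσ, Set.indicator_of_mem (show h • x0 ∈ (fun h : H => h • x0) '' B from ⟨_, hσ, e σ⟩)]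
    · exact le_rfl
    intro τ hτ
    refine Set.indicator_of_notMem (fun hτB => hτ ?_) _
    have := hB hτB hσ ((e τ).trans (e σ).symm)
    exact Subtype.ext (mul_left_cancel this)
  · push Not at hex
    have : ∀ σ : MulAction.stabilizer H x0, B.indicator (1 : H → ℝ≥0∞) (h * σ) = 0 := fun σ =>
      Set.indicator_of_notMem (hex σ) _
    simp [this]

def mtt (μ : Measure X) (x0 : X) (ς : X → H) : Measure H :=
  Measure.sum fun σ : MulAction.stabilizer H x0 => μ.map fun x => ς x * σ

theorem mt_apply (μ : Measure X) (x0 : X) [Countable (MulAction.stabilizer H x0)] (ς : X → H) (hςm : Measurable ς)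
    (B : Set H) (hB : MeasurableSet B) : mtt μ x0 ς B = ∫⁻ x, NN x0 ς B x ∂μ := by
  have hm : ∀ σ : MulAction.stabilizer H x0, Measurable fun x => ς x * (σ : H) := fun σ => hςm.mul_const _
  have hmm : ∀ σ : MulAction.stabilizer H x0, Measurable fun x => B.indicator (1:H→ℝ≥0∞) (ς x * (σ : H)) :=
    fun σ => (measurable_one.indicator hB).comp (hm σ)
  simp only [NN]
  rw [mtt, Measure.sum_apply _ hB, lintegral_tsum fun σ => (hmm σ).aemeasurable]
  refine tsum_congr fun σ => ?_
  rw [Measure.map_apply (hm σ) hB, ← lintegral_indicator_one (hm σ hB)]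
  rfl

section
variable (μ : Measure X) [IsProbabilityMeasure μ] (x0 : X)
  (ς : X → H) (hςm : Measurable ς) (hς : ∀ h : H, ς (h • x0) • x0 = h • x0)
  [Countable (MulAction.stabilizer H x0)] (hx0 : μ (Set.range fun h : H => h • x0)ᶜ = 0)
  (hinv : ∀ l : H, MeasurePreserving (fun x : X => l • x) μ μ)
include hςm hς hx0

theorem mt_inj (B : Set H) (hBm : IsCompact B) (hB : Set.InjOn (fun h : H => h • x0) B) :
    mtt μ x0 ς B ≤ μ ((fun h : H => h • x0) '' B) := by
  have hae : ∀ᵐ x ∂μ, x ∈ Set.range fun h : H => h • x0 := hx0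
  rw [mt_apply μ x0 ς hςm B hBm.measurableSet, ← lintegral_indicator_one (hBm.image (pi_cont x0)).measurableSet]
  refine lintegral_mono_ae ?_
  filter_upwards [hae] with x hx
  obtain ⟨h, rfl⟩ := hx
  exact NN_inj x0 ς hς B hB h

theorem mt_right (τ : H) (hτ : τ ∈ MulAction.stabilizer H x0) (B : Set H) (hB : MeasurableSet B) :
    mtt μ x0 ς ((fun h => h * τ) ⁻¹' B) = mtt μ x0 ς B := by
  rw [mt_apply μ x0 ς hςm B hB, mt_apply μ x0 ς hςm _ (measurable_mul_const τ hB)]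
  refine lintegral_congr fun x => ?_
  rw [NN, NN, ← (Equiv.mulRight (⟨τ, hτ⟩ : MulAction.stabilizer H x0)).tsum_eq
    (fun σ : MulAction.stabilizer H x0 => B.indicator (1 : H → ℝ≥0∞) (ς x * σ))]
  refine tsum_congr fun σ => ?_
  have e : ς x * ((Equiv.mulRight (⟨τ, hτ⟩ : MulAction.stabilizer H x0)) σ : H) = ς x * σ * τ :=
    (mul_assoc _ _ _).symm
  rw [e]
  rfl

include hinv

theorem mt_left : (mtt μ x0 ς).IsMulLeftInvariant := by
  refine ⟨fun l => ?_⟩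
  ext B hB
  have hae : ∀ᵐ x ∂μ, x ∈ Set.range fun h : H => h • x0 := hx0
  rw [Measure.map_apply (measurable_const_mul l) hB, mt_apply μ x0 ς hςm B hB,
    mt_apply μ x0 ς hςm _ (measurable_const_mul l hB), ← (hinv l).lintegral_comp (NN_meas x0 ς hςm B hB)]
  refine lintegral_congr_ae ?_
  filter_upwards [hae] with x hx
  obtain ⟨h, rfl⟩ := hx
  simp only
  rw [← mul_smul, NN_orb x0 ς hς, NN_orb x0 ς hς]
  refine tsum_congr fun σ => ?_
  rw [mul_assoc]
  rfl

theorem mt_haar (V : Set H) (hV : V ∈ 𝓝 1) (hVi : Set.InjOn (fun h : H => h • x0) V) :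
    (mtt μ x0 ς).IsHaarMeasure := by
  haveI := mt_left μ x0 ς hςm hς hx0 hinv
  obtain ⟨K, hK1, hKV, hKc⟩ := local_compact_nhds hV
  refine Measure.isHaarMeasure_of_isCompact_nonempty_interior _ K hKc ⟨1, mem_interior_iff_mem_nhds.2 hK1⟩ ?_ ?_
  · intro h0
    obtain ⟨s, hs, hcov⟩ := TopologicalSpace.countable_cover_nhds (α := H) (f := fun q => (fun h => q⁻¹ * h) ⁻¹' K)
      (fun q => (continuous_const_mul q⁻¹).continuousAt.preimage_mem_nhds (by simpa using hK1))
    have hu : mtt μ x0 ς Set.univ = 0 := by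
      rw [← hcov, measure_biUnion_null_iff hs]
      intro q _
      rw [measure_preimage_mul]; exact h0
    rw [mt_apply μ x0 ς hςm _ MeasurableSet.univ] at hu
    have h1 : ∀ x, 1 ≤ NN x0 ς Set.univ x := fun x => by
      rw [NN]
      refine le_trans ?_ (ENNReal.le_tsum (1 : MulAction.stabilizer H x0))
      simp
    have h2 : (1 : ℝ≥0∞) ≤ ∫⁻ x, NN x0 ς Set.univ x ∂μ := by
      calc (1 : ℝ≥0∞) = ∫⁻ _, 1 ∂μ := by simp
        _ ≤ _ := lintegral_mono h1
    rw [hu] at h2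
    exact absurd h2 (by simp)
  · exact ((mt_inj μ x0 ς hςm hς hx0 K hKc (hVi.mono hKV)).trans_lt (measure_lt_top _ _)).ne

theorem mt_unimod (V : Set H) (hV : V ∈ 𝓝 1) (hVi : Set.InjOn (fun h : H => h • x0) V) (l : H) :
    Measure.modularCharacterFun l = 1 := by
  haveI := mt_haar μ x0 ς hςm hς hx0 hinv V hV hVi
  obtain ⟨K, hK1, hKV, hKc⟩ := local_compact_nhds hV
  have hae : ∀ᵐ x ∂μ, x ∈ Set.range fun h : H => h • x0 := hx0
  have hK0 : mtt μ x0 ς K ≠ 0 := (Measure.measure_pos_of_mem_nhds _ hK1).ne'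
  have hKt : mtt μ x0 ς K ≠ ∞ := hKc.measure_lt_top.ne
  have hst : ∀ τ ∈ MulAction.stabilizer H x0, Measure.modularCharacterFun τ = 1 := by
    intro τ hτ
    have h1 := mod_spec (mtt μ x0 ς) τ K hKc.measurableSet
    rw [mt_right μ x0 ς hςm hς hx0 τ hτ K hKc.measurableSet] at h1
    have h2 : (Measure.modularCharacterFun τ : ℝ≥0∞) = 1 := by
      have h3 : (1 : ℝ≥0∞) * mtt μ x0 ς K = Measure.modularCharacterFun τ * mtt μ x0 ς K := by rw [one_mul]; exact h1
      exact ((ENNReal.mul_left_inj hK0 hKt).1 h3).symm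
    exact_mod_cast h2
  set D : X → NNReal := fun x => Measure.modularCharacterFun (ς x) with hD
  have hDm : Measurable D := (mod_meas (mtt μ x0 ς)).comp hςm
  have hDo : ∀ h : H, D (h • x0) = Measure.modularCharacterFun h := fun h => by
    have h0 : h⁻¹ * ς (h • x0) ∈ MulAction.stabilizer H x0 := by
      rw [MulAction.mem_stabilizer_iff, mul_smul, hς, inv_smul_smul]
    have := hst _ h0
    have h2 : ς (h • x0) = h * (h⁻¹ * ς (h • x0)) := by group
    simp only [hD]
    rw [h2, Measure.modularCharacterFun_map_mul, this, mul_one]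
  have key : ∀ l : H, ¬ 1 < Measure.modularCharacterFun l := by
    intro l hl
    have hnull : ∀ R : ℕ, μ {x | D x < R} = 0 := by
      intro R
      have hms : MeasurableSet {x | D x < R} := hDm measurableSet_Iio
      have hcons := (hinv l).conservative.ae_mem_imp_frequently_image_mem hms.nullMeasurableSet
      have : ∀ᵐ x ∂μ, x ∉ {x | D x < R} := by
        filter_upwards [hcons, hae] with x hx hxo hxs
        obtain ⟨h, rfl⟩ := hxo
        have hfr := hx hxs
        have ht : Tendsto (fun k : ℕ => (Measure.modularCharacterFun l)^k * Measure.modularCharacterFun h) atTop atTop :=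
          (tendsto_pow_atTop_atTop_of_one_lt hl).atTop_mul_const (Measure.modularCharacterFun_pos h)
        obtain ⟨k, hk1, hk2⟩ := (hfr.and_eventually (ht.eventually_ge_atTop (R : NNReal))).exists
        have hk3 : D ((l^k * h) • x0) < R := by
          have h5 := hk1
          rw [smul_iterate] at h5
          rw [mul_smul]
          exact h5
        rw [hDo, Measure.modularCharacterFun_map_mul] at hk3
        have : Measure.modularCharacterFun (l^k) = Measure.modularCharacterFun l ^ k :=
          map_pow (Measure.modularCharacter (G := H)) l k
        rw [this] at hk3
        exact absurd hk3 (not_lt.2 hk2)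
      rw [ae_iff] at this
      simpa using this
    have hu : μ Set.univ = 0 := by
      have : (Set.univ : Set X) ⊆ ⋃ R : ℕ, {x | D x < R} := fun x _ => by
        obtain ⟨R, hR⟩ := exists_nat_gt (D x)
        exact Set.mem_iUnion.2 ⟨R, hR⟩
      exact measure_mono_null this (measure_iUnion_null hnull)
    rw [measure_univ] at hu
    exact one_ne_zero hu
  have h1 := not_lt.1 (key l)
  have h2 := not_lt.1 (key l⁻¹)
  have h3 := Measure.modularCharacterFun_map_mul l⁻¹ l
  rw [inv_mul_cancel, Measure.modularCharacterFun_map_one] at h3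
  refine le_antisymm h1 ?_
  calc 1 = _ := h3
    _ ≤ 1 * Measure.modularCharacterFun l := by gcongr
    _ = _ := one_mul _

end

theorem A9 (μ : Measure X) [IsProbabilityMeasure μ] (x0 : X)
    (hx0 : μ (Set.range fun h : H => h • x0) = 1)
    (hinv : ∀ l : H, MeasurePreserving (fun x : X => l • x) μ μ)
    (hunif : ∀ z : X, ∃ V ∈ 𝓝 (1 : H), ∃ Z ∈ 𝓝 z, ∀ y ∈ Z, Set.InjOn (fun h : H => h • y) V) :
    IsClosed (Set.range fun h : H => h • x0) := by
  obtain ⟨V0, hV0, Z0, hZ0, hVi0⟩ := hunif x0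
  have hVi := hVi0 x0 (mem_of_mem_nhds hZ0)
  haveI := stab_countable x0 V0 hV0 hVi
  obtain ⟨ς, hςm, hς⟩ := exists_section x0 V0 hV0 hVi
  have hx0' : μ (Set.range fun h : H => h • x0)ᶜ = 0 := (prob_compl_eq_zero_iff (orbit_meas x0)).2 hx0
  have hmod := mt_unimod μ x0 ς hςm hς hx0' hinv V0 hV0 hVi
  haveI := mt_haar μ x0 ς hςm hς hx0' hinv V0 hV0 hVi
  rw [← closure_subset_iff_isClosed]
  intro z hz
  by_contra hzn
  obtain ⟨V, hV, Z, hZ, hVZ⟩ := hunif z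
  obtain ⟨K, hK1, hKV, hKc⟩ := local_compact_nhds hV
  set C := mtt μ x0 ς K with hC
  have hC0 : C ≠ 0 := (Measure.measure_pos_of_mem_nhds _ hK1).ne'
  have hmeas : ∀ y ∈ Z, y ∈ (Set.range fun h : H => h • x0) → C ≤ μ ((fun h : H => h • y) '' K) := by
    rintro _ hyZ ⟨l, rfl⟩
    have hKl : IsCompact ((fun h => h * l) '' K) := hKc.image (continuous_mul_const l)
    have e1 : mtt μ x0 ς ((fun h => h * l) '' K) = C := by
      have := mod_spec (mtt μ x0 ς) l _ hKl.measurableSet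
      rw [hmod, ENNReal.coe_one, one_mul, Set.preimage_image_eq _ (mul_left_injective l)] at this
      exact this.symm
    have e2 : (fun h : H => h • l • x0) '' K = (fun h : H => h • x0) '' ((fun h => h * l) '' K) := by
      rw [Set.image_image]; simp only [mul_smul]
    rw [e2, ← e1]
    refine mt_inj μ x0 ς hςm hς hx0' _ hKl ?_
    rintro _ ⟨a, ha, rfl⟩ _ ⟨b, hb, rfl⟩ hab
    simp only [mul_smul] at hab
    rw [hVZ _ hyZ (hKV ha) (hKV hb) hab]
  have hmis : ∀ F : Finset X, (∀ y ∈ F, y ∈ Set.range fun h : H => h • x0) →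
      ∃ y ∈ Z, y ∈ (Set.range fun h : H => h • x0) ∧ ∀ y' ∈ F,
        Disjoint ((fun h : H => h • y) '' K) ((fun h : H => h • y') '' K) := by
    intro F hF
    have hM : ∀ y' ∈ F, ((fun p : H × H => (p.1⁻¹ * p.2) • y') '' (K ×ˢ K))ᶜ ∈ 𝓝 z := by
      intro y' hy'
      have hc : Continuous fun p : H × H => (p.1⁻¹ * p.2) • y' :=
        (continuous_fst.inv.mul continuous_snd).smul continuous_const
      refine ((hKc.prod hKc).image hc).isClosed.isOpen_compl.mem_nhds ?_
      rintro ⟨p, _, hp⟩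
      obtain ⟨h, rfl⟩ := hF y' hy'
      exact hzn ⟨p.1⁻¹ * p.2 * h, by rw [← hp]; simp [mul_smul]⟩
    have hM2 := inter_mem hZ ((biInter_finset_mem F).2 hM)
    obtain ⟨y, hy1, hy2⟩ := mem_closure_iff_nhds.1 hz _ hM2
    refine ⟨y, hy1.1, hy2, fun y' hy' => Set.disjoint_left.2 ?_⟩
    rintro _ ⟨a, ha, rfl⟩ ⟨b, hb, hab⟩
    have := Set.mem_iInter₂.1 hy1.2 y' hy'
    refine this ⟨(a, b), ⟨ha, hb⟩, ?_⟩
    simp only at hab ⊢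
    rw [mul_smul, hab, inv_smul_smul]
  have hKne : K.Nonempty := ⟨1, mem_of_mem_nhds hK1⟩
  have hind : ∀ k : ℕ, ∃ F : Finset X, F.card = k ∧ (∀ y ∈ F, y ∈ Z ∧ y ∈ Set.range fun h : H => h • x0) ∧
      (F : Set X).PairwiseDisjoint fun y => (fun h : H => h • y) '' K := by
    classical
    intro k
    induction k with
    | zero => exact ⟨∅, rfl, by simp, by simp⟩
    | succ k ih =>
      obtain ⟨F, hF1, hF2, hF3⟩ := ih
      obtain ⟨y, hyZ, hyo, hyd⟩ := hmis F fun y hy => (hF2 y hy).2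
      have hyF : y ∉ F := fun h => by
        have := hyd y h
        rw [Set.disjoint_iff_inter_eq_empty, Set.inter_self] at this
        exact (hKne.image _).ne_empty this
      refine ⟨insert y F, by rw [Finset.card_insert_of_notMem hyF, hF1], ?_, ?_⟩
      · intro y' hy'
        rcases Finset.mem_insert.1 hy' with rfl | h
        · exact ⟨hyZ, hyo⟩
        · exact hF2 y' h
      · rw [Finset.coe_insert]
        exact hF3.insert fun y' hy' _ => hyd y' hy'
  have hbd : ∀ k : ℕ, (k : ℝ≥0∞) * C ≤ 1 := by
    intro k
    obtain ⟨F, hF1, hF2, hF3⟩ := hind k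
    calc (k : ℝ≥0∞) * C = ∑ y ∈ F, C := by simp [hF1]
      _ ≤ ∑ y ∈ F, μ ((fun h : H => h • y) '' K) := Finset.sum_le_sum fun y hy => hmeas y (hF2 y hy).1 (hF2 y hy).2
      _ = μ (⋃ y ∈ F, (fun h : H => h • y) '' K) :=
        (measure_biUnion_finset hF3 fun y _ => (hKc.image (pi_cont y)).measurableSet).symm
      _ ≤ 1 := prob_le_one
  obtain ⟨k, hk⟩ := ENNReal.exists_nat_mul_gt hC0 ENNReal.one_ne_top
  exact absurd (hbd k) (not_le.2 hk)

end P23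

section P24
variable {G : Type*} [Group G] [TopologicalSpace G] [IsTopologicalGroup G] [T2Space G]
  (Γ : Subgroup G) [DiscreteTopology Γ]

theorem quo_t2 : T2Space (G ⧸ Γ) := by
  have hcl : IsClosed (Γ : Set G) := Subgroup.isClosed_of_discrete
  have hq : IsOpenQuotientMap (QuotientGroup.mk : G → G ⧸ Γ) := QuotientGroup.isOpenQuotientMap_mk
  rw [t2Space_iff_of_isOpenQuotientMap hq]
  have : {q : G × G | (QuotientGroup.mk q.1 : G ⧸ Γ) = QuotientGroup.mk q.2} = (fun q : G × G => q.1⁻¹ * q.2) ⁻¹' (Γ : Set G) := by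
    ext q
    exact QuotientGroup.eq
  rw [this]
  exact hcl.preimage (by fun_prop)

omit [T2Space G] [DiscreteTopology Γ] in
theorem quo_open (x : G ⧸ Γ) (V : Set G) (hV : V ∈ 𝓝 (1 : G)) : (fun g : G => g • x) '' V ∈ 𝓝 x := by
  obtain ⟨g, rfl⟩ := QuotientGroup.mk_surjective x
  have h1 : (fun h => h * g⁻¹) ⁻¹' V ∈ 𝓝 g :=
    (continuous_mul_const g⁻¹).continuousAt.preimage_mem_nhds (by simpa using hV)
  have h2 := (QuotientGroup.isOpenMap_coe (N := Γ)).image_mem_nhds h1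
  refine mem_of_superset h2 ?_
  rintro _ ⟨h, hh, rfl⟩
  refine ⟨h * g⁻¹, hh, ?_⟩
  change ((h * g⁻¹ * g : G) : G ⧸ Γ) = h
  simp

omit [T2Space G] in
theorem quo_unif (z : G ⧸ Γ) : ∃ V ∈ 𝓝 (1 : G), ∃ Z ∈ 𝓝 z, ∀ y ∈ Z, Set.InjOn (fun h : G => h • y) V := by
  obtain ⟨g, rfl⟩ := QuotientGroup.mk_surjective z
  obtain ⟨W, hW, hW1⟩ : ∃ W ∈ 𝓝 (1 : G), ∀ γ ∈ Γ, γ ∈ W → γ = 1 := by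
    have : ({1} : Set Γ) ∈ 𝓝 (1 : Γ) := (isOpen_discrete _).mem_nhds rfl
    obtain ⟨W, hW, h⟩ := mem_nhds_subtype _ _ _ |>.1 this
    exact ⟨W, hW, fun γ hγ hγW => congrArg Subtype.val (h (show (⟨γ, hγ⟩ : Γ) ∈ _ from hγW))⟩
  have hc : Continuous fun p : (G × G) × G => p.2⁻¹ * (p.1.2⁻¹ * p.1.1) * p.2 := by fun_prop
  have h1 : (fun p : (G × G) × G => p.2⁻¹ * (p.1.2⁻¹ * p.1.1) * p.2) ⁻¹' W ∈ 𝓝 (((1 : G), (1 : G)), g) :=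
    hc.continuousAt.preimage_mem_nhds (by simpa using hW)
  rw [nhds_prod_eq, nhds_prod_eq] at h1
  obtain ⟨VV, hVV, N, hN, hsub⟩ := mem_prod_iff.1 h1
  obtain ⟨V, hV, hV2⟩ := mem_prod_same_iff.1 hVV
  refine ⟨V, hV, QuotientGroup.mk '' N, (QuotientGroup.isOpenMap_coe (N := Γ)).image_mem_nhds hN, ?_⟩
  rintro _ ⟨k, hk, rfl⟩ a ha b hb hab
  have hab2 : ((b * k : G) : G ⧸ Γ) = (a * k : G) := hab.symm
  have h3 := QuotientGroup.eq.1 hab2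
  have h4 : k⁻¹ * (b⁻¹ * a) * k ∈ W := hsub (show ((a, b), k) ∈ VV ×ˢ N from ⟨hV2 ⟨ha, hb⟩, hk⟩)
  have h5 : (b * k)⁻¹ * (a * k) = k⁻¹ * (b⁻¹ * a) * k := by group
  rw [h5] at h3
  have h6 := hW1 _ h3 h4
  have h7 : b⁻¹ * a = 1 := by
    have : k⁻¹ * (b⁻¹ * a) = k⁻¹ := mul_eq_one_iff_eq_inv.1 h6
    exact mul_eq_left.1 this
  exact (inv_mul_eq_one.1 h7).symm

end P24

/-- **Dani**: measure classification for the maximal unipotent subgroup `U = 𝕌ₙ`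
acting on `G/Γ`, `Γ` a lattice in `G = SL(n,ℝ)`: every ergodic `U`-invariant
probability measure is a homogeneous measure supported on a closed orbit `L·a`. -/
theorem dani_horospherical_measure_classification (n : ℕ)
    (U : Subgroup (SL(n, ℝ)))
    (hU : ∀ v : SL(n, ℝ), v ∈ U ↔
      ((∀ i : Fin n, (v : Matrix (Fin n) (Fin n) ℝ) i i = 1) ∧
        ∀ i j : Fin n, j < i → (v : Matrix (Fin n) (Fin n) ℝ) i j = 0))
    (Γ : Subgroup (SL(n, ℝ))) [DiscreteTopology Γ]
    [BorelSpace (SL(n, ℝ) ⧸ Γ)]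
    (μHaar : Measure (SL(n, ℝ))) (hμHaar : μHaar.IsHaarMeasure)
    (F : Set (SL(n, ℝ))) (hFmeas : MeasurableSet F)
    (hFfund : ∀ g : SL(n, ℝ), ∃! h : SL(n, ℝ), h ∈ F ∧ ∃ γ ∈ Γ, g * γ = h)
    (hFvol : μHaar F < ⊤)
    (μ : Measure (SL(n, ℝ) ⧸ Γ)) [IsProbabilityMeasure μ]
    (hinv : ∀ v ∈ U, MeasurePreserving (fun x : SL(n, ℝ) ⧸ Γ => v • x) μ μ)
    (herg : ∀ A : Set (SL(n, ℝ) ⧸ Γ), MeasurableSet A →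
      (∀ v ∈ U, (fun x : SL(n, ℝ) ⧸ Γ => v • x) ⁻¹' A = A) → μ A = 0 ∨ μ A = 1) :
    ∃ (L : Subgroup (SL(n, ℝ))) (a : SL(n, ℝ) ⧸ Γ),
      IsClosed (L : Set (SL(n, ℝ))) ∧
      IsClosed {x : SL(n, ℝ) ⧸ Γ | ∃ l ∈ L, l • a = x} ∧
      μ {x : SL(n, ℝ) ⧸ Γ | ∃ l ∈ L, l • a = x} = 1 ∧
      ∀ l ∈ L, MeasurePreserving (fun x : SL(n, ℝ) ⧸ Γ => l • x) μ μ := by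
  have hUU : U = UU n := by
    ext v
    rw [hU, mem_UU]
  subst hUU
  haveI : T2Space (SL(n, ℝ) ⧸ Γ) := quo_t2 Γ
  haveI : LocallyCompactSpace (SL(n, ℝ) ⧸ Γ) := inferInstance
  haveI : SecondCountableTopology (SL(n, ℝ) ⧸ Γ) := inferInstance
  haveI : ContinuousSMul (SL(n, ℝ)) (SL(n, ℝ) ⧸ Γ) := inferInstance
  obtain ⟨x0, hx0⟩ := A8 μ hinv herg (fun x => by
    obtain ⟨V, hV, Z, hZ, h⟩ := quo_unif Γ x
    exact ⟨V, hV, h x (mem_of_mem_nhds hZ)⟩) (quo_open Γ)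
  have hL : IsClosed (Lst (SL(n, ℝ)) μ : Set (SL(n, ℝ))) := Lst_closed μ
  refine ⟨Lst (SL(n, ℝ)) μ, x0, hL, ?_, hx0, fun l hl => hl⟩
  haveI : LocallyCompactSpace (Lst (SL(n, ℝ)) μ) := hL.isClosedEmbedding_subtypeVal.locallyCompactSpace
  haveI : SecondCountableTopology (Lst (SL(n, ℝ)) μ) :=
    TopologicalSpace.Subtype.secondCountableTopology (Lst (SL(n, ℝ)) μ : Set (SL(n, ℝ)))
  haveI : ContinuousSMul (Lst (SL(n, ℝ)) μ) (SL(n, ℝ) ⧸ Γ) := ⟨by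
    have h : Continuous fun p : SL(n, ℝ) × (SL(n, ℝ) ⧸ Γ) => p.1 • p.2 := continuous_smul
    exact h.comp (continuous_subtype_val.prodMap continuous_id)⟩
  rw [sub_orbit] at hx0 ⊢
  refine A9 μ x0 hx0 (fun l => l.2) fun z => ?_
  obtain ⟨V, hV, Z, hZ, h⟩ := quo_unif Γ z
  exact ⟨Subtype.val ⁻¹' V, continuous_subtype_val.continuousAt.preimage_mem_nhds hV, Z, hZ,
    fun y hy a ha b hb hab => Subtype.ext (h y hy ha hb hab)⟩
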